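/- arXiv:2507.20416 — 2 statements merged into one kernel-verified Lean document; each statement's English description precedes it below -/
import Mathlib

section
/- Let k ≥ 2, n = k(k+1)/2, and let α be an n-tuple of pairwise independent irrational numbers with k(α) = k. Then there exists T > 1 such that for every t_0 ≥ T, with the functions enumerated as ψ_{i,j} according to their decreasing order at t_0 and {t_m} the sequence of moments of permutation changes: for all 1 ≤ i ≤ k and all s ≥ 0, the k functions taking the k largest values at t_{i−1+ks} are exactly the functions that are discontinuous at t_{i+ks}, and ψ_{i,i} is the largest of all n functions at t_{i−1+ks}. -/
/-- Distance from `x` to the nearest integer. -/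
noncomputable def distToInt (x : ℝ) : ℝ := |x - round x|

/-- The irrationality measure function `ψ_α(t) = min_{1 ≤ q ≤ t} ‖qα‖`. -/
noncomputable def psi (α : ℝ) (t : ℝ) : ℝ :=
  sInf ((fun q : ℤ => distToInt ((q : ℝ) * α)) '' {q : ℤ | 1 ≤ q ∧ (q : ℝ) ≤ t})

/-- An `n`-tuple is pairwise independent if eventually all the values
`ψ_{α_i}(t)` are pairwise distinct. -/
def PairwiseIndependent {n : ℕ} (α : Fin n → ℝ) : Prop :=
  ∃ T : ℝ, 0 ≤ T ∧ ∀ t : ℝ, T ≤ t → ∀ i j : Fin n, i ≠ j → psi (α i) t ≠ psi (α j) t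

/-- `v : Fin n → Fin n` is the order vector of `α` at time `t`:
`ψ_{α_{v 0}}(t) > ψ_{α_{v 1}}(t) > … > ψ_{α_{v (n-1)}}(t)`. -/
def IsOrderVec {n : ℕ} (α : Fin n → ℝ) (t : ℝ) (v : Fin n → Fin n) : Prop :=
  Function.Bijective v ∧
    ∀ p q : Fin n, p < q → psi (α (v p)) t > psi (α (v q)) t

/-- The order vector `v` occurs at arbitrarily large times. -/
def OccursInfinitely {n : ℕ} (α : Fin n → ℝ) (v : Fin n → Fin n) : Prop :=
  ∀ T : ℝ, ∃ t : ℝ, T < t ∧ IsOrderVec α t v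

/-- `k(α)`: the number of distinct order vectors occurring for arbitrarily large `t`. -/
noncomputable def kAlpha {n : ℕ} (α : Fin n → ℝ) : ℕ :=
  Nat.card {v : Fin n → Fin n | OccursInfinitely α v}

/-- The relative order of the functions `ψ_{α_i}` is the same at times `t` and `t'`
(i.e. the order vectors coincide). -/
def SameOrder {n : ℕ} (α : Fin n → ℝ) (t t' : ℝ) : Prop :=
  ∀ i j : Fin n, (psi (α i) t < psi (α j) t ↔ psi (α i) t' < psi (α j) t')

/-- `ts` is a sequence of moments of permutation changes:
`ts (i+1) = min { t > ts i : v_α(t) ≠ v_α(ts i) }`. -/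
def IsChangeSeq {n : ℕ} (α : Fin n → ℝ) (ts : ℕ → ℝ) : Prop :=
  ∀ i : ℕ, IsLeast {t : ℝ | ts i < t ∧ ¬ SameOrder α (ts i) t} (ts (i + 1))

/-- The set of positions `(j,l)`, `1 ≤ j ≤ l ≤ k` (here `0`-based). -/
def PairIdx (k : ℕ) := {p : Fin k × Fin k // p.1 ≤ p.2}

/-- Construct a position from `0`-based indices `j ≤ l < k`. -/
def mkPos {k : ℕ} (j l : ℕ) (hj : j ≤ l) (hl : l < k) : PairIdx k :=
  ⟨(⟨j, lt_of_le_of_lt hj hl⟩, ⟨l, hl⟩), Fin.mk_le_mk.mpr hj⟩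

/-- The position permutation underlying `π`: one has `π(u) = u ∘ tau`.
In `1`-based notation: `tau (i,i) = (i+1,i+1)` for `i < k`, `tau (k,k) = (1,1)`,
`tau (i,k) = (1,i+1)` for `i < k`, and `tau (i,j) = (i+1,j+1)` otherwise. -/
def tau {k : ℕ} (p : PairIdx k) : PairIdx k :=
  if h2 : p.1.2.val = k - 1 then
    if h1 : p.1.1.val = k - 1 then
      ⟨(⟨0, by have := p.1.2.isLt; omega⟩, ⟨0, by have := p.1.2.isLt; omega⟩), le_refl _⟩
    else
      ⟨(⟨0, by have := p.1.2.isLt; omega⟩,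
        ⟨p.1.1.val + 1, by have := p.1.1.isLt; omega⟩),
       Fin.mk_le_mk.mpr (by omega)⟩
  else
    ⟨(⟨p.1.1.val + 1, by have h := p.1.2.isLt; have h' : p.1.1.val ≤ p.1.2.val := p.2; omega⟩,
      ⟨p.1.2.val + 1, by have h := p.1.2.isLt; omega⟩),
     Fin.mk_le_mk.mpr (by have h' : p.1.1.val ≤ p.1.2.val := p.2; omega)⟩

/-- The action of `π` on vectors indexed by positions: `π(u) = u ∘ tau`. -/
def piMap {k : ℕ} {X : Type*} (u : PairIdx k → X) : PairIdx k → X :=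
  fun p => u (tau p)

/-- The (`0`-based) linear position of the pair `(j,l)` in the special enumeration
`u_{1,1}, u_{1,k}, u_{1,k-1}, …, u_{1,2}, u_{2,2}, u_{2,k}, …, u_{k,k}`. -/
def posIdx {k : ℕ} (p : PairIdx k) : ℕ :=
  (p.1.1.val * k - p.1.1.val * (p.1.1.val - 1) / 2) +
    (if p.1.2.val = p.1.1.val then 0 else k - p.1.2.val)

/-- `v : PairIdx k → Fin n` is the order vector of `α` at time `t`, written in the
special pair enumeration: the function at position `p` is larger than the one at
position `q` whenever `p` precedes `q` in the enumeration. -/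
def IsOrderVecP {n k : ℕ} (α : Fin n → ℝ) (t : ℝ) (v : PairIdx k → Fin n) : Prop :=
  Function.Bijective v ∧
    ∀ p q : PairIdx k, posIdx p < posIdx q → psi (α (v p)) t > psi (α (v q)) t

/-- Denominator `q_m` of the `m`-th convergent of the continued fraction of `α`. -/
noncomputable def cfDen (α : ℝ) (m : ℕ) : ℝ := (GenContFract.of α).dens m

/-- The orbit equivalence relation of the map `tau` on positions. -/
def orbitSetoid (k : ℕ) : Setoid (PairIdx k) where
  r p q := ∃ a b : ℕ, (fun x : PairIdx k => tau x)^[a] p = (fun x : PairIdx k => tau x)^[b] q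
  iseqv := by
    constructor
    · exact fun p => ⟨0, 0, rfl⟩
    · rintro p q ⟨a, b, h⟩; exact ⟨b, a, h.symm⟩
    · rintro p q r ⟨a, b, h1⟩ ⟨c, d, h2⟩
      refine ⟨c + a, b + d, ?_⟩
      rw [Function.iterate_add_apply, h1, ← Function.iterate_add_apply,
        Nat.add_comm c b, Function.iterate_add_apply, h2, ← Function.iterate_add_apply]

lemma distToInt_le (x : ℝ) (m : ℤ) : distToInt x ≤ |x - m| := round_le x m

lemma distToInt_add_int (x : ℝ) (m : ℤ) : distToInt (x + m) = distToInt x := by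
  simp [distToInt, round_add_intCast]

lemma distToInt_neg (x : ℝ) : distToInt (-x) = distToInt x := by
  have key : ∀ y : ℝ, distToInt (-y) ≤ distToInt y := fun y => by
    have h := distToInt_le (-y) (-round y)
    push_cast at h
    rwa [show -y - -(round y : ℝ) = -(y - round y) by ring, abs_neg] at h
  refine le_antisymm (key x) ?_
  simpa using key (-x)

/-- The irrationality measure function restricted to `ℕ`, with the convention `ψ(0) = 1`. -/
noncomputable def dpsi (α : ℝ) (N : ℕ) : ℝ := if N = 0 then 1 else psi α N

/-- `v` has a (downward) jump at `N`. -/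
def Jm (v : ℕ → ℝ) (N : ℕ) : Prop := v N < v (N - 1)

/-- `a < b` are consecutive jumps of `v`. -/
def Cons (v : ℕ → ℝ) (a b : ℕ) : Prop :=
  Jm v a ∧ Jm v b ∧ a < b ∧ ∀ c, a < c → c < b → ¬ Jm v c

/-- The abstract properties of an irrationality measure function. -/
structure IMF (v : ℕ → ℝ) : Prop where
  pos : ∀ N, 0 < v N
  anti : Antitone v
  jump_one : Jm v 1
  jump_inf : ∀ N, ∃ M, N < M ∧ Jm v M
  cons_det : ∀ a b, Cons v a b → b * v a + a * v b = 1
  cons_add : ∀ a b c, Cons v a b → Cons v b c →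
    ∃ m : ℕ, 1 ≤ m ∧ c = m * b + a ∧ v a = m * v b + v c
  jump_det : ∀ a b, Jm v a → Jm v b → a < b →
    ∃ D : ℤ, 1 ≤ D ∧ ((D : ℝ) = b * v a + a * v b ∨ (D : ℝ) = b * v a - a * v b)
  cons_coprime : ∀ a b, Cons v a b → Nat.Coprime a b

lemma psi_bddBelow (α t : ℝ) :
    BddBelow ((fun q : ℤ => distToInt ((q : ℝ) * α)) '' {q : ℤ | 1 ≤ q ∧ (q : ℝ) ≤ t}) :=
  ⟨0, by rintro _ ⟨q, -, rfl⟩; exact abs_nonneg _⟩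

lemma psi_floor (α : ℝ) {t : ℝ} (ht : 0 ≤ t) : psi α t = psi α (⌊t⌋₊ : ℕ) := by
  unfold psi
  congr 2
  ext q
  refine and_congr_right fun hq => ?_
  lift q to ℕ using by omega
  simp only [Int.cast_natCast, Nat.cast_le]
  exact (Nat.le_floor_iff ht).symm

lemma psi_eq_dpsi (α : ℝ) {t : ℝ} (ht : 1 ≤ t) : psi α t = dpsi α ⌊t⌋₊ := by
  rw [dpsi, if_neg (by have := Nat.floor_pos.2 ht; omega), ← psi_floor α (by linarith)]

lemma dpsi_le (α : ℝ) {q N : ℕ} (hq : 1 ≤ q) (hN : q ≤ N) : dpsi α N ≤ distToInt (q * α) := by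
  rw [dpsi, if_neg (by omega)]
  refine csInf_le (psi_bddBelow _ _) ⟨q, ⟨by exact_mod_cast hq, by exact_mod_cast hN⟩, by simp⟩

lemma dpsi_mem (α : ℝ) {N : ℕ} (hN : 1 ≤ N) :
    ∃ q : ℕ, 1 ≤ q ∧ q ≤ N ∧ dpsi α N = distToInt (q * α) := by
  rw [dpsi, if_neg (by omega)]
  set S : Set ℤ := {q : ℤ | 1 ≤ q ∧ (q : ℝ) ≤ (N : ℝ)}
  have hS : S.Finite := by
    refine (Set.finite_Icc (1 : ℤ) N).subset fun q hq => ⟨hq.1, ?_⟩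
    exact_mod_cast hq.2
  have hne : ((fun q : ℤ => distToInt ((q : ℝ) * α)) '' S).Nonempty :=
    ⟨_, 1, ⟨le_rfl, by exact_mod_cast hN⟩, rfl⟩
  obtain ⟨q, hq, h⟩ := hne.csInf_mem (hS.image _)
  have h1 := hq.1
  have h2 : q ≤ N := by exact_mod_cast hq.2
  lift q to ℕ using by omega
  exact ⟨q, by omega, by omega, by simpa [psi] using h.symm⟩

lemma dpsi_congr {α β : ℝ} (h : ∀ q : ℕ, distToInt (q * α) = distToInt (q * β)) :
    dpsi α = dpsi β := by
  ext N
  rcases Nat.eq_zero_or_pos N with rfl | hN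
  · simp [dpsi]
  · obtain ⟨q, h1, h2, h3⟩ := dpsi_mem α hN
    obtain ⟨r, h4, h5, h6⟩ := dpsi_mem β hN
    refine le_antisymm ?_ ?_
    · rw [h6, ← h]; exact dpsi_le α h4 h5
    · rw [h3, h]; exact dpsi_le β h1 h2

lemma distToInt_le_half (x : ℝ) : distToInt x ≤ 1 / 2 := abs_sub_round x

lemma dpsi_anti (α : ℝ) : Antitone (dpsi α) := by
  intro M N h
  rcases Nat.eq_zero_or_pos M with rfl | hM
  · rcases Nat.eq_zero_or_pos N with rfl | hN
    · exact le_rfl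
    · have := (dpsi_le α le_rfl hN).trans (distToInt_le_half _)
      have : dpsi α 0 = 1 := by simp [dpsi]
      linarith
  · obtain ⟨q, h1, h2, h3⟩ := dpsi_mem α hM
    rw [h3]
    exact dpsi_le α h1 (h2.trans h)

/-- At a jump the value is attained by the jump point itself. -/
lemma Jm.eq {α : ℝ} {N : ℕ} (h : Jm (dpsi α) N) : 1 ≤ N ∧ dpsi α N = distToInt (N * α) := by
  have hN : 1 ≤ N := by
    by_contra h0
    obtain rfl : N = 0 := by omega
    exact lt_irrefl _ h
  refine ⟨hN, ?_⟩
  obtain ⟨q, h1, h2, h3⟩ := dpsi_mem α hN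
  rcases h2.lt_or_eq with h4 | rfl
  · have := dpsi_le α h1 (show q ≤ N - 1 by omega)
    unfold Jm at h
    linarith
  · exact h3

lemma irr_sub_ne {α : ℝ} (hα : Irrational α) {q : ℕ} (hq : 1 ≤ q) (p r : ℚ) :
    (q : ℝ) * α - p ≠ r := by
  intro h
  have : Irrational ((q : ℝ) * α) := hα.natCast_mul (by omega)
  exact this ⟨p + r, by push_cast; linarith⟩

lemma distToInt_pos {α : ℝ} (hα : Irrational α) {q : ℕ} (hq : 1 ≤ q) :
    0 < distToInt (q * α) := by
  refine abs_pos.2 ?_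
  have := irr_sub_ne hα hq (round ((q : ℝ) * α)) 0
  simpa using this

lemma dpsi_pos {α : ℝ} (hα : Irrational α) (N : ℕ) : 0 < dpsi α N := by
  rcases Nat.eq_zero_or_pos N with rfl | hN
  · simp [dpsi]
  · obtain ⟨q, h1, -, h3⟩ := dpsi_mem α hN
    rw [h3]; exact distToInt_pos hα h1

lemma dpsi_dirichlet {α : ℝ} (hα : Irrational α) {N : ℕ} (hN : 1 ≤ N) :
    (N + 1 : ℝ) * dpsi α N < 1 := by
  obtain ⟨j, k, hk, hkN, h⟩ := Real.exists_int_int_abs_mul_sub_le α (n := N) (by omega)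
  lift k to ℕ using by omega
  have h1 := (dpsi_le α (show 1 ≤ k by omega) (by exact_mod_cast hkN)).trans
    (distToInt_le ((k : ℝ) * α) j)
  have hpos : (0 : ℝ) < N + 1 := by positivity
  rw [← lt_div_iff₀' hpos]
  refine h1.trans_lt (lt_of_le_of_ne (by simpa using h) fun he => ?_)
  rcases abs_eq (by positivity : (0:ℝ) ≤ 1 / (N + 1)) |>.1 he with h2 | h2
  · exact irr_sub_ne hα (show 1 ≤ k by omega) j (1 / (N + 1)) (by push_cast; exact h2)
  · exact irr_sub_ne hα (show 1 ≤ k by omega) j (-(1 / (N + 1))) (by push_cast; exact h2)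

lemma const_of_no_jump {v : ℕ → ℝ} (hv : Antitone v) {a b : ℕ} (hab : a ≤ b)
    (h : ∀ c, a < c → c ≤ b → ¬ Jm v c) : v b = v a := by
  induction b, hab using Nat.le_induction with
  | base => rfl
  | succ b hb ih =>
    rw [← ih fun c h1 h2 => h c h1 (by omega)]
    exact le_antisymm (hv (Nat.le_succ b)) (not_lt.1 (h (b + 1) (by omega) le_rfl))

lemma Cons.eq_of_mem {v : ℕ → ℝ} (hv : Antitone v) {a b c : ℕ} (h : Cons v a b)
    (h1 : a ≤ c) (h2 : c < b) : v c = v a :=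
  const_of_no_jump hv h1 fun d hd hd' => h.2.2.2 d hd (by omega)

lemma dpsi_cons {α : ℝ} (hα : Irrational α) {a b : ℕ} (h : Cons (dpsi α) a b) :
    b * dpsi α a < 1 ∧ dpsi α b < dpsi α a := by
  obtain ⟨ha, -⟩ := h.1.eq
  have hab := h.2.2.1
  have h1 := h.eq_of_mem (dpsi_anti α) (c := b - 1) (by omega) (by omega)
  have h2 := dpsi_dirichlet hα (show 1 ≤ b - 1 by omega)
  have hJ := h.2.1
  unfold Jm at hJ
  rw [h1] at h2 hJ
  refine ⟨?_, hJ⟩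
  have : ((b - 1 : ℕ) : ℝ) + 1 = b := by exact_mod_cast (by omega : b - 1 + 1 = b)
  rwa [this] at h2

/-- The numerators attached to consecutive jumps. -/
lemma dpsi_cons_num {α : ℝ} (hα : Irrational α) {a b : ℕ} (h : Cons (dpsi α) a b) :
    ∃ s : ℤ, (s = 1 ∨ s = -1) ∧ a * round ((b : ℝ) * α) - b * round ((a : ℝ) * α) = s ∧
      (a : ℝ) * α - round ((a : ℝ) * α) = s * dpsi α a ∧
      (b : ℝ) * α - round ((b : ℝ) * α) = -(s * dpsi α b) := by
  obtain ⟨h1, h2⟩ := dpsi_cons hα h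
  obtain ⟨ha, ea⟩ := h.1.eq
  obtain ⟨hb, eb⟩ := h.2.1.eq
  have pa := dpsi_pos hα a
  have pb := dpsi_pos hα b
  have hab : (a : ℝ) < b := by exact_mod_cast h.2.2.1
  have ha' : (1 : ℝ) ≤ a := by exact_mod_cast ha
  unfold distToInt at ea eb
  set p := round ((a : ℝ) * α)
  set p' := round ((b : ℝ) * α)
  set x := dpsi α a
  set y := dpsi α b
  have hD : ((a * p' - b * p : ℤ) : ℝ) = b * ((a : ℝ) * α - p) - a * ((b : ℝ) * α - p') := by
    push_cast; ring
  have m1 : (a : ℝ) * y < 1 := by nlinarith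
  have m2 : (a : ℝ) * y < b * x := by nlinarith
  have m3 : 0 < (a : ℝ) * y := by nlinarith
  have int1 : ∀ D : ℤ, (D : ℝ) < 2 → 0 < (D : ℝ) → D = 1 := fun D u1 u2 => by
    have : D < 2 := by exact_mod_cast u1
    have : 0 < D := by exact_mod_cast u2
    omega
  have int2 : ∀ D : ℤ, -2 < (D : ℝ) → (D : ℝ) < 0 → D = -1 := fun D u1 u2 => by
    have : -2 < D := by exact_mod_cast u1
    have : D < 0 := by exact_mod_cast u2
    omega
  rcases (abs_eq pa.le).1 ea.symm with e1 | e1 <;> rcases (abs_eq pb.le).1 eb.symm with e2 | e2 <;>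
    rw [e1, e2] at hD
  · have := int1 _ (by rw [hD]; linarith) (by rw [hD]; linarith)
    rw [this] at hD; push_cast at hD; linarith
  · refine ⟨1, Or.inl rfl, int1 _ ?_ ?_, by rw [e1]; simp, by rw [e2]; simp⟩ <;> rw [hD] <;> linarith
  · refine ⟨-1, Or.inr rfl, int2 _ ?_ ?_, by rw [e1]; simp, by rw [e2]; simp⟩ <;> rw [hD] <;> linarith
  · have := int2 _ (by rw [hD]; linarith) (by rw [hD]; linarith)
    rw [this] at hD; push_cast at hD; linarith

lemma dpsi_cons_det {α : ℝ} (hα : Irrational α) {a b : ℕ} (h : Cons (dpsi α) a b) :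
    b * dpsi α a + a * dpsi α b = 1 := by
  obtain ⟨s, hs, h1, h2, h3⟩ := dpsi_cons_num hα h
  have h1' : (a : ℝ) * round ((b : ℝ) * α) - b * round ((a : ℝ) * α) = s := by exact_mod_cast h1
  have : (s : ℝ) * (b * dpsi α a + a * dpsi α b) = s := by
    linear_combination h1' - (b : ℝ) * h2 + a * h3
  rcases hs with rfl | rfl <;> push_cast at this <;> linarith

lemma dpsi_cons_coprime {α : ℝ} (hα : Irrational α) {a b : ℕ} (h : Cons (dpsi α) a b) :
    Nat.Coprime a b := by
  obtain ⟨s, hs, h1, -⟩ := dpsi_cons_num hα h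
  rw [← Nat.isCoprime_iff_coprime]
  rcases hs with rfl | rfl
  · exact ⟨round ((b : ℝ) * α), -round ((a : ℝ) * α), by linarith⟩
  · exact ⟨-round ((b : ℝ) * α), round ((a : ℝ) * α), by linarith⟩

lemma dpsi_cons_add {α : ℝ} (hα : Irrational α) {a b c : ℕ} (h : Cons (dpsi α) a b)
    (h' : Cons (dpsi α) b c) :
    ∃ m : ℕ, 1 ≤ m ∧ c = m * b + a ∧ dpsi α a = m * dpsi α b + dpsi α c := by
  obtain ⟨s, hs, h1, h2, h3⟩ := dpsi_cons_num hα h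
  obtain ⟨r, hr, g1, g2, g3⟩ := dpsi_cons_num hα h'
  have hab := h.2.2.1
  have hbc := h'.2.2.1
  have hsr : r = -s := by
    have h0 : (r + s : ℝ) * dpsi α b = 0 := by linarith
    have h4 : (r + s : ℝ) = 0 := by
      rcases mul_eq_zero.1 h0 with h4 | h4
      · exact h4
      · exact absurd h4 (dpsi_pos hα b).ne'
    have : r + s = 0 := by exact_mod_cast h4
    linarith
  have hdvd : (b : ℤ) ∣ ((c : ℤ) - a) := by
    have hcop : IsCoprime (b : ℤ) (round ((b : ℝ) * α)) := by
      rcases hs with rfl | rfl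
      · exact ⟨-round ((a : ℝ) * α), a, by linarith⟩
      · exact ⟨round ((a : ℝ) * α), -a, by linarith⟩
    refine hcop.dvd_of_dvd_mul_right ⟨round ((c : ℝ) * α) - round ((a : ℝ) * α), ?_⟩
    rw [hsr] at g1
    linarith
  obtain ⟨m, hm⟩ := hdvd
  have hb : 0 < (b : ℤ) := by omega
  have hm1 : 0 < m := by
    by_contra h0
    have : (b : ℤ) * m ≤ 0 := mul_nonpos_of_nonneg_of_nonpos hb.le (by omega)
    omega
  lift m to ℕ using hm1.le
  have hc : c = m * b + a := by
    have : (c : ℤ) = m * b + a := by linarith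
    exact_mod_cast this
  refine ⟨m, by exact_mod_cast hm1, hc, ?_⟩
  have d1 := dpsi_cons_det hα h
  have d2 := dpsi_cons_det hα h'
  have hc' : (c : ℝ) = m * b + a := by exact_mod_cast hc
  have hb' : (b : ℝ) ≠ 0 := by exact_mod_cast hb.ne'
  rw [hc'] at d2
  apply mul_left_cancel₀ hb'
  linear_combination d1 - d2

lemma dpsi_jump_det {α : ℝ} (hα : Irrational α) {a b : ℕ} (h : Jm (dpsi α) a)
    (h' : Jm (dpsi α) b) (hab : a < b) :
    ∃ D : ℤ, 1 ≤ D ∧ ((D : ℝ) = b * dpsi α a + a * dpsi α b ∨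
      (D : ℝ) = b * dpsi α a - a * dpsi α b) := by
  obtain ⟨ha, ea⟩ := h.eq
  obtain ⟨hb, eb⟩ := h'.eq
  have pa := dpsi_pos hα a
  have pb := dpsi_pos hα b
  have hle : dpsi α b ≤ dpsi α a := dpsi_anti α hab.le
  have hab : (a : ℝ) < b := by exact_mod_cast hab
  have ha' : (1 : ℝ) ≤ a := by exact_mod_cast ha
  unfold distToInt at ea eb
  set p := round ((a : ℝ) * α)
  set p' := round ((b : ℝ) * α)
  set x := dpsi α a
  set y := dpsi α b
  have hD : ((a * p' - b * p : ℤ) : ℝ) = b * ((a : ℝ) * α - p) - a * ((b : ℝ) * α - p') := by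
    push_cast; ring
  have m2 : (a : ℝ) * y < b * x := by nlinarith
  have m3 : 0 < (a : ℝ) * y := by nlinarith
  have int1 : ∀ D : ℤ, 0 < (D : ℝ) → 1 ≤ D := fun D u => by
    have : 0 < D := by exact_mod_cast u
    omega
  rcases (abs_eq pa.le).1 ea.symm with e1 | e1 <;> rcases (abs_eq pb.le).1 eb.symm with e2 | e2 <;>
    rw [e1, e2] at hD
  · exact ⟨_, int1 _ (by rw [hD]; linarith), Or.inr hD⟩
  · exact ⟨_, int1 _ (by rw [hD]; linarith), Or.inl (by rw [hD]; ring)⟩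
  · have e : ((-(a * p' - b * p) : ℤ) : ℝ) = b * x + a * y := by
      rw [Int.cast_neg, hD]; ring
    exact ⟨_, int1 _ (by rw [e]; linarith), Or.inl e⟩
  · have e : ((-(a * p' - b * p) : ℤ) : ℝ) = b * x - a * y := by
      rw [Int.cast_neg, hD]; ring
    exact ⟨_, int1 _ (by rw [e]; linarith), Or.inr e⟩

lemma dpsi_jump_inf {α : ℝ} (hα : Irrational α) (N : ℕ) : ∃ M, N < M ∧ Jm (dpsi α) M := by
  by_contra! h
  obtain ⟨M, hM⟩ := exists_nat_gt (1 / dpsi α N)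
  have hp := dpsi_pos hα N
  have hc := const_of_no_jump (dpsi_anti α) (le_max_left N (M + 1)) fun c h1 _ => h c h1
  have h1 := dpsi_dirichlet hα (show 1 ≤ max N (M + 1) by omega)
  rw [hc] at h1
  rw [div_lt_iff₀ hp] at hM
  have : (M : ℝ) ≤ ((max N (M + 1) : ℕ) : ℝ) + 1 := by
    exact_mod_cast (by omega : M ≤ max N (M + 1) + 1)
  nlinarith

lemma dpsi_imf {α : ℝ} (hα : Irrational α) : IMF (dpsi α) where
  pos := dpsi_pos hα
  anti := dpsi_anti α
  jump_one := by
    have h1 := (dpsi_le α le_rfl (le_refl 1)).trans (distToInt_le_half _)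
    have h3 : dpsi α 0 = 1 := by simp [dpsi]
    show dpsi α 1 < dpsi α 0
    linarith
  jump_inf := dpsi_jump_inf hα
  cons_det _ _ := dpsi_cons_det hα
  cons_add _ _ _ := dpsi_cons_add hα
  jump_det _ _ := dpsi_jump_det hα
  cons_coprime _ _ := dpsi_cons_coprime hα

/-- Two different irrationality measure functions eventually share no pair of consecutive jumps. -/
lemma dpsi_no_common_cons {α β : ℝ} (hα : Irrational α) (hβ : Irrational β)
    (hne : dpsi α ≠ dpsi β) :
    ∃ T : ℕ, ∀ a b, T ≤ a → Cons (dpsi α) a b → ¬ Cons (dpsi β) a b := by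
  have hminus : 0 < distToInt (α - β) := by
    refine lt_of_le_of_ne (abs_nonneg _) fun h => hne (dpsi_congr fun q => ?_)
    have h0 : α - β - round (α - β) = 0 := abs_eq_zero.1 h.symm
    have : (q : ℝ) * α = q * β + ((q * round (α - β) : ℤ) : ℝ) := by
      push_cast; linear_combination (q : ℝ) * h0
    rw [this, distToInt_add_int]
  have hplus : 0 < distToInt (α + β) := by
    refine lt_of_le_of_ne (abs_nonneg _) fun h => hne (dpsi_congr fun q => ?_)
    have h0 : α + β - round (α + β) = 0 := abs_eq_zero.1 h.symm
    have : (q : ℝ) * α = -(q * β) + ((q * round (α + β) : ℤ) : ℝ) := by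
      push_cast; linear_combination (q : ℝ) * h0
    rw [this, distToInt_add_int, distToInt_neg]
  set d := min (distToInt (α - β)) (distToInt (α + β))
  have hd : 0 < d := lt_min hminus hplus
  obtain ⟨T, hT⟩ := exists_nat_gt (2 / d)
  refine ⟨T, fun a b hTa h h' => ?_⟩
  rw [div_lt_iff₀ hd] at hT
  obtain ⟨s, hs, h1, -⟩ := dpsi_cons_num hα h
  obtain ⟨r, hr, g1, -⟩ := dpsi_cons_num hβ h'
  obtain ⟨ha, ea⟩ := h.1.eq
  obtain ⟨-, eb⟩ := h'.1.eq
  unfold distToInt at ea eb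
  set p := round ((a : ℝ) * α)
  set p' := round ((b : ℝ) * α)
  set u := round ((a : ℝ) * β)
  set u' := round ((b : ℝ) * β)
  have ha' : (1 : ℝ) ≤ a := by exact_mod_cast ha
  have hab : (a : ℝ) < b := by exact_mod_cast h.2.2.1
  have b1 := (dpsi_cons hα h).1
  have b2 := (dpsi_cons hβ h').1
  have q1 := dpsi_pos hα a
  have q2 := dpsi_pos hβ a
  have hTa' : (T : ℝ) ≤ a := by exact_mod_cast hTa
  have hcop := Nat.isCoprime_iff_coprime.2 (dpsi_cons_coprime hα h)
  have c1 : (a : ℝ) * dpsi α a < 1 := by nlinarith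
  have c2 : (a : ℝ) * dpsi β a < 1 := by nlinarith
  have fin : ∀ x : ℝ, d ≤ x → a * x ≤ dpsi α a + dpsi β a → False := fun x hx hx' => by
    have : (a : ℝ) * d ≤ a * x := by nlinarith
    have h2 : (2 : ℝ) < a * d := by nlinarith
    nlinarith
  rcases (by rcases hs with rfl | rfl <;> rcases hr with rfl | rfl <;> simp : r = s ∨ r = -s)
    with rfl | rfl
  · have hdvd : (a : ℤ) ∣ p - u := hcop.dvd_of_dvd_mul_left (y := (b : ℤ)) ⟨p' - u', by linarith⟩
    obtain ⟨k, hk⟩ := hdvd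
    refine fin |α - β - k| ((min_le_left _ _).trans (distToInt_le _ k)) ?_
    rw [ea, eb, ← abs_of_pos (show (0 : ℝ) < a by linarith), ← abs_mul,
      abs_of_pos (show (0 : ℝ) < a by linarith)]
    have hk' : (p : ℝ) - u = a * k := by exact_mod_cast hk
    rw [show (a : ℝ) * (α - β - k) = (a * α - p) - (a * β - u) by linear_combination hk']
    exact abs_sub _ _
  · have hdvd : (a : ℤ) ∣ p + u := hcop.dvd_of_dvd_mul_left (y := (b : ℤ)) ⟨p' + u', by linarith⟩
    obtain ⟨k, hk⟩ := hdvd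
    refine fin |α + β - k| ((min_le_right _ _).trans (distToInt_le _ k)) ?_
    rw [ea, eb, ← abs_of_pos (show (0 : ℝ) < a by linarith), ← abs_mul,
      abs_of_pos (show (0 : ℝ) < a by linarith)]
    have hk' : (p : ℝ) + u = a * k := by exact_mod_cast hk
    rw [show (a : ℝ) * (α + β - k) = (a * α - p) + (a * β - u) by linear_combination hk']
    exact abs_add_le _ _

lemma Jm.pos {v : ℕ → ℝ} {N : ℕ} (h : Jm v N) : 1 ≤ N := by
  by_contra h0
  obtain rfl : N = 0 := by omega
  exact lt_irrefl _ h

lemma Jm.lt_of_lt {v : ℕ → ℝ} (hv : Antitone v) {a b : ℕ} (h : Jm v b) (hab : a < b) :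
    v b < v a :=
  lt_of_lt_of_le h (hv (by omega))

namespace IMF

variable {v : ℕ → ℝ}

lemma exists_last (hv : IMF v) {N : ℕ} (hN : 1 ≤ N) :
    ∃ a, a ≤ N ∧ Jm v a ∧ ∀ c, a < c → c ≤ N → ¬ Jm v c := by
  induction N, hN using Nat.le_induction with
  | base => exact ⟨1, le_rfl, hv.jump_one, fun c _ _ => by omega⟩
  | succ N _ ih =>
    by_cases h : Jm v (N + 1)
    · exact ⟨N + 1, le_rfl, h, fun c _ _ => by omega⟩
    · obtain ⟨a, h1, h2, h3⟩ := ih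
      refine ⟨a, by omega, h2, fun c hc hc' => ?_⟩
      rcases hc'.lt_or_eq with h4 | rfl
      · exact h3 c hc (by omega)
      · exact h

lemma exists_next (hv : IMF v) (N : ℕ) :
    ∃ b, N < b ∧ Jm v b ∧ ∀ c, N < c → c < b → ¬ Jm v c := by
  classical
  have h := hv.jump_inf N
  refine ⟨Nat.find h, (Nat.find_spec h).1, (Nat.find_spec h).2, fun c h1 h2 h3 => ?_⟩
  exact Nat.find_min h h2 ⟨h1, h3⟩

/-- Consecutive jumps around the step from `N` to `N + 1`. -/
lemma exists_around (hv : IMF v) {N : ℕ} (hN : 1 ≤ N) :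
    ∃ a b, a ≤ N ∧ N < b ∧ Cons v a b := by
  obtain ⟨a, h1, h2, h3⟩ := hv.exists_last hN
  obtain ⟨b, g1, g2, g3⟩ := hv.exists_next N
  refine ⟨a, b, h1, g1, h2, g2, by omega, fun c u1 u2 => ?_⟩
  rcases le_or_gt c N with h | h
  · exact h3 c u1 h
  · exact g3 c h u2

lemma exists_cons_left (hv : IMF v) {a : ℕ} (ha : Jm v a) : ∃ b, Cons v a b := by
  obtain ⟨b, h1, h2, h3⟩ := hv.exists_next a
  exact ⟨b, ha, h2, h1, h3⟩

lemma exists_cons_right (hv : IMF v) {b : ℕ} (hb : Jm v b) (h1 : 1 < b) : ∃ a, Cons v a b := by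
  obtain ⟨a, h1, h2, h3⟩ := hv.exists_last (show 1 ≤ b - 1 by omega)
  exact ⟨a, h2, hb, by omega, fun c u1 u2 => h3 c u1 (by omega)⟩

lemma cons_mul_lt (hv : IMF v) {a b : ℕ} (h : Cons v a b) : b * v a < 1 := by
  have h1 := hv.cons_det a b h
  have h2 : (1 : ℝ) ≤ a := by exact_mod_cast h.1.pos
  nlinarith [hv.pos b]

lemma one_le_of_two_jumps (hv : IMF v) {a b c : ℕ} (h : Cons v a b) (h' : Cons v b c) :
    1 ≤ c * v a := by
  obtain ⟨m, hm, hc, -⟩ := hv.cons_add a b c h h'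
  have h1 := hv.cons_det a b h
  have h2 : ((b + a : ℕ) : ℝ) ≤ c := by
    have : b ≤ m * b := Nat.le_mul_of_pos_left b hm
    exact_mod_cast (by omega)
  push_cast at h2
  have h3 : v b ≤ v a := hv.anti h.2.2.1.le
  have h4 : (1 : ℝ) ≤ a := by exact_mod_cast h.1.pos
  nlinarith [hv.pos a]

end IMF

/-- `Cons` bounds: any jump after the first element is at least the second. -/
lemma Cons.le_of_jump {v : ℕ → ℝ} {a b c : ℕ} (h : Cons v a b) (hc : Jm v c) (hac : a < c) :
    b ≤ c := by
  by_contra h0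
  exact h.2.2.2 c hac (by omega) hc

lemma Cons.le_of_jump' {v : ℕ → ℝ} {a b c : ℕ} (h : Cons v a b) (hc : Jm v c) (hcb : c < b) :
    c ≤ a := by
  by_contra h0
  exact h.2.2.2 c (by omega) hcb hc

section Pair

variable {g h : ℕ → ℝ}

lemma no_jump_of_lt (hg : IMF g) (hh : IMF h) {q q' : ℕ} (hq : Cons h q q') (h1 : g q < h q)
    (h2 : g q' < h q') {c : ℕ} (hc : q < c) (hc' : c ≤ q') : ¬ Jm g c := by
  intro hJ
  have hq1 := hq.1.pos
  obtain ⟨x, x1, x2, x3⟩ := hg.exists_last hq1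
  obtain ⟨y, y1, y2, y3⟩ := hg.exists_last (show 1 ≤ q' by omega)
  have hcy : c ≤ y := by
    by_contra h0
    exact y3 c (by omega) hc' hJ
  obtain ⟨D, hD, hD'⟩ := hg.jump_det x y x2 y2 (by omega)
  have e1 := const_of_no_jump hg.anti x1 x3
  have e2 := const_of_no_jump hg.anti y1 y3
  rw [e1] at h1
  rw [e2] at h2
  have hdet := hh.cons_det q q' hq
  have a1 : (x : ℝ) ≤ q := by exact_mod_cast x1
  have a2 : (y : ℝ) ≤ q' := by exact_mod_cast y1
  have a3 : (1 : ℝ) ≤ q := by exact_mod_cast hq1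
  have a4 : (1 : ℝ) ≤ x := by exact_mod_cast x2.pos
  have a5 : (1 : ℝ) ≤ y := by exact_mod_cast y2.pos
  have D1 : (1 : ℝ) ≤ D := by exact_mod_cast hD
  have p1 := hg.pos x
  have p2 := hg.pos y
  have b1 : (y : ℝ) * g x ≤ q' * g x := by nlinarith
  have b2 : (x : ℝ) * g y ≤ q * g y := by nlinarith
  have b3 : (q' : ℝ) * g x < q' * h q := by nlinarith
  have b4 : (q : ℝ) * g y < q * h q' := by nlinarith
  have b5 : 0 < (x : ℝ) * g y := by positivity
  rcases hD' with hD' | hD' <;> linarith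

lemma lt_of_two_jumps (hg : IMF g) (hh : IMF h) {q q' z z' : ℕ} (hq : Cons h q q')
    (hz : Jm g z) (hz' : Jm g z') (h1 : q < z) (h2 : z < z') (h3 : z' ≤ q') : h q < g q := by
  obtain ⟨z0, w1, u1, u2, c0⟩ := hg.exists_around hq.1.pos
  obtain ⟨w2, c1⟩ := hg.exists_cons_left c0.2.1
  have l1 : w1 ≤ z := c0.le_of_jump hz (by omega)
  have l2 : w2 ≤ z' := c1.le_of_jump hz' (by omega)
  have b1 := hg.one_le_of_two_jumps c0 c1
  have b2 := hh.cons_mul_lt hq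
  rw [c0.eq_of_mem hg.anti u1 u2]
  have : (w2 : ℝ) ≤ q' := by exact_mod_cast (by omega)
  have := hg.pos z0
  have q0 : (0 : ℝ) < q' := by exact_mod_cast (by have := hq.2.2.1; omega)
  nlinarith

/-- If `h` and `g` both jump at `τ`, `g` jumps at `c < τ` and `g < h` on `[c, τ)`, then `g` has no
jump in between. -/
lemma cons_of_common_jump (hg : IMF g) (hh : IMF h) {c τ : ℕ} (hτ : Jm h τ) (gτ : Jm g τ)
    (hc : Jm g c) (hcτ : c < τ) (hlt : ∀ N, c ≤ N → N < τ → g N < h N) (hne : h τ ≠ g τ) :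
    Cons g c τ := by
  obtain ⟨y1, c1⟩ := hg.exists_cons_left hc
  obtain ⟨y2, c2⟩ := hg.exists_cons_left c1.2.1
  have l1 : y1 ≤ τ := c1.le_of_jump gτ hcτ
  rcases l1.eq_or_lt with rfl | l1
  · exact c1
  exfalso
  have l2 : y2 ≤ τ := c2.le_of_jump gτ l1
  have c1pos := hc.pos
  have one := hg.one_le_of_two_jumps c1 c2
  have pgc := hg.pos c
  rcases lt_or_gt_of_ne hne with hlt' | hgt
  · obtain ⟨s0, s1, u1, u2, d0⟩ := hh.exists_around c1pos
    have e0 := d0.eq_of_mem hh.anti u1 u2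
    have gc := hlt c le_rfl hcτ
    rw [e0] at gc
    have m0 := hh.cons_mul_lt d0
    have ss : s1 < y2 := by
      by_contra h0
      have : (y2 : ℝ) ≤ s1 := by exact_mod_cast (by omega)
      have q0 : (0 : ℝ) < s1 := by exact_mod_cast (by omega)
      nlinarith
    have nojump : ∀ c', s1 < c' → c' < τ → ¬ Jm g c' := fun c' r1 r2 r3 => by
      obtain ⟨q, q', w1, w2, d⟩ := hh.exists_around (show 1 ≤ c' - 1 by omega)
      have hs1 : s1 ≤ q := by
        by_contra h0
        exact d.2.2.2 s1 (by omega) (by omega) d0.2.1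
      have hq' : q' ≤ τ := d.le_of_jump hτ (by omega)
      rcases hq'.eq_or_lt with rfl | hq'
      · have t1 := lt_of_two_jumps hg hh d r3 gτ (by omega) r2 le_rfl
        have t2 := hlt q (by omega) (by omega)
        linarith
      · exact no_jump_of_lt hg hh d (hlt q (by omega) (by omega)) (hlt q' (by omega) hq')
          (by omega) (by omega) r3
    have k1 : y1 ≤ s1 := by
      by_contra h0
      exact nojump y1 (by omega) l1 c1.2.1
    have k2 : y2 = τ := by
      by_contra h0
      exact nojump y2 ss (by omega) c2.2.1
    subst k2
    obtain ⟨m, hm, m1, m2⟩ := hg.cons_add _ _ _ c1 c2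
    have m3 := hg.cons_det _ _ c1
    have m1' : (y2 : ℝ) = m * y1 + c := by exact_mod_cast m1
    have key : (y2 : ℝ) * g c - c * g y2 = m := by
      rw [m1']; linear_combination (m : ℝ) * m3 + (c : ℝ) * m2
    obtain ⟨D, hD, hD'⟩ := hh.jump_det s0 y2 d0.1 hτ (by omega)
    have det := hh.cons_det _ _ d0
    have hs1 := hτ.lt_of_lt hh.anti ss
    have p0 := hh.pos s0
    have p1 := hh.pos y2
    have a0 : (1 : ℝ) ≤ s0 := by exact_mod_cast d0.1.pos
    have a1 : (s0 : ℝ) ≤ c := by exact_mod_cast u1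
    have a2 : (s1 : ℝ) < y2 := by exact_mod_cast ss
    have a3 : (c : ℝ) < s1 := by exact_mod_cast u2
    have a4 : (y1 : ℝ) ≤ s1 := by exact_mod_cast k1
    have a5 : 0 < (s0 : ℝ) * h y2 := by positivity
    have f1 : (m : ℝ) < D := by
      have f2 : (s0 : ℝ) * h y2 ≤ c * g y2 := by nlinarith
      have f3 : (y2 : ℝ) * g c < y2 * h s0 := by nlinarith
      rcases hD' with hD' | hD' <;> linarith
    have f4 : (m : ℝ) + 1 ≤ D := by
      have : (m : ℤ) < D := by exact_mod_cast f1
      exact_mod_cast (by omega : (m : ℤ) + 1 ≤ D)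
    have f5 : (D : ℝ) ≤ y2 * h s0 + s0 * h y2 := by rcases hD' with hD' | hD' <;> linarith
    have f6 : (s1 : ℝ) * (y2 * h s0 + s0 * h y2) < y2 := by
      have f7 : (s1 : ℝ) * h y2 < y2 * h s1 := by nlinarith
      have f8 : (s0 : ℝ) * (s1 * h y2) < s0 * (y2 * h s1) := by nlinarith
      have f9 : (y2 : ℝ) * (s1 * h s0 + s0 * h s1) = y2 := by rw [det, mul_one]
      linarith
    have f7 : (s1 : ℝ) * (m + 1) < y2 := by nlinarith
    have f8 : (m : ℝ) * y1 ≤ m * s1 := by gcongr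
    linarith
  · obtain ⟨q, d⟩ := hh.exists_cons_right hτ (by omega)
    have hqτ := d.2.2.1
    rcases le_or_gt c q with hcq | hqc
    · exact no_jump_of_lt hg hh d (hlt q hcq hqτ) hgt hqτ le_rfl gτ
    · have e0 := d.eq_of_mem hh.anti hqc.le hcτ
      have gc := hlt c le_rfl hcτ
      rw [e0] at gc
      have m0 := hh.cons_mul_lt d
      have : (y2 : ℝ) ≤ τ := by exact_mod_cast l2
      have q0 : (0 : ℝ) < τ := by exact_mod_cast (by omega)
      nlinarith

lemma cons_of_crossing (hg : IMF g) (hh : IMF h) {T N τ : ℕ} (hne : ∀ M, T ≤ M → h M ≠ g M)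
    (hTN : T ≤ N) (hN : h N < g N) (hNτ : N < τ) (hτ : Jm h τ) (gτ : Jm g τ)
    (hlt : g (τ - 1) < h (τ - 1)) :
    ∃ p, N < p ∧ Cons g p τ ∧ (∀ M, p ≤ M → M < τ → g M < h M) ∧ h (p - 1) < g (p - 1) := by
  classical
  have hex : ∃ d, h (τ - 1 - d) < g (τ - 1 - d) := ⟨τ - 1 - N, by
    rwa [show τ - 1 - (τ - 1 - N) = N by omega]⟩
  set d := Nat.find hex
  have hd : h (τ - 1 - d) < g (τ - 1 - d) := Nat.find_spec hex
  have hdN : d ≤ τ - 1 - N := Nat.find_min' hex (by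
    rwa [show τ - 1 - (τ - 1 - N) = N by omega])
  have hd0 : d ≠ 0 := by
    intro h0
    rw [h0] at hd
    exact lt_asymm hd hlt
  set p := τ - d with hp
  have hp1 : p - 1 = τ - 1 - d := by omega
  have hrun : ∀ M, p ≤ M → M < τ → g M < h M := fun M h1 h2 => by
    have h3 := Nat.find_min hex (m := τ - 1 - M) (by omega)
    rw [show τ - 1 - (τ - 1 - M) = M by omega] at h3
    exact lt_of_le_of_ne (not_lt.1 h3) (hne M (by omega)).symm
  have hgp : Jm g p := by
    have h1 := hrun p le_rfl (by omega)
    have h2 := hh.anti (show p - 1 ≤ p by omega)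
    rw [← hp1] at hd
    exact h1.trans_le (h2.trans hd.le)
  refine ⟨p, by omega, ?_, hrun, by rwa [hp1]⟩
  exact cons_of_common_jump hg hh hτ gτ hgp (by omega) hrun (hne τ (by omega))

lemma exists_crossing (hg : IMF g) (hh : IMF h) {T : ℕ} (hne : ∀ M, T ≤ M → h M ≠ g M) :
    ∃ N, T ≤ N ∧ h N < g N := by
  by_contra! H
  have hlt : ∀ N, T ≤ N → g N < h N := fun N hN => lt_of_le_of_ne (H N hN) (hne N hN).symm
  obtain ⟨s, hs, hsJ⟩ := hh.jump_inf T
  obtain ⟨c, hc, hcJ⟩ := hg.jump_inf s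
  obtain ⟨q, q', h1, h2, d⟩ := hh.exists_around (show 1 ≤ c - 1 by omega)
  have : s ≤ q := by
    by_contra h0
    exact d.2.2.2 s (by omega) (by omega) hsJ
  exact no_jump_of_lt hg hh d (hlt q (by omega)) (hlt q' (by omega)) (by omega) (by omega) hcJ

end Pair

section States

variable {ι : Type*} {v : ι → ℕ → ℝ}

/-- The order of the values `v i N`. -/
def st (v : ι → ℕ → ℝ) (N : ℕ) : ι → ι → Prop := fun i j => v i N < v j N

/-- Restriction of a relation to a finite set. -/
def res (S : Finset ι) (r : ι → ι → Prop) : ι → ι → Prop := fun i j => i ∈ S ∧ j ∈ S ∧ r i j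

/-- The restrictions to `S` of orders occurring infinitely often. -/
def vis (v : ι → ℕ → ℝ) (S : Finset ι) : Set (ι → ι → Prop) :=
  {r | ∀ T : ℕ, ∃ N, T ≤ N ∧ res S (st v N) = r}

/-- The set of functions jumping at `τ`. -/
noncomputable def jset [Fintype ι] (v : ι → ℕ → ℝ) (τ : ℕ) : Finset ι := by
  classical exact Finset.univ.filter fun i => Jm (v i) τ

/-- `i` has the largest value at `N`. -/
def IsMaxAt (v : ι → ℕ → ℝ) (N : ℕ) (i : ι) : Prop := ∀ j, j ≠ i → v j N < v i N

lemma st_iff {M N : ℕ} (h : st v M = st v N) (i j : ι) : v i M < v j M ↔ v i N < v j N := by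
  have := congrFun (congrFun h i) j
  simpa [st] using this

lemma IsMaxAt.congr {M N : ℕ} (h : st v M = st v N) {i : ι} (hi : IsMaxAt v M i) : IsMaxAt v N i :=
  fun j hj => (st_iff h j i).1 (hi j hj)

lemma IsMaxAt.unique {N : ℕ} {i j : ι} (hi : IsMaxAt v N i) (hj : IsMaxAt v N j) : i = j := by
  by_contra h
  exact lt_asymm (hi j (Ne.symm h)) (hj i h)

lemma res_univ [Fintype ι] (r : ι → ι → Prop) : res Finset.univ r = r := by
  ext i j; simp [res]

@[simp] lemma mem_jset [Fintype ι] {τ : ℕ} {i : ι} : i ∈ jset v τ ↔ Jm (v i) τ := by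
  classical simp [jset]

/-- A family of irrationality measure functions that are pairwise distinct, and share no pair of
consecutive jumps, from `T` on. -/
structure Sys (v : ι → ℕ → ℝ) (T : ℕ) : Prop where
  imf : ∀ i, IMF (v i)
  ne : ∀ N, T ≤ N → ∀ i j, i ≠ j → v i N ≠ v j N
  nocons : ∀ i j, i ≠ j → ∀ a b, T ≤ a → Cons (v i) a b → ¬ Cons (v j) a b

/-- `T` is large enough for only the recurrent orders to occur from `T` on, and
all pairs of functions are swapped between `T` and `T'`. -/
structure Reg [Fintype ι] (v : ι → ℕ → ℝ) (T T' : ℕ) : Prop extends Sys v T where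
  one_le : 1 ≤ T
  mem : ∀ N, T ≤ N → st v N ∈ vis v Finset.univ
  swap : ∀ i j, i ≠ j → ∃ N, T ≤ N ∧ N < T' ∧ v i N < v j N
  le : T < T'

lemma Sys.mono {T T' : ℕ} (h : Sys v T) (hT : T ≤ T') : Sys v T' :=
  ⟨h.imf, fun N hN => h.ne N (by omega), fun i j hij a b ha => h.nocons i j hij a b (by omega)⟩

lemma Sys.exists_reg [Fintype ι] {T : ℕ} (h : Sys v T) : ∃ T1 T2, T ≤ T1 ∧ Reg v T1 T2 := by
  classical
  have : ∀ r : ι → ι → Prop, ∃ B : ℕ, r ∈ vis v Finset.univ ∨ ∀ N, B ≤ N → st v N ≠ r := by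
    intro r
    by_cases hr : r ∈ vis v Finset.univ
    · exact ⟨0, Or.inl hr⟩
    · simp only [vis, Set.mem_ofPred_eq, not_forall, not_exists, not_and, res_univ] at hr
      obtain ⟨B, hB⟩ := hr
      exact ⟨B, Or.inr hB⟩
  choose B hB using this
  obtain ⟨M, hM⟩ := (Set.finite_range B).bddAbove
  set T1 := max (max T M) 1
  have hs := h.mono (show T ≤ T1 by omega)
  have hcross : ∀ p : ι × ι, ∃ N, p.1 ≠ p.2 → T1 ≤ N ∧ v p.1 N < v p.2 N := by
    rintro ⟨i, j⟩
    by_cases hij : i = j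
    · exact ⟨0, fun h => absurd hij h⟩
    · obtain ⟨N, h1, h2⟩ := exists_crossing (hs.imf j) (hs.imf i) (fun M hM => hs.ne M hM i j hij)
      exact ⟨N, fun _ => ⟨h1, h2⟩⟩
  choose C hC using hcross
  obtain ⟨M', hM'⟩ := (Set.finite_range C).bddAbove
  refine ⟨T1, max (M' + 1) (T1 + 1), by omega, hs, by omega, fun N hN => ?_, fun i j hij => ?_,
    by omega⟩
  · rcases hB (st v N) with h1 | h1
    · exact h1
    · have : B (st v N) ≤ M := hM ⟨_, rfl⟩
      exact absurd rfl (h1 N (by omega))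
  · have h1 := hC (i, j) hij
    have h2 : C (i, j) ≤ M' := hM' ⟨_, rfl⟩
    exact ⟨_, h1.1, by omega, h1.2⟩

lemma not_jump_eq {T N : ℕ} (h : Sys v T) {i : ι} (hi : ¬ Jm (v i) N) :
    v i (N - 1) = v i N :=
  le_antisymm (not_lt.1 hi) ((h.imf i).anti (by omega))

lemma Sys.exists_top [Fintype ι] [Nonempty ι] {T : ℕ} (h : Sys v T) {N : ℕ} (hN : T ≤ N) :
    ∃ i, IsMaxAt v N i := by
  obtain ⟨i, hi⟩ := Finite.exists_max fun i => v i N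
  exact ⟨i, fun j hj => lt_of_le_of_ne (hi j) (h.ne N hN j i hj)⟩

lemma Sys.res_eq [Fintype ι] {T : ℕ} (h : Sys v T) {τ : ℕ} {S : Finset ι}
    (hS : Disjoint (jset v τ) S) : res S (st v (τ - 1)) = res S (st v τ) := by
  ext i j
  simp only [res, st]
  refine and_congr_right fun hi => and_congr_right fun hj => ?_
  rw [not_jump_eq h fun hJ => Finset.disjoint_left.1 hS (mem_jset.2 hJ) hi,
    not_jump_eq h fun hJ => Finset.disjoint_left.1 hS (mem_jset.2 hJ) hj]

section Card

variable [Fintype ι] {T T' : ℕ}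

lemma vis_finite (S : Finset ι) : (vis v S).Finite := Set.toFinite _

lemma Reg.res_mem (h : Reg v T T') (S : Finset ι) {N : ℕ} (hN : T ≤ N) :
    res S (st v N) ∈ vis v S := by
  intro B
  obtain ⟨M, hM, he⟩ := h.mem N hN B
  rw [res_univ] at he
  exact ⟨M, hM, by rw [he]⟩

/-- Merging states by restriction lowers the number of states. -/
lemma Reg.ncard_drop (h : Reg v T T') {S S' : Finset ι} (hS : S' ⊆ S)
    (X : Set (ι → ι → Prop)) (hX : X ⊆ vis v S)
    (hrep : ∀ x ∈ X, ∃ y ∈ vis v S, y ∉ X ∧ res S' y = res S' x) :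
    (vis v S').ncard + X.ncard ≤ (vis v S).ncard := by
  have hsub : vis v S' ⊆ res S' '' (vis v S \ X) := by
    intro r hr
    obtain ⟨N, hN, rfl⟩ := hr T
    have hm := h.res_mem S hN
    have he : res S' (res S (st v N)) = res S' (st v N) := by
      ext i j
      simp only [res]
      have := @hS i
      have := @hS j
      tauto
    by_cases hx : res S (st v N) ∈ X
    · obtain ⟨y, h1, h2, h3⟩ := hrep _ hx
      exact ⟨y, ⟨h1, h2⟩, by rw [h3, he]⟩
    · exact ⟨_, ⟨hm, hx⟩, he⟩
  have h1 := Set.ncard_le_ncard hsub (Set.toFinite _)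
  have h2 := Set.ncard_image_le (f := res S') (Set.toFinite (vis v S \ X))
  have h3 := Set.ncard_sdiff_add_ncard_of_subset hX (Set.toFinite _)
  omega

/-- A function jumping at `τ` together with a larger one has previously jumped when it crossed the
larger one. -/
lemma Reg.prev (h : Reg v T T') {τ : ℕ} (hτ : T' ≤ τ) {i g : ι} (hi : Jm (v i) τ)
    (hg : Jm (v g) τ) (hlt : v g (τ - 1) < v i (τ - 1)) :
    ∃ p, T < p ∧ Cons (v g) p τ ∧ (∀ M, p ≤ M → M < τ → v g M < v i M) ∧
      v i (p - 1) < v g (p - 1) := by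
  have hne : i ≠ g := by rintro rfl; exact lt_irrefl _ hlt
  obtain ⟨N, h1, h2, h3⟩ := h.swap i g hne
  obtain ⟨p, h4, h5⟩ := cons_of_crossing (h.imf g) (h.imf i) (fun M hM => h.ne M hM i g hne) h1 h3
    (by omega) hi hg hlt
  exact ⟨p, by omega, h5⟩

/-- The states before the jumps preceding a common jump are different. -/
lemma Reg.exists_inj (h : Reg v T T') {τ : ℕ} (hτ : T' ≤ τ) (S : Finset ι) {i : ι} (hi : i ∈ S)
    (hJ : ∀ g ∈ S, Jm (v g) τ) (hmax : ∀ g ∈ S, g ≠ i → v g (τ - 1) < v i (τ - 1)) :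
    ∃ P : ι → ℕ, P i = τ ∧ (∀ g ∈ S, T < P g) ∧
      (∀ g ∈ S, g ≠ i → Cons (v g) (P g) τ ∧ (∀ M, P g ≤ M → M < τ → v g M < v i M) ∧
        v i (P g - 1) < v g (P g - 1)) ∧
      ∀ S', S ⊆ S' → Set.InjOn (fun g => res S' (st v (P g - 1))) S := by
  classical
  have : ∀ g, ∃ p, (g = i → p = τ) ∧ (g ∈ S → T < p) ∧ (g ∈ S → g ≠ i →
      Cons (v g) p τ ∧ (∀ M, p ≤ M → M < τ → v g M < v i M) ∧
        v i (p - 1) < v g (p - 1)) := by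
    intro g
    by_cases hgi : g = i
    · exact ⟨τ, fun _ => rfl, fun _ => by have := h.le; omega, fun _ h => absurd hgi h⟩
    by_cases hg : g ∈ S
    · obtain ⟨p, h1, h2⟩ := h.prev hτ (hJ i hi) (hJ g hg) (hmax g hg hgi)
      exact ⟨p, fun h => absurd h hgi, fun _ => h1, fun _ _ => h2⟩
    · exact ⟨0, fun h => absurd h hgi, fun h => absurd h hg, fun h => absurd h hg⟩
  choose P hP0 hP1 hP2 using this
  refine ⟨P, hP0 i rfl, hP1, hP2, fun S' hS' => ?_⟩
  have key : ∀ g ∈ S, ∀ g' ∈ S, g ≠ i → P g < P g' →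
      res S' (st v (P g - 1)) ≠ res S' (st v (P g' - 1)) := by
    intro g hg g' hg' hgi hlt he
    have h1 := hP2 g hg hgi
    have hle : P g' ≤ τ := by
      by_cases hg'i : g' = i
      · rw [hP0 g' hg'i]
      · exact (hP2 g' hg' hg'i).1.2.2.1.le
    have h2 := h1.2.1 (P g' - 1) (by omega) (by have := hP1 g' hg'; omega)
    have h3 := congrFun (congrFun he i) g
    simp only [res, st, hS' hi, hS' hg, true_and, eq_iff_iff] at h3
    exact lt_asymm h2 (h3.1 h1.2.2)
  intro g hg g' hg' he
  by_contra hne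
  rcases lt_trichotomy (P g) (P g') with hlt | heq | hlt
  · by_cases hgi : g = i
    · rw [hP0 g hgi] at hlt
      have := (hP2 g' hg' (fun h => hne (hgi.trans h.symm))).1.2.2.1
      omega
    · exact key g hg g' hg' hgi hlt he
  · by_cases hgi : g = i
    · rw [hP0 g hgi] at heq
      have := (hP2 g' hg' (fun h => hne (hgi.trans h.symm))).1.2.2.1
      omega
    by_cases hgi' : g' = i
    · rw [hP0 g' hgi'] at heq
      have := (hP2 g hg hgi).1.2.2.1
      omega
    have h1 := (hP2 g hg hgi).1
    have h2 := (hP2 g' hg' hgi').1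
    rw [← heq] at h2
    exact h.nocons g g' hne _ _ (hP1 g hg).le h1 h2
  · by_cases hgi : g' = i
    · rw [hP0 g' hgi] at hlt
      have := (hP2 g hg (fun h => hne (h.trans hgi.symm))).1.2.2.1
      omega
    · exact key g' hg' g hg hgi hlt he.symm

open scoped Classical in
lemma Reg.card_jump_le (h : Reg v T T') {τ : ℕ} (hτ : T' ≤ τ) (S : Finset ι) :
    (S.filter (· ∈ jset v τ)).card ≤ (vis v S).ncard := by
  set A := S.filter (· ∈ jset v τ) with hA
  rcases A.eq_empty_or_nonempty with h0 | hne
  · simp [h0]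
  have hAJ : ∀ g ∈ A, Jm (v g) τ := fun g hg => mem_jset.1 (Finset.mem_filter.1 hg).2
  obtain ⟨i, hi, hmax⟩ := A.exists_max_image (fun g => v g (τ - 1)) hne
  have hle := h.le
  obtain ⟨P, -, h1, -, h2⟩ := h.exists_inj hτ A hi hAJ fun g hg hgi =>
    lt_of_le_of_ne (hmax g hg) (h.ne (τ - 1) (by omega) g i hgi)
  have h3 := h2 S (Finset.filter_subset _ _)
  have := Set.ncard_le_ncard_of_injOn (s := (A : Set ι)) (t := vis v S) _
    (fun g hg => h.res_mem S (by have := h1 g hg; omega)) h3 (Set.toFinite _)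
  simpa using this

lemma Reg.exists_change (h : Reg v T T') {S : Finset ι} (hS : 1 < S.card) (B : ℕ) :
    ∃ τ, B ≤ τ ∧ res S (st v (τ - 1)) ≠ res S (st v τ) := by
  by_contra! H
  obtain ⟨i, hi, j, hj, hij⟩ := Finset.one_lt_card.1 hS
  set C := max (max B T) 1
  have hconst : ∀ N, C ≤ N → res S (st v N) = res S (st v C) := by
    intro N hN
    induction N, hN using Nat.le_induction with
    | base => rfl
    | succ N hN ih => rw [← ih, ← H (N + 1) (by omega), Nat.add_sub_cancel]
  have hne : ∀ M, C ≤ M → ∀ i j : ι, i ≠ j → v i M ≠ v j M := fun M hM i j hij =>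
    h.ne M (by omega) i j hij
  obtain ⟨N1, a1, a2⟩ := exists_crossing (h.imf i) (h.imf j)
    (fun M hM => hne M hM j i (Ne.symm hij))
  obtain ⟨N2, b1, b2⟩ := exists_crossing (h.imf j) (h.imf i) (fun M hM => hne M hM i j hij)
  have he := (hconst N1 a1).trans (hconst N2 b1).symm
  have h3 := congrFun (congrFun he i) j
  simp only [res, st, hi, hj, true_and, eq_iff_iff] at h3
  exact lt_asymm a2 (h3.2 b2)

lemma Reg.card_le (h : Reg v T T') (m : ℕ) (S : Finset ι) (hS : (vis v S).ncard ≤ m) :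
    S.card * 2 ≤ m * (m + 1) := by
  classical
  induction m generalizing S with
  | zero =>
    have h1 := (Set.ncard_eq_zero (vis_finite (v := v) S)).1 (by omega)
    have h2 := h.res_mem S le_rfl
    rw [h1] at h2
    exact absurd h2 (Set.notMem_empty _)
  | succ m ih =>
    rcases le_or_gt S.card 1 with h1 | h1
    · nlinarith
    obtain ⟨τ, hτ, hne⟩ := h.exists_change h1 T'
    have hle := h.le
    set A := S.filter (· ∈ jset v τ) with hA
    have hAc : A.card ≤ m + 1 := (h.card_jump_le hτ S).trans hS
    have hsub : S \ A ⊆ S := Finset.sdiff_subset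
    have hdisj : Disjoint (jset v τ) (S \ A) := by
      rw [Finset.disjoint_left]
      intro i hi hi'
      simp only [hA, Finset.mem_sdiff, Finset.mem_filter] at hi'
      tauto
    have hres : ∀ N, res (S \ A) (res S (st v N)) = res (S \ A) (st v N) := fun N => by
      ext i j
      simp only [res]
      have := @hsub i
      have := @hsub j
      tauto
    have hd := h.ncard_drop hsub {res S (st v τ)}
      (Set.singleton_subset_iff.2 (h.res_mem S (by omega))) (by
        rintro x rfl
        refine ⟨_, h.res_mem S (show T ≤ τ - 1 by omega), hne, ?_⟩
        rw [hres, hres, h.res_eq hdisj])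
    rw [Set.ncard_singleton] at hd
    have h2 := ih (S \ A) (by omega)
    have h3 := Finset.card_sdiff_add_card_eq_card (show A ⊆ S from Finset.filter_subset _ _)
    nlinarith

end Card

end States

section Extremal

variable {ι : Type*} [Fintype ι] {v : ι → ℕ → ℝ} {k T T' : ℕ}

/-- The order changes at `τ`. -/
def Chg (v : ι → ℕ → ℝ) (τ : ℕ) : Prop := st v (τ - 1) ≠ st v τ

/-- The extremal situation: `k (k + 1) / 2` functions with `k` recurrent orders. -/
structure Full (v : ι → ℕ → ℝ) (k T T' : ℕ) : Prop extends Reg v T T' where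
  two_le : 2 ≤ k
  card_eq : Fintype.card ι * 2 = k * (k + 1)
  ncard_eq : (vis v Finset.univ).ncard = k

lemma Reg.full (h : Reg v T T') (hk : 2 ≤ k) (hc : Fintype.card ι * 2 = k * (k + 1))
    (hle : (vis v Finset.univ).ncard ≤ k) : Full v k T T' := by
  refine { h with two_le := hk, card_eq := hc, ncard_eq := le_antisymm hle ?_ }
  have := h.card_le _ Finset.univ le_rfl
  rw [Finset.card_univ, hc] at this
  by_contra! hlt
  have h2 := Nat.mul_lt_mul'' hlt (Nat.add_lt_add_right hlt 1)
  omega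

namespace Full

lemma nonempty (h : Full v k T T') : Nonempty ι := by
  rw [← Fintype.card_pos_iff]
  have := h.card_eq
  have := h.two_le
  by_contra h0
  have : Fintype.card ι = 0 := by omega
  nlinarith

open scoped Classical in
/-- Removing functions that merge many states: a lower bound for their number. -/
lemma card_removed (h : Full v k T T') (U : Finset ι) (X : Set (ι → ι → Prop))
    (hX : X ⊆ vis v Finset.univ)
    (hrep : ∀ x ∈ X, ∃ y ∈ vis v Finset.univ, y ∉ X ∧ res Uᶜ y = res Uᶜ x) :
    k * (k + 1) ≤ 2 * U.card + (k - X.ncard) * (k - X.ncard + 1) := by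
  have h1 := h.ncard_drop (Finset.subset_univ Uᶜ) X hX hrep
  rw [h.ncard_eq] at h1
  have h2 := h.card_le (k - X.ncard) Uᶜ (by omega)
  have h3 := Finset.card_add_card_compl U
  have := h.card_eq
  omega

open scoped Classical in
lemma res_compl_eq (h : Full v k T T') {τ : ℕ} {U : Finset ι} (hU : jset v τ ⊆ U) :
    res Uᶜ (st v (τ - 1)) = res Uᶜ (st v τ) :=
  h.res_eq ((disjoint_compl_right (a := U)).mono_left hU)

lemma card_jset (h : Full v k T T') {τ : ℕ} (hτ : T' ≤ τ) (hc : Chg v τ) :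
    (jset v τ).card = k := by
  classical
  have hle := h.le
  have h1 := h.card_jump_le hτ Finset.univ
  rw [h.ncard_eq] at h1
  have h2 : (Finset.univ.filter (· ∈ jset v τ)) = jset v τ := by ext; simp
  rw [h2] at h1
  refine le_antisymm h1 ?_
  have h3 := h.card_removed (jset v τ) {st v τ}
    (Set.singleton_subset_iff.2 (h.mem τ (by omega)))
    (by rintro x rfl; exact ⟨_, h.mem (τ - 1) (by omega), hc, h.res_compl_eq subset_rfl⟩)
  rw [Set.ncard_singleton] at h3
  have := h.two_le
  obtain ⟨m, rfl⟩ : ∃ m, k = m + 1 := ⟨k - 1, by omega⟩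
  rw [Nat.add_sub_cancel] at h3
  nlinarith

open scoped Classical in
/-- Jump sets of different changes share at most one function. -/
lemma card_inter_le (h : Full v k T T') {τ τ' : ℕ} (hτ : T' ≤ τ) (hτ' : T' ≤ τ')
    (hc : Chg v τ) (hc' : Chg v τ')
    (hne : (st v (τ - 1) ≠ st v (τ' - 1) ∧ st v (τ - 1) ≠ st v τ') ∨
      (st v τ ≠ st v (τ' - 1) ∧ st v τ ≠ st v τ')) :
    (jset v τ ∩ jset v τ').card ≤ 1 := by
  have hle := h.le
  have j1 := h.card_jset hτ hc
  have j2 := h.card_jset hτ' hc'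
  have hu := Finset.card_union_add_card_inter (jset v τ) (jset v τ')
  set U := jset v τ ∪ jset v τ' with hU
  have e1 : res Uᶜ (st v (τ - 1)) = res Uᶜ (st v τ) := h.res_compl_eq Finset.subset_union_left
  have e2 : res Uᶜ (st v (τ' - 1)) = res Uᶜ (st v τ') := h.res_compl_eq Finset.subset_union_right
  have main : ∀ x x' : ι → ι → Prop, x ∈ vis v Finset.univ → x' ∈ vis v Finset.univ → x ≠ x' →
      res Uᶜ x = res Uᶜ x' → x ≠ st v (τ' - 1) → x ≠ st v τ' →
      k * (k + 1) ≤ 2 * U.card + (k - 2) * (k - 2 + 1) := by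
    intro x x' hx hx' hxx e n1 n2
    by_cases hp : x' = st v (τ' - 1)
    · have := h.card_removed U {x, st v τ'}
        (Set.insert_subset hx (Set.singleton_subset_iff.2 (h.mem _ (by omega)))) (by
          rintro y (rfl | rfl)
          · exact ⟨x', hx', by simp [n1.symm, hp, show st v (τ' - 1) ≠ st v τ' from hc'], e.symm⟩
          · exact ⟨st v (τ' - 1), h.mem _ (by omega),
              by simp [n1.symm, show st v (τ' - 1) ≠ st v τ' from hc'], e2⟩)
      rwa [Set.ncard_pair n2] at this
    · have := h.card_removed U {x, st v (τ' - 1)}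
        (Set.insert_subset hx (Set.singleton_subset_iff.2 (h.mem _ (by omega)))) (by
          rintro y (rfl | rfl)
          · exact ⟨x', hx', by simp [hxx.symm, hp], e.symm⟩
          · exact ⟨st v τ', h.mem _ (by omega),
              by simp [n2.symm, (show st v (τ' - 1) ≠ st v τ' from hc').symm], e2.symm⟩)
      rwa [Set.ncard_pair n1] at this
  have hfin : k * (k + 1) ≤ 2 * U.card + (k - 2) * (k - 2 + 1) := by
    rcases hne with ⟨n1, n2⟩ | ⟨n1, n2⟩
    · exact main _ _ (h.mem _ (by omega)) (h.mem _ (by omega)) hc e1 n1 n2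
    · exact main _ _ (h.mem _ (by omega)) (h.mem _ (by omega)) (Ne.symm hc) e1.symm n1 n2
  have := h.two_le
  obtain ⟨m, rfl⟩ : ∃ m, k = m + 2 := ⟨k - 2, by omega⟩
  rw [Nat.add_sub_cancel] at hfin
  nlinarith

/-- Each function jumping at a change drops below some function that does not jump. -/
lemma exists_drop (h : Full v k T T') {τ : ℕ} (hτ : T' ≤ τ) (hc : Chg v τ) {f : ι}
    (hf : f ∈ jset v τ) :
    ∃ x, x ∉ jset v τ ∧ v x (τ - 1) < v f (τ - 1) ∧ v f τ < v x τ := by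
  classical
  have hle := h.le
  by_contra! H
  set U := (jset v τ).erase f with hU
  have hUc : U.card = k - 1 := by rw [hU, Finset.card_erase_of_mem hf, h.card_jset hτ hc]
  have he : res Uᶜ (st v (τ - 1)) = res Uᶜ (st v τ) := by
    have nj : ∀ i, i ∈ Uᶜ → i ≠ f → v i (τ - 1) = v i τ := fun i hi hif =>
      not_jump_eq h.toSys fun hJ => by
        simp only [hU, Finset.mem_compl, Finset.mem_erase, mem_jset] at hi
        exact hi ⟨hif, hJ⟩
    have nm : ∀ i, i ∈ Uᶜ → i ≠ f → i ∉ jset v τ := fun i hi hif hJ => by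
      simp only [hU, Finset.mem_compl, Finset.mem_erase] at hi
      exact hi ⟨hif, hJ⟩
    have hfle : v f τ ≤ v f (τ - 1) := (h.imf f).anti (by omega)
    have hx : ∀ i, i ∈ Uᶜ → i ≠ f → (v i (τ - 1) < v f (τ - 1) ↔ v i τ < v f τ) := by
      intro i hi hif
      have e := nj i hi hif
      constructor
      · intro hlt
        exact lt_of_le_of_ne (H i (nm i hi hif) hlt) (h.ne τ (by omega) i f hif)
      · intro hlt; linarith
    ext i j
    simp only [res, st]
    refine and_congr_right fun hi => and_congr_right fun hj => ?_
    by_cases hif : i = f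
    · by_cases hjf : j = f
      · rw [hif, hjf]; simp
      · rw [hif]
        have h1 := hx j hj hjf
        have h2 := h.ne τ (by omega) j f hjf
        have h3 := h.ne (τ - 1) (by omega) j f hjf
        constructor
        · intro hlt
          exact lt_of_le_of_ne (not_lt.1 fun hh => lt_asymm hlt (h1.2 hh)) h2.symm
        · intro hlt
          exact lt_of_le_of_ne (not_lt.1 fun hh => lt_asymm hlt (h1.1 hh)) h3.symm
    · by_cases hjf : j = f
      · rw [hjf]; exact hx i hi hif
      · rw [nj i hi hif, nj j hj hjf]
  have h3 := h.card_removed U {st v τ}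
    (Set.singleton_subset_iff.2 (h.mem τ (by omega)))
    (by rintro x rfl; exact ⟨_, h.mem (τ - 1) (by omega), hc, he⟩)
  rw [Set.ncard_singleton, hUc] at h3
  have := h.two_le
  obtain ⟨m, rfl⟩ : ∃ m, k = m + 1 := ⟨k - 1, by omega⟩
  simp only [Nat.add_sub_cancel] at h3
  nlinarith

lemma isMaxAt_not_jump (h : Full v k T T') {τ : ℕ} (hτ : T' ≤ τ) (hc : Chg v τ) {y : ι}
    (hy : IsMaxAt v τ y) : y ∉ jset v τ := fun hJ => by
  obtain ⟨x, -, h1, h2⟩ := h.exists_drop hτ hc hJ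
  exact lt_asymm h2 (hy x (by rintro rfl; exact lt_irrefl _ h2))

/-- At a change, every other state is left when some jumping function drops below
the largest jumping function. -/
lemma exists_exit (h : Full v k T T') {τ : ℕ} (hτ : T' ≤ τ) (hc : Chg v τ) {y : ι}
    (hyJ : y ∈ jset v τ) (hy : ∀ g ∈ jset v τ, g ≠ y → v g (τ - 1) < v y (τ - 1))
    {X : ι → ι → Prop} (hX : X ∈ vis v Finset.univ) (hne : X ≠ st v (τ - 1)) :
    ∃ g p, g ∈ jset v τ ∧ g ≠ y ∧ T < p ∧ Cons (v g) p τ ∧ st v (p - 1) = X ∧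
      (∀ M, p ≤ M → M < τ → v g M < v y M) ∧ v y (p - 1) < v g (p - 1) := by
  classical
  obtain ⟨P, h0, h1, h2, h3⟩ := h.exists_inj hτ (jset v τ) hyJ (fun g hg => mem_jset.1 hg) hy
  have hinj := h3 Finset.univ (Finset.subset_univ _)
  have himg : (fun g => st v (P g - 1)) '' (jset v τ : Set ι) = vis v Finset.univ := by
    refine Set.eq_of_subset_of_ncard_le ?_ ?_ (Set.toFinite _)
    · rintro _ ⟨g, hg, rfl⟩
      exact h.mem _ (by have := h1 g hg; omega)
    · rw [Set.InjOn.ncard_image (by simpa only [res_univ] using hinj), h.ncard_eq,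
        Set.ncard_coe_finset, h.card_jset hτ hc]
  rw [← himg] at hX
  obtain ⟨g, hg, rfl⟩ := hX
  have hgy : g ≠ y := by
    rintro rfl
    simp only [h0] at hne
    exact hne rfl
  exact ⟨g, P g, hg, hgy, h1 g hg, (h2 g hg hgy).1, rfl, (h2 g hg hgy).2⟩

lemma isMaxAt_jump_of_lost (h : Full v k T T') {τ : ℕ} {y : ι}
    (hy : IsMaxAt v (τ - 1) y) (hy' : ¬ IsMaxAt v τ y) : y ∈ jset v τ := by
  by_contra hJ
  refine hy' fun j hj => ?_
  rw [← not_jump_eq h.toSys fun h0 => hJ (mem_jset.2 h0)]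
  exact ((h.imf j).anti (by omega)).trans_lt (hy j hj)

/-- A state is determined by its largest function. -/
lemma st_eq_of_isMaxAt (h : Full v k T T') {M N : ℕ} (hM : T ≤ M) (hN : T ≤ N) {y : ι}
    (hyM : IsMaxAt v M y) (hyN : IsMaxAt v N y) : st v M = st v N := by
  have hle := h.le
  obtain ⟨N2, hN2, he⟩ := h.mem M hM T'
  rw [res_univ] at he
  have hy2 := hyM.congr he.symm
  have hex : ∃ B, N2 ≤ B ∧ ¬ IsMaxAt v B y := by
    have : 1 < Fintype.card ι := by
      have h1 := h.card_eq
      have h2 := h.two_le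
      nlinarith
    obtain ⟨x, hx⟩ := Fintype.exists_ne_of_one_lt_card this y
    obtain ⟨B, hB, hlt⟩ := exists_crossing (h.imf x) (h.imf y)
      (T := N2) (fun M hM => h.ne M (by omega) y x hx.symm)
    exact ⟨B, hB, fun hy => lt_asymm hlt (hy x hx)⟩
  classical
  set τ := Nat.find hex
  obtain ⟨t1, t2⟩ : N2 ≤ τ ∧ ¬ IsMaxAt v τ y := Nat.find_spec hex
  have t3 : N2 ≠ τ := fun h0 => t2 (h0 ▸ hy2)
  have t4 : IsMaxAt v (τ - 1) y := by
    by_contra h0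
    exact Nat.find_min hex (show τ - 1 < τ by omega) ⟨by omega, h0⟩
  have hc : Chg v τ := fun h0 => t2 (t4.congr h0)
  have hJ := h.isMaxAt_jump_of_lost t4 t2
  have key : ∀ B, T ≤ B → IsMaxAt v B y → st v B = st v (τ - 1) := fun B hB hyB => by
    by_contra hne
    obtain ⟨g, p, -, g2, -, -, g5, -, g7⟩ :=
      h.exists_exit (by omega) hc hJ (fun g _ hg => t4 g hg) (h.mem B hB) hne
    exact lt_asymm g7 ((st_iff g5 g y).2 (hyB g g2))
  rw [key M hM hyM, key N hN hyN]

lemma isMaxAt_jump (h : Full v k T T') {τ : ℕ} (hτ : T' ≤ τ) (hc : Chg v τ) {y : ι}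
    (hy : IsMaxAt v (τ - 1) y) : y ∈ jset v τ :=
  h.isMaxAt_jump_of_lost hy fun h' => by
    have hle := h.le
    exact hc (h.st_eq_of_isMaxAt (by omega) (by omega) hy h')

lemma above_jump (h : Full v k T T') {τ : ℕ} {y x : ι} (hy : IsMaxAt v τ y)
    (hlt : v y (τ - 1) < v x (τ - 1)) : x ∈ jset v τ := by
  by_contra hJ
  have h1 := not_jump_eq h.toSys fun h0 => hJ (mem_jset.2 h0)
  have h2 := hy x (by rintro rfl; exact lt_irrefl _ hlt)
  have h3 := (h.imf y).anti (show τ - 1 ≤ τ by omega)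
  linarith

end Full

end Extremal

section Periodic

variable {ι : Type*} [Fintype ι] {v : ι → ℕ → ℝ} {k T T' : ℕ}

namespace Full

lemma next_unique_aux (h : Full v k T T') {τ τ1 τ2 : ℕ} (hτ : T' ≤ τ) (hτ1 : T' ≤ τ1)
    (hτ2 : T' ≤ τ2) (hc : Chg v τ) (hc1 : Chg v τ1) (hc2 : Chg v τ2)
    (he : st v (τ - 1) = st v (τ1 - 1)) (he2 : st v (τ2 - 1) = st v τ) (hne : st v τ ≠ st v τ1)
    {y z : ι} (hy : IsMaxAt v τ y) (hz : IsMaxAt v τ1 z) (hzy : v z (τ - 1) < v y (τ - 1)) :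
    False := by
  classical
  have hle := h.le
  have : Nonempty ι := h.nonempty
  obtain ⟨t, ht⟩ := h.exists_top (show T ≤ τ - 1 by omega)
  have htJ := h.isMaxAt_jump hτ hc ht
  have htJ1 := h.isMaxAt_jump hτ1 hc1 (ht.congr he)
  have hyJ1 : y ∈ jset v τ1 := h.above_jump hz ((st_iff he _ _).1 hzy)
  have hy2 : IsMaxAt v (τ2 - 1) y := hy.congr he2.symm
  have hyJ2 := h.isMaxAt_jump hτ2 hc2 hy2
  have hyJ := h.isMaxAt_not_jump hτ hc hy
  have hty : t ≠ y := fun h0 => hyJ (h0 ▸ htJ)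
  obtain ⟨g, p, g1, g2, -, -, g5, -, g7⟩ := h.exists_exit hτ2 hc2 hyJ2 (fun g _ hg => hy2 g hg)
    (h.mem (τ - 1) (by omega)) (by rw [he2]; exact hc)
  have hyg : v y (τ - 1) < v g (τ - 1) := (st_iff g5 _ _).1 g7
  have hgJ := h.above_jump hy hyg
  have hgJ1 : g ∈ jset v τ1 := h.above_jump hz ((st_iff he _ _).1 (hzy.trans hyg))
  have hgt : g = t := by
    refine Finset.card_le_one.1 (h.card_inter_le hτ hτ1 hc hc1 (Or.inr ⟨?_, hne⟩)) g
      (Finset.mem_inter.2 ⟨hgJ, hgJ1⟩) t (Finset.mem_inter.2 ⟨htJ, htJ1⟩)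
    rw [← he]; exact Ne.symm hc
  subst hgt
  refine hty (Finset.card_le_one.1 (h.card_inter_le hτ2 hτ1 hc2 hc1 (Or.inl ⟨?_, ?_⟩)) g
    (Finset.mem_inter.2 ⟨g1, hgJ1⟩) y (Finset.mem_inter.2 ⟨hyJ2, hyJ1⟩))
  · rw [he2, ← he]; exact Ne.symm hc
  · rw [he2]; exact hne

end Full

/-- `c` enumerates the changes of the order from `T'` on. -/
structure Enum (v : ι → ℕ → ℝ) (k T T' : ℕ) (c : ℕ → ℕ) : Prop extends Full v k T T' where
  mono : StrictMono c
  ge : ∀ i, T' ≤ c i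
  chg : ∀ i, Chg v (c i)
  surj : ∀ τ, T' ≤ τ → Chg v τ → ∃ i, c i = τ

lemma Full.exists_enum (h : Full v k T T') : ∃ c, Enum v k T T' c := by
  classical
  set p : ℕ → Prop := fun τ => T' ≤ τ ∧ Chg v τ
  have hinf : (Set.ofPred p).Infinite := by
    rw [Set.infinite_iff_exists_gt]
    intro B
    have hcard : 1 < (Finset.univ : Finset ι).card := by
      rw [Finset.card_univ]
      have h1 := h.card_eq
      have h2 := h.two_le
      nlinarith
    obtain ⟨τ, h1, h2⟩ := h.exists_change hcard (max (B + 1) T')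
    rw [res_univ, res_univ] at h2
    exact ⟨τ, ⟨by omega, h2⟩, by omega⟩
  refine ⟨Nat.nth p, h, Nat.nth_strictMono hinf, fun i => (Nat.nth_mem_of_infinite hinf i).1,
    fun i => (Nat.nth_mem_of_infinite hinf i).2, fun τ h1 h2 => ?_⟩
  obtain ⟨i, -, hi⟩ := Nat.exists_lt_card_nth_eq (p := p) (x := τ) ⟨h1, h2⟩
  exact ⟨i, hi⟩

namespace Enum

variable {c : ℕ → ℕ}

lemma st_between (h : Enum v k T T' c) {i N : ℕ} (h1 : c i ≤ N) (h2 : N < c (i + 1)) :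
    st v N = st v (c i) := by
  induction N, h1 using Nat.le_induction with
  | base => rfl
  | succ N hN ih =>
    rw [← ih (by omega)]
    by_contra hne
    obtain ⟨j, hj⟩ := h.surj (N + 1) (by have := h.ge i; omega)
      (by rw [Chg, Nat.add_sub_cancel]; exact Ne.symm hne)
    have a1 : i < j := h.mono.lt_iff_lt.1 (by omega)
    have a2 : j < i + 1 := h.mono.lt_iff_lt.1 (by omega)
    omega

lemma base_lt (h : Enum v k T T' c) (i : ℕ) : T < c i := by
  have := h.le
  have := h.ge i
  omega

lemma st_pred (h : Enum v k T T' c) (i : ℕ) : st v (c (i + 1) - 1) = st v (c i) :=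
  h.st_between (by have := h.mono (Nat.lt_add_one i); omega) (by have := h.base_lt (i + 1); omega)

lemma exists_index (h : Enum v k T T' c) {N : ℕ} (hN : c 0 ≤ N) :
    ∃ i, c i ≤ N ∧ N < c (i + 1) := by
  by_contra! H
  have : ∀ i, c i ≤ N := fun i => by
    induction i with
    | zero => exact hN
    | succ i ih => exact H i ih
  have h1 := h.mono.id_le (N + 1)
  have h2 := this (N + 1)
  simp only [id] at h1
  omega

lemma next_unique (h : Enum v k T T' c) {i j : ℕ} (he : st v (c i - 1) = st v (c j - 1)) :
    st v (c i) = st v (c j) := by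
  by_contra hne
  have hne' : Nonempty ι := h.nonempty
  obtain ⟨y, hy⟩ := h.exists_top (h.base_lt i).le
  obtain ⟨z, hz⟩ := h.exists_top (h.base_lt j).le
  have hyz : y ≠ z := by
    rintro rfl
    exact hne (h.st_eq_of_isMaxAt (h.base_lt i).le (h.base_lt j).le hy hz)
  rcases lt_or_gt_of_ne (h.ne (c i - 1) (by have := h.base_lt i; omega) y z hyz) with hlt | hlt
  · exact h.next_unique_aux (h.ge j) (h.ge i) (h.ge (j + 1)) (h.chg j) (h.chg i) (h.chg (j + 1))
      he.symm (h.st_pred j) (Ne.symm hne) hz hy ((st_iff he _ _).1 hlt)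
  · exact h.next_unique_aux (h.ge i) (h.ge j) (h.ge (i + 1)) (h.chg i) (h.chg j) (h.chg (i + 1))
      he (h.st_pred i) hne hy hz hlt

lemma shift (h : Enum v k T T' c) {i j : ℕ} (he : st v (c i - 1) = st v (c j - 1)) (n : ℕ) :
    st v (c (i + n) - 1) = st v (c (j + n) - 1) := by
  induction n with
  | zero => exact he
  | succ n ih =>
    rw [← add_assoc, ← add_assoc, h.st_pred, h.st_pred]
    exact h.next_unique ih

/-- Within a period all states are different. -/
lemma st_ne (h : Enum v k T T' c) {a b : ℕ} (hab : a < b) (hb : b < a + k) :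
    st v (c a - 1) ≠ st v (c b - 1) := by
  intro he
  have hper : ∀ n, ∃ m, a ≤ m ∧ m < b ∧ st v (c (a + n) - 1) = st v (c m - 1) := by
    intro n
    induction n using Nat.strong_induction_on with
    | _ n ih =>
      rcases lt_or_ge (a + n) b with h1 | h1
      · exact ⟨a + n, by omega, h1, rfl⟩
      · obtain ⟨m, m1, m2, m3⟩ := ih (n - (b - a)) (by omega)
        refine ⟨m, m1, m2, ?_⟩
        rw [← m3, h.shift he (n - (b - a))]
        congr 3
        omega
  have hsub : vis v Finset.univ ⊆ (fun m => st v (c m - 1)) '' (Finset.Ico a b : Set ℕ) := by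
    intro X hX
    obtain ⟨N, hN, hX⟩ := hX (c a)
    rw [res_univ] at hX
    obtain ⟨i, i1, i2⟩ := h.exists_index ((h.mono.monotone (Nat.zero_le a)).trans hN)
    have hai : a ≤ i := by
      by_contra h0
      have := h.mono.monotone (show i + 1 ≤ a by omega)
      omega
    obtain ⟨m, m1, m2, m3⟩ := hper (i + 1 - a)
    refine ⟨m, by simp [m1, m2], ?_⟩
    show st v (c m - 1) = X
    rw [← m3, ← hX, h.st_between i1 i2, show a + (i + 1 - a) = i + 1 by omega, h.st_pred]
  have h1 := Set.ncard_le_ncard hsub (Set.toFinite _)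
  have h2 := Set.ncard_image_le (f := fun m => st v (c m - 1))
    (Set.toFinite (Finset.Ico a b : Set ℕ))
  rw [h.ncard_eq] at h1
  rw [Set.ncard_coe_finset, Nat.card_Ico] at h2
  omega

/-- The sequence of states has period `k`. -/
lemma st_periodic (h : Enum v k T T' c) (a : ℕ) :
    st v (c (a + k) - 1) = st v (c a - 1) := by
  classical
  by_contra hne
  have hinj : Set.InjOn (fun m => st v (c m - 1)) (Finset.Icc a (a + k) : Set ℕ) := by
    have key : ∀ i j, a ≤ i → j ≤ a + k → i < j → st v (c i - 1) ≠ st v (c j - 1) := by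
      intro i j hi hj hij
      rcases lt_or_ge j (i + k) with h1 | h1
      · exact h.st_ne hij h1
      · obtain rfl : i = a := by omega
        obtain rfl : j = i + k := by omega
        exact Ne.symm hne
    intro i hi j hj he
    simp only [Finset.coe_Icc, Set.mem_Icc] at hi hj
    rcases lt_trichotomy i j with hij | hij | hij
    · exact absurd he (key i j hi.1 hj.2 hij)
    · exact hij
    · exact absurd he.symm (key j i hj.1 hi.2 hij)
  have h1 := Set.ncard_le_ncard_of_injOn (t := vis v Finset.univ) _
    (fun m _ => h.mem _ (by have := h.base_lt m; omega)) hinj (Set.toFinite _)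
  rw [h.ncard_eq, Set.ncard_coe_finset, Nat.card_Icc] at h1
  omega

lemma isMaxAt_periodic (h : Enum v k T T' c) {a : ℕ} {y : ι} :
    IsMaxAt v (c (a + k) - 1) y ↔ IsMaxAt v (c a - 1) y :=
  ⟨fun hy => hy.congr (h.st_periodic a), fun hy => hy.congr (h.st_periodic a).symm⟩

/-- The function that drops below the maximum between the changes `l` and `m`. -/
lemma exists_common (h : Enum v k T T' c) {l m : ℕ} (hlm : l < m) (hm : m < l + k) {y : ι}
    (hy : IsMaxAt v (c m - 1) y) :
    ∃ g, g ≠ y ∧ Cons (v g) (c l) (c m) ∧ v y (c l - 1) < v g (c l - 1) := by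
  have hyJ := h.isMaxAt_jump (h.ge m) (h.chg m) hy
  have hst := h.st_ne hlm hm
  obtain ⟨g, p, g1, g2, g3, g4, g5, g6, g7⟩ := h.exists_exit (h.ge m) (h.chg m) hyJ
    (fun g _ hg => hy g hg) (h.mem (c l - 1) (by have := h.base_lt l; omega)) hst
  have hcl := h.mono hlm
  have hl := h.base_lt l
  have hp : c l ≤ p := by
    by_contra hlt
    exact lt_asymm (g6 (c l - 1) (by omega) (by omega)) ((st_iff g5 y g).1 g7)
  have hpm := g4.2.2.1
  have hcp : Chg v p := fun h0 => lt_asymm g7 ((st_iff h0 g y).2 (g6 p le_rfl hpm))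
  obtain ⟨i, rfl⟩ := h.surj p (by have := h.ge l; omega) hcp
  have hli : l ≤ i := h.mono.le_iff_le.1 hp
  have him : i < m := h.mono.lt_iff_lt.1 hpm
  obtain rfl : l = i := by
    by_contra hne
    exact h.st_ne (show l < i by omega) (by omega) g5.symm
  exact ⟨g, g2, g4, g7⟩

end Enum

end Periodic

section Largest

variable {ι : Type*} [Fintype ι] {v : ι → ℕ → ℝ} {k T T' : ℕ} {c : ℕ → ℕ} {y : ℕ → ι}

lemma Cons.right_unique {v : ℕ → ℝ} {a b b' : ℕ} (h : Cons v a b) (h' : Cons v a b') : b = b' :=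
  le_antisymm (h.le_of_jump h'.2.1 h'.2.2.1) (h'.le_of_jump h.2.1 h.2.2.1)

lemma Cons.left_unique {v : ℕ → ℝ} {a a' b : ℕ} (h : Cons v a b) (h' : Cons v a' b) : a = a' :=
  le_antisymm (h'.le_of_jump' h.1 h.2.2.1) (h.le_of_jump' h'.1 h'.2.2.1)

/-- `c` enumerates the changes and `y m` is the largest function before the change `c m`. -/
structure EnumTop (v : ι → ℕ → ℝ) (k T T' : ℕ) (c : ℕ → ℕ) (y : ℕ → ι) : Prop
    extends Enum v k T T' c where
  top : ∀ m, IsMaxAt v (c m - 1) (y m)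

lemma Enum.exists_enumTop (h : Enum v k T T' c) : ∃ y, EnumTop v k T T' c y := by
  have := h.nonempty
  have : ∀ m, ∃ i, IsMaxAt v (c m - 1) i := fun m =>
    h.exists_top (by have := h.base_lt m; omega)
  choose y hy using this
  exact ⟨y, h, hy⟩

namespace EnumTop

lemma top_mem (h : EnumTop v k T T' c y) (m : ℕ) : y m ∈ jset v (c m) :=
  h.isMaxAt_jump (h.ge m) (h.chg m) (h.top m)

lemma top_succ (h : EnumTop v k T T' c y) (m : ℕ) : IsMaxAt v (c m) (y (m + 1)) :=
  (h.top (m + 1)).congr (h.st_pred m)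

lemma top_succ_notMem (h : EnumTop v k T T' c y) (m : ℕ) : y (m + 1) ∉ jset v (c m) :=
  h.isMaxAt_not_jump (h.ge m) (h.chg m) (h.top_succ m)

lemma top_add (h : EnumTop v k T T' c y) (m : ℕ) : y (m + k) = y m :=
  (h.isMaxAt_periodic.1 (h.top (m + k))).unique (h.top m)

/-- The function provided by `Enum.exists_common`. -/
lemma exists_link (h : EnumTop v k T T' c y) {l m : ℕ} (hlm : l < m) (hm : m < l + k) :
    ∃ g, g ≠ y m ∧ Cons (v g) (c l) (c m) ∧ v (y m) (c l - 1) < v g (c l - 1) :=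
  h.exists_common hlm hm (h.top m)

lemma inter_unique (h : EnumTop v k T T' c y) (hk : 3 ≤ k) {a b : ℕ} (hab : a < b)
    (hb : b < a + k) {f g : ι} (fa : Jm (v f) (c a)) (fb : Jm (v f) (c b)) (ga : Jm (v g) (c a))
    (gb : Jm (v g) (c b)) : f = g := by
  classical
  rcases lt_or_ge (b + 1) (a + k) with h1 | h1
  · refine Finset.card_le_one.1 (h.card_inter_le (h.ge b) (h.ge a) (h.chg b) (h.chg a)
      (Or.inr ⟨?_, ?_⟩)) f (by simp [fa, fb]) g (by simp [ga, gb])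
    · rw [← h.st_pred]; exact (h.st_ne (by omega) (by omega)).symm
    · rw [← h.st_pred, ← h.st_pred]; exact (h.st_ne (by omega) (by omega)).symm
  · refine Finset.card_le_one.1 (h.card_inter_le (h.ge a) (h.ge b) (h.chg a) (h.chg b)
      (Or.inr ⟨?_, ?_⟩)) f (by simp [fa, fb]) g (by simp [ga, gb])
    · rw [← h.st_pred]; exact h.st_ne (by omega) (by omega)
    · rw [← h.st_pred, ← h.st_pred]; exact h.st_ne (by omega) (by omega)

lemma top_notMem (h : EnumTop v k T T' c y) (hk : 3 ≤ k) {a b : ℕ} (hab : a < b)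
    (hb : b < a + k) : ¬ Jm (v (y b)) (c a) := by
  intro hJ
  obtain ⟨g, g1, g2, -⟩ := h.exists_link hab hb
  exact g1 (h.inter_unique hk hab hb g2.1 g2.2.1 hJ (mem_jset.1 (h.top_mem b)))

lemma top_notMem' (h : EnumTop v k T T' c y) (hk : 3 ≤ k) {a b : ℕ} (hab : b < a)
    (hb : a < b + k) : ¬ Jm (v (y b)) (c a) := by
  rw [← h.top_add]
  exact h.top_notMem hk (by omega) (by omega)

lemma exists_prev (h : EnumTop v k T T' c y) {b : ℕ} (hb : k ≤ b + 1) {f : ι}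
    (hf : Jm (v f) (c b)) (hfy : f ≠ y b) : ∃ l, l < b ∧ b < l + k ∧ Cons (v f) (c l) (c b) := by
  classical
  have : ∀ l, ∃ g, l < b → b < l + k → g ≠ y b ∧ Cons (v g) (c l) (c b) := fun l => by
    by_cases h1 : l < b ∧ b < l + k
    · obtain ⟨g, g1, g2, -⟩ := h.exists_link h1.1 h1.2
      exact ⟨g, fun _ _ => ⟨g1, g2⟩⟩
    · exact ⟨y b, fun h2 h3 => absurd ⟨h2, h3⟩ h1⟩
  choose G hG using this
  have himg : (Finset.Ico (b + 1 - k) b).image G =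
      (jset v (c b)).erase (y b) := by
    refine Finset.eq_of_subset_of_card_le (fun f hf => ?_) ?_
    · obtain ⟨l, hl, rfl⟩ := Finset.mem_image.1 hf
      rw [Finset.mem_Ico] at hl
      have := hG l (by omega) (by omega)
      exact Finset.mem_erase.2 ⟨this.1, mem_jset.2 this.2.2.1⟩
    · rw [Finset.card_image_of_injOn, Finset.card_erase_of_mem (h.top_mem b),
        h.card_jset (h.ge b) (h.chg b), Nat.card_Ico]
      · omega
      · intro l hl l' hl' he
        simp only [Finset.coe_Ico, Set.mem_Ico] at hl hl'
        have h1 := (hG l (by omega) (by omega)).2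
        have h2 := (hG l' (by omega) (by omega)).2
        have he' : G l = G l' := he
        rw [he'] at h1
        exact h.mono.injective (h1.left_unique h2)
  have hmem : f ∈ (jset v (c b)).erase (y b) := Finset.mem_erase.2 ⟨hfy, mem_jset.2 hf⟩
  rw [← himg] at hmem
  obtain ⟨l, hl, rfl⟩ := Finset.mem_image.1 hmem
  rw [Finset.mem_Ico] at hl
  exact ⟨l, by omega, by omega, (hG l (by omega) (by omega)).2⟩

lemma exists_next (h : EnumTop v k T T' c y) (hk : 3 ≤ k) {b : ℕ} {f : ι}
    (hf : Jm (v f) (c b)) (hfy : f ≠ y b) : ∃ N, b < N ∧ N < b + k ∧ Cons (v f) (c b) (c N) := by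
  classical
  have : ∀ N, ∃ g, b < N → N < b + k → g ≠ y b ∧ Cons (v g) (c b) (c N) := fun N => by
    by_cases h1 : b < N ∧ N < b + k
    · obtain ⟨g, g1, g2, -⟩ := h.exists_link h1.1 h1.2
      refine ⟨g, fun _ _ => ⟨?_, g2⟩⟩
      rintro rfl
      exact h.top_notMem' hk h1.1 h1.2 g2.2.1
    · exact ⟨y b, fun h2 h3 => absurd ⟨h2, h3⟩ h1⟩
  choose G hG using this
  have himg : (Finset.Ioo b (b + k)).image G = (jset v (c b)).erase (y b) := by
    refine Finset.eq_of_subset_of_card_le (fun f hf => ?_) ?_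
    · obtain ⟨l, hl, rfl⟩ := Finset.mem_image.1 hf
      rw [Finset.mem_Ioo] at hl
      have := hG l (by omega) (by omega)
      exact Finset.mem_erase.2 ⟨this.1, mem_jset.2 this.2.1⟩
    · rw [Finset.card_image_of_injOn, Finset.card_erase_of_mem (h.top_mem b),
        h.card_jset (h.ge b) (h.chg b), Nat.card_Ioo]
      · omega
      · intro l hl l' hl' he
        simp only [Finset.coe_Ioo, Set.mem_Ioo] at hl hl'
        have h1 := (hG l (by omega) (by omega)).2
        have h2 := (hG l' (by omega) (by omega)).2
        have he' : G l = G l' := he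
        rw [he'] at h1
        exact h.mono.injective (h1.right_unique h2)
  have hmem : f ∈ (jset v (c b)).erase (y b) := Finset.mem_erase.2 ⟨hfy, mem_jset.2 hf⟩
  rw [← himg] at hmem
  obtain ⟨N, hN, rfl⟩ := Finset.mem_image.1 hmem
  rw [Finset.mem_Ioo] at hN
  exact ⟨N, by omega, by omega, (hG N (by omega) (by omega)).2⟩

lemma gap (h : EnumTop v k T T' c y) (hk : 3 ≤ k) {a b N : ℕ} {f : ι}
    (h1 : Cons (v f) (c a) (c b)) (h2 : Cons (v f) (c b) (c N)) : a + k ≤ N := by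
  by_contra hN
  have hab := h.mono.lt_iff_lt.1 h1.2.2.1
  have hbN := h.mono.lt_iff_lt.1 h2.2.2.1
  obtain ⟨g, -, g2, -⟩ := h.exists_link (show a < N by omega) (by omega)
  obtain rfl := h.inter_unique hk (show a < N by omega) (by omega) h1.1 h2.2.1 g2.1 g2.2.1
  have := h.mono.injective (h1.right_unique g2)
  omega

lemma nocons' (h : EnumTop v k T T' c y) {a b : ℕ} {f g : ι} (h1 : Cons (v f) (c a) (c b))
    (h2 : Cons (v g) (c a) (c b)) : f = g := by
  by_contra hne
  exact h.nocons f g hne _ _ (h.base_lt a).le h1 h2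

/-- The size estimate behind `jump_above`. -/
lemma mul_le (h : EnumTop v k T T' c y) (hk : 3 ≤ k) {m : ℕ} (hm : k ≤ m) :
    c m * c (m + 1) ≤ c (m + 2) := by
  obtain ⟨g, -, g2, -⟩ := h.exists_link (show m < m + 1 by omega) (by omega)
  obtain ⟨p, -, p2, -⟩ := h.exists_link (show m < m + 2 by omega) (by omega)
  obtain ⟨r, -, r2, -⟩ := h.exists_link (show m + 1 < m + 2 by omega) (by omega)
  have gy : g ≠ y m := fun h0 => h.top_notMem' hk (show m < m + 1 by omega) (by omega) (h0 ▸ g2.2.1)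
  have py : p ≠ y m := fun h0 => h.top_notMem' hk (show m < m + 2 by omega) (by omega) (h0 ▸ p2.2.1)
  have ry : r ≠ y (m + 1) := fun h0 =>
    h.top_notMem' hk (show m + 1 < m + 2 by omega) (by omega) (h0 ▸ r2.2.1)
  obtain ⟨a, a1, a2, a3⟩ := h.exists_prev (by omega) g2.1 gy
  obtain ⟨b, b1, b2, b3⟩ := h.exists_prev (by omega) p2.1 py
  obtain ⟨d, d1, d2, d3⟩ := h.exists_prev (by omega) r2.1 ry
  have ga := h.gap hk a3 g2
  have gb := h.gap hk b3 p2
  have gd := h.gap hk d3 r2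
  have hab : a ≠ b := by
    rintro rfl
    obtain rfl := h.nocons' a3 b3
    have := h.mono.injective (g2.right_unique p2)
    omega
  obtain rfl : b = d := by omega
  obtain ⟨A, A1, A2, -⟩ := (h.imf p).cons_add _ _ _ b3 p2
  obtain ⟨B, B1, B2, -⟩ := (h.imf r).cons_add _ _ _ d3 r2
  have hcop := (h.imf g).cons_coprime _ _ g2
  have hdvd : c (m + 1) ∣ A := hcop.symm.dvd_of_dvd_mul_right ⟨B, by linarith⟩
  have := Nat.le_of_dvd (by omega) hdvd
  rw [A2, mul_comm]
  nlinarith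

lemma jump_above_top (h : EnumTop v k T T' c y) (hk : 3 ≤ k) {m : ℕ} (hm : k ≤ m) {f : ι}
    (hf : Jm (v f) (c m)) : v (y (m + 1)) (c m - 1) < v f (c m - 1) := by
  have hmul := h.mul_le hk hm
  obtain ⟨g, -, g2, g3⟩ := h.exists_link (show m < m + 1 by omega) (by omega)
  by_cases hfy : f = y m
  · subst hfy
    exact h.top m _ fun h0 => h.top_succ_notMem m (h0 ▸ h.top_mem m)
  by_cases hfg : f = g
  · rwa [hfg]
  refine g3.trans ?_
  have gy : g ≠ y m := fun h0 => h.top_notMem' hk (show m < m + 1 by omega) (by omega) (h0 ▸ g2.2.1)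
  obtain ⟨a, a1, a2, a3⟩ := h.exists_prev (by omega) hf hfy
  obtain ⟨b, b1, b2, b3⟩ := h.exists_prev (by omega) g2.1 gy
  obtain ⟨N, N1, N2, N3⟩ := h.exists_next hk hf hfy
  have hN : m + 2 ≤ N := by
    by_contra hlt
    obtain rfl : N = m + 1 := by omega
    exact hfg (h.nocons' N3 g2)
  rw [a3.eq_of_mem (h.imf f).anti (show c a ≤ c m - 1 by have := a3.2.2.1; omega)
      (by have := a3.2.2.1; omega),
    b3.eq_of_mem (h.imf g).anti (show c b ≤ c m - 1 by have := b3.2.2.1; omega)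
      (by have := b3.2.2.1; omega)]
  have e1 := (h.imf f).cons_det _ _ a3
  have e2 := (h.imf g).cons_det _ _ b3
  have e3 := (h.imf g).cons_det _ _ g2
  have e4 := (h.imf f).cons_mul_lt N3
  have pf := (h.imf f).pos (c m)
  have q1 : (2 : ℝ) ≤ c b := by exact_mod_cast (by have := h.base_lt b; have := h.one_le; omega)
  have q2 : (c a : ℝ) < c m := by exact_mod_cast a3.2.2.1
  have q3 : (c m : ℝ) < c (m + 1) := by exact_mod_cast g2.2.2.1
  have q4 : (c m : ℝ) * c (m + 1) ≤ c N := by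
    exact_mod_cast hmul.trans (h.mono.monotone hN)
  have q5 := g2.2.1.lt_of_lt (h.imf g).anti g2.2.2.1
  have pg := (h.imf g).pos (c (m + 1))
  have q6 : (0 : ℝ) < c m := by exact_mod_cast (by have := h.base_lt m; omega)
  have r1 : 1 < 2 * ((c (m + 1) : ℝ) * v g (c m)) := by nlinarith
  have r2 : (c (m + 1) : ℝ) * (c a * v f (c m)) < 1 := by
    have : (c m : ℝ) * c (m + 1) * v f (c m) ≤ c N * v f (c m) := by gcongr
    have : (c a : ℝ) * (c (m + 1) * v f (c m)) ≤ c m * (c (m + 1) * v f (c m)) := by gcongr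
    linarith
  have r3 : (c (m + 1) : ℝ) * (c a * v f (c m)) < c (m + 1) * (c b * v g (c m)) := by
    have : (2 : ℝ) * (c (m + 1) * v g (c m)) ≤ c b * (c (m + 1) * v g (c m)) := by
      gcongr
      nlinarith
    linarith
  have r4 : (c a : ℝ) * v f (c m) < c b * v g (c m) := lt_of_mul_lt_mul_left r3 (by linarith)
  have r5 : (c m : ℝ) * v g (c b) < c m * v f (c a) := by linarith
  exact lt_of_mul_lt_mul_left r5 q6.le

/-- The functions jumping at a change are exactly the `k` largest ones before it. -/
lemma jump_above (h : EnumTop v k T T' c y) {m : ℕ} (hm : k ≤ m) {f j : ι}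
    (hf : Jm (v f) (c m)) (hj : ¬ Jm (v j) (c m)) : v j (c m - 1) < v f (c m - 1) := by
  classical
  rcases (show k = 2 ∨ 3 ≤ k by have := h.two_le; omega) with hk | hk
  · obtain ⟨x, x1, x2, -⟩ := h.exists_drop (h.ge m) (h.chg m) (mem_jset.2 hf)
    have h1 := h.card_jset (h.ge m) (h.chg m)
    have h2 := Finset.card_add_card_compl (jset v (c m))
    have h3 := h.card_eq
    subst hk
    have : j = x := Finset.card_le_one.1 (show (jset v (c m))ᶜ.card ≤ 1 by omega) j (by simpa using hj)
      x (by simpa using x1)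
    rwa [this]
  · refine lt_of_le_of_lt ?_ (h.jump_above_top hk hm hf)
    by_cases hjy : j = y (m + 1)
    · rw [hjy]
    · have h1 := h.top_succ m j hjy
      rw [not_jump_eq h.toSys hj, not_jump_eq h.toSys fun h0 => h.top_succ_notMem m (mem_jset.2 h0)]
      exact h1.le

lemma top_notMem_of_lt (h : EnumTop v k T T' c y) {a b : ℕ} (hab : a < b) (hb : b < a + k) :
    ¬ Jm (v (y b)) (c a) := by
  rcases (show k = 2 ∨ 3 ≤ k by have := h.two_le; omega) with hk | hk
  · obtain rfl : b = a + 1 := by omega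
    exact fun h0 => h.top_succ_notMem a (mem_jset.2 h0)
  · exact h.top_notMem hk hab hb

end EnumTop

end Largest

section Positions

/-- The index of the first position in row `j` of the enumeration `posIdx`. -/
def rowStart (k j : ℕ) : ℕ := j * k - j * (j - 1) / 2

lemma rowStart_succ {k j : ℕ} (hj : j < k) : rowStart k (j + 1) = rowStart k j + (k - j) := by
  have h1 := Nat.triangle_succ j
  have h2 : j * (j - 1) / 2 ≤ j * k :=
    (Nat.div_le_self _ _).trans (Nat.mul_le_mul_left _ (by omega))
  have h3 : j * (j - 1) / 2 + j ≤ j * k + k := by omega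
  rw [rowStart, rowStart, h1, Nat.succ_mul]
  omega

lemma two_mul_rowStart_add {k j : ℕ} (hj : j ≤ k) :
    2 * rowStart k j + (k - j) * (k - j + 1) = k * (k + 1) := by
  induction j with
  | zero => simp [rowStart]
  | succ j ih =>
    have h1 := ih (by omega)
    rw [rowStart_succ (by omega)]
    obtain ⟨d, rfl⟩ : ∃ d, k = j + 1 + d := ⟨k - (j + 1), by omega⟩
    rw [show j + 1 + d - j = d + 1 by omega] at *
    rw [show j + 1 + d - (j + 1) = d by omega]
    linarith

lemma rowStart_mono {k i j : ℕ} (hij : i ≤ j) (hj : j ≤ k) : rowStart k i ≤ rowStart k j := by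
  have h1 := two_mul_rowStart_add (hij.trans hj)
  have h2 := two_mul_rowStart_add hj
  have := Nat.mul_le_mul (show k - j ≤ k - i by omega) (show k - j + 1 ≤ k - i + 1 by omega)
  omega

variable {k : ℕ}

lemma rowStart_le_posIdx (p : PairIdx k) : rowStart k p.1.1 ≤ posIdx p := Nat.le_add_right _ _

lemma posIdx_lt_rowStart (p : PairIdx k) : posIdx p < rowStart k (p.1.1 + 1) := by
  have h1 : p.1.1.val ≤ p.1.2.val := p.2
  have h2 := p.1.2.isLt
  rw [rowStart_succ (by omega), posIdx, rowStart]
  split_ifs <;> omega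

lemma posIdx_lt (p : PairIdx k) : 2 * posIdx p < k * (k + 1) := by
  have h1 := posIdx_lt_rowStart p
  have h2 := rowStart_mono (show p.1.1.val + 1 ≤ k from p.1.1.isLt) le_rfl
  have h3 := two_mul_rowStart_add (le_refl k)
  omega

lemma posIdx_injective : Function.Injective (posIdx (k := k)) := by
  have hrow : ∀ p q : PairIdx k, posIdx p = posIdx q → p.1.1.val ≤ q.1.1.val := by
    intro p q h
    by_contra! hlt
    have h1 := rowStart_mono (show q.1.1.val + 1 ≤ p.1.1.val from hlt) p.1.1.isLt.le
    have h2 := rowStart_le_posIdx p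
    have h3 := posIdx_lt_rowStart q
    omega
  intro p q h
  have h1 : p.1.1.val = q.1.1.val := le_antisymm (hrow _ _ h) (hrow _ _ h.symm)
  have h2 : p.1.2.val = q.1.2.val := by
    have hp : p.1.1.val ≤ p.1.2.val := p.2
    have hq : q.1.1.val ≤ q.1.2.val := q.2
    have hp' := p.1.2.isLt
    have hq' := q.1.2.isLt
    simp only [posIdx, h1] at h
    split_ifs at h <;> omega
  exact Subtype.ext (Prod.ext (Fin.ext h1) (Fin.ext h2))

lemma posIdx_diag {i : ℕ} (hi : i < k) : posIdx (mkPos i i le_rfl hi) = rowStart k i := by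
  simp [posIdx, mkPos, rowStart]

/-- In an order enumerated along `posIdx`, the position gives the number of larger elements. -/
lemma card_above {ι : Type*} [Fintype ι] (hc : Fintype.card ι * 2 = k * (k + 1)) {u : ι → ℝ}
    {e : PairIdx k → ι} (he : Function.Bijective e)
    (ho : ∀ p q, posIdx p < posIdx q → u (e q) < u (e p)) (p : PairIdx k) :
    (Finset.univ.filter fun x => u (e p) < u x).card = posIdx p := by
  classical
  set E := Equiv.ofBijective e he
  set f : ι → ℕ := fun x => posIdx (E.symm x)
  have hf : Function.Injective f := posIdx_injective.comp E.symm.injective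
  have hall : Finset.univ.image f = Finset.range (Fintype.card ι) := by
    refine Finset.eq_of_subset_of_card_le (fun m hm => ?_) ?_
    · obtain ⟨x, -, rfl⟩ := Finset.mem_image.1 hm
      have := posIdx_lt (E.symm x)
      exact Finset.mem_range.2 (by simp only [f]; omega)
    · rw [Finset.card_image_of_injective _ hf, Finset.card_range, Finset.card_univ]
  have hpe : ∀ x, e (E.symm x) = x := E.apply_symm_apply
  have habove : ∀ x, u (e p) < u x ↔ f x < posIdx p := by
    intro x
    refine ⟨fun h => ?_, fun h => ?_⟩
    · by_contra! hle
      rcases hle.eq_or_lt with h1 | h1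
      · rw [posIdx_injective h1, hpe] at h
        exact lt_irrefl _ h
      · have := ho _ _ h1
        rw [hpe] at this
        exact lt_asymm h this
    · have := ho _ _ h
      rwa [hpe] at this
  have himg : (Finset.univ.filter fun x => u (e p) < u x).image f = Finset.range (posIdx p) := by
    ext m
    simp only [habove, Finset.mem_image, Finset.mem_filter, Finset.mem_univ, true_and,
      Finset.mem_range]
    refine ⟨?_, fun hm => ?_⟩
    · rintro ⟨x, h1, rfl⟩
      exact h1
    · have : m ∈ Finset.univ.image f := by
        rw [hall, Finset.mem_range]
        have := posIdx_lt p
        omega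
      obtain ⟨x, -, rfl⟩ := Finset.mem_image.1 this
      exact ⟨x, hm, rfl⟩
  rw [← Finset.card_image_of_injective _ hf, himg, Finset.card_range]

end Positions

namespace EnumTop

variable {ι : Type*} [Fintype ι] {v : ι → ℕ → ℝ} {k T T' : ℕ} {c : ℕ → ℕ} {y : ℕ → ι}

open scoped Classical in
/-- The functions jumping at one of the `i` changes from `c a` on. -/
noncomputable def jumped (v : ι → ℕ → ℝ) (c : ℕ → ℕ) (a i : ℕ) : Finset ι :=
  (Finset.range i).biUnion fun j => jset v (c (a + j))

lemma mem_jumped {a i : ℕ} {x : ι} : x ∈ jumped v c a i ↔ ∃ j < i, Jm (v x) (c (a + j)) := by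
  classical simp [jumped]

lemma lt_iff_of_not_jump (h : EnumTop v k T T' c y) {a i : ℕ} {x z : ι}
    (hx : ∀ j < i, ¬ Jm (v x) (c (a + j))) (hz : ∀ j < i, ¬ Jm (v z) (c (a + j))) :
    v z (c a - 1) < v x (c a - 1) ↔ v z (c (a + i) - 1) < v x (c (a + i) - 1) := by
  induction i with
  | zero => rfl
  | succ i ih =>
    rw [ih (fun j hj => hx j (by omega)) fun j hj => hz j (by omega),
      not_jump_eq h.toSys (hx i (by omega)), not_jump_eq h.toSys (hz i (by omega))]
    exact (st_iff (h.st_pred (a + i)) _ _).symm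

lemma above_iff_mem_jumped (h : EnumTop v k T T' c y) {a i : ℕ} (ha : k ≤ a) (hi : i < k) (x : ι) :
    v (y (a + i)) (c a - 1) < v x (c a - 1) ↔ x ∈ jumped v c a i := by
  classical
  have hy : ∀ j < i, ¬ Jm (v (y (a + i))) (c (a + j)) := fun j hj =>
    h.top_notMem_of_lt (by omega) (by omega)
  rw [mem_jumped]
  refine ⟨fun hlt => ?_, fun hex => ?_⟩
  · by_contra! hx
    rw [h.lt_iff_of_not_jump hx hy] at hlt
    refine lt_asymm hlt (h.top (a + i) x ?_)
    rintro rfl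
    exact lt_irrefl _ hlt
  · have hs := Nat.find_spec hex
    have hmin := fun j (hj : j < Nat.find hex) => Nat.find_min hex hj
    set j := Nat.find hex
    rw [h.lt_iff_of_not_jump (i := j) (fun l hl hJ => hmin l hl ⟨by omega, hJ⟩)
      fun l hl => hy l (by omega)]
    exact h.jump_above (by omega) hs.2 (hy j hs.1)

lemma card_jumped_le (h : EnumTop v k T T' c y) (a : ℕ) {i : ℕ} (hi : i ≤ k) :
    2 * (jumped v c a i).card + (k - i) * (k - i + 1) ≤ k * (k + 1) := by
  classical
  induction i with
  | zero => simp [jumped]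
  | succ i ih =>
    have h1 := ih (by omega)
    have hun : jumped v c a (i + 1) = jset v (c (a + i)) ∪ jumped v c a i := by
      simp only [jumped, Finset.range_add_one, Finset.biUnion_insert]
    have hinter : i ≤ (jset v (c (a + i)) ∩ jumped v c a i).card := by
      have : ∀ j : Fin i, ∃ g, Cons (v g) (c (a + j)) (c (a + i)) := fun j => by
        obtain ⟨g, -, g2, -⟩ := h.exists_link (show a + j < a + i by omega) (by omega)
        exact ⟨g, g2⟩
      choose G hG using this
      have hinj : Function.Injective G := fun j j' hj => by
        have h2 := hG j
        rw [hj] at h2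
        have := h.mono.injective (h2.left_unique (hG j'))
        exact Fin.ext (by omega)
      calc i = (Finset.univ.image G).card := by
            rw [Finset.card_image_of_injective _ hinj, Finset.card_univ, Fintype.card_fin]
        _ ≤ _ := Finset.card_le_card fun g hg => by
            obtain ⟨j, -, rfl⟩ := Finset.mem_image.1 hg
            exact Finset.mem_inter.2
              ⟨mem_jset.2 (hG j).2.1, mem_jumped.2 ⟨j, j.isLt, (hG j).1⟩⟩
    have h2 := Finset.card_union_add_card_inter (jset v (c (a + i))) (jumped v c a i)
    rw [← hun, h.card_jset (h.ge _) (h.chg _)] at h2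
    obtain ⟨d, rfl⟩ : ∃ d, k = i + 1 + d := ⟨k - (i + 1), by omega⟩
    rw [show i + 1 + d - i = d + 1 by omega] at h1
    rw [show i + 1 + d - (i + 1) = d by omega]
    nlinarith

lemma card_jumped (h : EnumTop v k T T' c y) (a : ℕ) {i : ℕ} (hi : i < k) :
    (jumped v c a i).card = rowStart k i := by
  classical
  have hle := h.card_jumped_le a hi.le
  have hrow := two_mul_rowStart_add hi.le
  have hres : ∀ j ≤ i, res (jumped v c a i)ᶜ (st v (c a - 1)) =
      res (jumped v c a i)ᶜ (st v (c (a + j) - 1)) := by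
    intro j hj
    induction j with
    | zero => rfl
    | succ j ih =>
      rw [ih (by omega), ← add_assoc, h.st_pred]
      convert h.res_compl_eq (τ := c (a + j)) (U := jumped v c a i)
        (fun x hx => mem_jumped.2 ⟨j, by omega, mem_jset.1 hx⟩)
  have hvis : ∀ m, st v (c m - 1) ∈ vis v Finset.univ := fun m =>
    h.mem _ (by have := h.base_lt m; omega)
  have hinj : Set.InjOn (fun m => st v (c m - 1)) (Set.Ioc a (a + i)) := by
    intro m hm m' hm' he
    simp only [Set.mem_Ioc] at hm hm'
    rcases lt_trichotomy m m' with hlt | rfl | hlt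
    · exact absurd he (h.st_ne hlt (by omega))
    · rfl
    · exact absurd he (h.st_ne hlt (by omega)).symm
  have hcard := h.card_removed (jumped v c a i)
    ((fun m => st v (c m - 1)) '' Set.Ioc a (a + i))
    (by rintro _ ⟨m, -, rfl⟩; exact hvis m)
    (by
      rintro _ ⟨m, hm, rfl⟩
      simp only [Set.mem_Ioc] at hm
      refine ⟨st v (c a - 1), hvis a, ?_, ?_⟩
      · rintro ⟨m', hm', he⟩
        simp only [Set.mem_Ioc] at hm'
        exact h.st_ne (show a < m' by omega) (by omega) he.symm
      · obtain ⟨j, rfl⟩ := Nat.exists_eq_add_of_lt hm.1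
        exact hres (j + 1) (by omega))
  rw [Set.InjOn.ncard_image hinj, ← Finset.coe_Ioc, Set.ncard_coe_finset, Nat.card_Ioc,
    Nat.add_sub_cancel_left] at hcard
  omega

/-- The successive largest functions are those on the diagonal of the initial enumeration. -/
lemma diag_eq_top (h : EnumTop v k T T' c y) {a : ℕ} (ha : k ≤ a) {e : PairIdx k → ι}
    (he : Function.Bijective e)
    (ho : ∀ p q, posIdx p < posIdx q → v (e q) (c a - 1) < v (e p) (c a - 1)) {i : ℕ}
    (hi : i < k) : e (mkPos i i le_rfl hi) = y (a + i) := by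
  classical
  have h1 := card_above h.card_eq (u := fun x => v x (c a - 1)) he ho (mkPos i i le_rfl hi)
  rw [posIdx_diag, ← h.card_jumped a hi,
    show jumped v c a i = Finset.univ.filter fun x => v (y (a + i)) (c a - 1) < v x (c a - 1) by
      ext x; simp [h.above_iff_mem_jumped ha hi]] at h1
  by_contra hne
  rcases lt_or_gt_of_ne (h.ne (c a - 1) (by have := h.base_lt a; omega) _ _ hne) with hlt | hlt
  · refine (Finset.card_lt_card (Finset.ssubset_iff.2 ⟨y (a + i), by simp, ?_⟩)).ne' h1
    refine Finset.insert_subset_iff.2 ⟨by simpa using hlt, fun x hx => ?_⟩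
    simp only [Finset.mem_filter, Finset.mem_univ, true_and] at hx ⊢
    exact hlt.trans hx
  · refine (Finset.card_lt_card (Finset.ssubset_iff.2 ⟨e (mkPos i i le_rfl hi), by simp, ?_⟩)).ne h1
    refine Finset.insert_subset_iff.2 ⟨by simpa using hlt, fun x hx => ?_⟩
    simp only [Finset.mem_filter, Finset.mem_univ, true_and] at hx ⊢
    exact hlt.trans hx

end EnumTop

section Transfer

lemma EnumTop.card_above_lt_iff {ι : Type*} [Fintype ι] {v : ι → ℕ → ℝ} {k T T' : ℕ} {c : ℕ → ℕ}
    {y : ℕ → ι} (h : EnumTop v k T T' c y) {m : ℕ} (hm : k ≤ m) (x : ι) :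
    Nat.card {j : ι // v x (c m - 1) < v j (c m - 1)} < k ↔ Jm (v x) (c m) := by
  classical
  have hJ := h.card_jset (h.ge m) (h.chg m)
  rw [Nat.card_eq_fintype_card, Fintype.card_subtype]
  refine ⟨fun hlt => ?_, fun hx => ?_⟩
  · by_contra hx
    have : jset v (c m) ⊆ Finset.univ.filter fun j => v x (c m - 1) < v j (c m - 1) :=
      fun j hj => by simpa using h.jump_above hm (mem_jset.1 hj) hx
    have := Finset.card_le_card this
    omega
  · rw [← hJ]
    refine Finset.card_lt_card (Finset.ssubset_iff.2 ⟨x, by simp, ?_⟩)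
    refine Finset.insert_subset_iff.2 ⟨mem_jset.2 hx, fun j hj => ?_⟩
    simp only [Finset.mem_filter, Finset.mem_univ, true_and] at hj
    by_contra hj'
    exact lt_asymm hj (h.jump_above hm hx (by simpa using hj'))

lemma not_continuousAt_psi_iff {α : ℝ} {N : ℕ} (hN : 2 ≤ N) :
    ¬ ContinuousAt (psi α) N ↔ Jm (dpsi α) N := by
  have hpred : ∀ s : ℝ, (N : ℝ) - 1 < s → s < N → psi α s = dpsi α (N - 1) := by
    intro s h1 h2
    have h3 : (2 : ℝ) ≤ N := by exact_mod_cast hN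
    rw [psi_eq_dpsi α (by linarith)]
    congr 1
    rw [Nat.floor_eq_iff (by linarith)]
    push_cast [show 1 ≤ N by omega]
    constructor <;> linarith
  have hval : ∀ s : ℝ, (N : ℝ) ≤ s → s < N + 1 → psi α s = dpsi α N := by
    intro s h1 h2
    have h3 : (2 : ℝ) ≤ N := by exact_mod_cast hN
    rw [psi_eq_dpsi α (by linarith)]
    congr 1
    rw [Nat.floor_eq_iff (by linarith)]
    exact ⟨h1, h2⟩
  refine ⟨fun hc => ?_, fun hJ hc => ?_⟩
  · by_contra hJ
    have heq : dpsi α (N - 1) = dpsi α N :=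
      le_antisymm (not_lt.1 hJ) (dpsi_anti α (Nat.sub_le _ _))
    refine hc (ContinuousAt.congr (f := fun _ => dpsi α N) continuousAt_const ?_)
    filter_upwards [Ioo_mem_nhds (show (N : ℝ) - 1 < N by linarith)
      (show (N : ℝ) < N + 1 by linarith)] with s hs
    rcases lt_or_ge s N with h1 | h1
    · rw [hpred s hs.1 h1, heq]
    · rw [hval s h1 hs.2]
  · have h1 : Filter.Tendsto (psi α) (nhdsWithin (N : ℝ) (Set.Iio N)) (nhds (psi α N)) :=
      hc.tendsto.mono_left nhdsWithin_le_nhds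
    have h2 : Filter.Tendsto (psi α) (nhdsWithin (N : ℝ) (Set.Iio N)) (nhds (dpsi α (N - 1))) := by
      refine tendsto_const_nhds.congr' ?_
      filter_upwards [Ioo_mem_nhdsLT (show (N : ℝ) - 1 < N by linarith)] with s hs
      exact (hpred s hs.1 hs.2).symm
    have h3 := tendsto_nhds_unique h1 h2
    rw [hval N le_rfl (by linarith)] at h3
    exact hJ.ne h3

variable {n : ℕ} {α : Fin n → ℝ}

lemma sameOrder_iff {t t' : ℝ} (ht : 1 ≤ t) (ht' : 1 ≤ t') :
    SameOrder α t t' ↔ st (fun i => dpsi (α i)) ⌊t⌋₊ = st (fun i => dpsi (α i)) ⌊t'⌋₊ := by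
  simp only [SameOrder, psi_eq_dpsi _ ht, psi_eq_dpsi _ ht', funext_iff, st, eq_iff_iff]

lemma PairwiseIndependent.exists_sys (hirr : ∀ i, Irrational (α i)) (h : PairwiseIndependent α) :
    ∃ T, Sys (fun i => dpsi (α i)) T := by
  classical
  obtain ⟨T, -, hT⟩ := h
  have hne : ∀ N, max ⌈T⌉₊ 1 ≤ N → ∀ i j, i ≠ j → dpsi (α i) N ≠ dpsi (α j) N := by
    intro N hN i j hij
    have h1 : (1 : ℝ) ≤ N := by exact_mod_cast (le_max_right _ _).trans hN
    have := hT N ((Nat.le_ceil T).trans (by exact_mod_cast (le_max_left _ _).trans hN)) i j hij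
    rwa [psi_eq_dpsi _ h1, psi_eq_dpsi _ h1, Nat.floor_natCast] at this
  have hcons : ∀ p : Fin n × Fin n, ∃ B : ℕ, p.1 ≠ p.2 → ∀ a b, B ≤ a →
      Cons (dpsi (α p.1)) a b → ¬ Cons (dpsi (α p.2)) a b := by
    rintro ⟨i, j⟩
    by_cases hij : i = j
    · exact ⟨0, fun h0 => absurd hij h0⟩
    · obtain ⟨B, hB⟩ := dpsi_no_common_cons (hirr i) (hirr j)
        fun h0 => hne _ le_rfl i j hij (congrFun h0 _)
      exact ⟨B, fun _ => hB⟩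
  choose B hB using hcons
  obtain ⟨M, hM⟩ := (Set.finite_range B).bddAbove
  refine ⟨max (max ⌈T⌉₊ 1) M, fun i => dpsi_imf (hirr i), fun N hN => hne N (by omega),
    fun i j hij a b ha => hB (i, j) hij a b ?_⟩
  have := hM ⟨(i, j), rfl⟩
  omega

lemma exists_antitone_enum {u : Fin n → ℝ} (hu : Function.Injective u) :
    ∃ w : Fin n → Fin n, Function.Bijective w ∧ ∀ p q, p < q → u (w q) < u (w p) := by
  refine ⟨Tuple.sort fun i => -u i, (Tuple.sort _).bijective, fun p q hpq => ?_⟩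
  have h1 := Tuple.monotone_sort (fun i => -u i) hpq.le
  simp only [Function.comp_apply, neg_le_neg_iff] at h1
  exact h1.lt_of_ne fun h0 => hpq.ne' ((Tuple.sort _).injective (hu h0))

lemma ncard_vis_le_kAlpha {T : ℕ} (h : Sys (fun i => dpsi (α i)) T) :
    (vis (fun i => dpsi (α i)) Finset.univ).ncard ≤ kAlpha α := by
  classical
  set F : (Fin n → Fin n) → Fin n → Fin n → Prop := fun w i j => ∃ p q, p < q ∧ w q = i ∧ w p = j
  have hsub : vis (fun i => dpsi (α i)) Finset.univ ⊆ F '' {w | OccursInfinitely α w} := by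
    intro r hr
    obtain ⟨M, hM, hMr⟩ := hr T
    rw [res_univ] at hMr
    obtain ⟨w, hw, hlt⟩ := exists_antitone_enum (u := fun i => dpsi (α i) M) fun i j hij => by
      by_contra hne
      exact h.ne M hM i j hne hij
    refine ⟨w, fun B => ?_, ?_⟩
    · obtain ⟨N, hN, hNr⟩ := hr (⌈B⌉₊ + 1)
      rw [res_univ, ← hMr] at hNr
      have h1 : (⌈B⌉₊ : ℝ) + 1 ≤ N := by exact_mod_cast hN
      have h2 := Nat.le_ceil B
      have h3 : (0 : ℝ) ≤ ⌈B⌉₊ := Nat.cast_nonneg _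
      refine ⟨N, by linarith, hw, fun p q hpq => ?_⟩
      rw [psi_eq_dpsi _ (by linarith), psi_eq_dpsi _ (by linarith), Nat.floor_natCast]
      exact (st_iff hNr _ _).2 (hlt p q hpq)
    · rw [← hMr]
      ext i j
      refine ⟨?_, fun hij => ?_⟩
      · rintro ⟨p, q, hpq, rfl, rfl⟩
        exact hlt p q hpq
      · obtain ⟨q, rfl⟩ := hw.surjective i
        obtain ⟨p, rfl⟩ := hw.surjective j
        refine ⟨p, q, ?_, rfl, rfl⟩
        by_contra! hle
        rcases hle.eq_or_lt with rfl | h1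
        · exact lt_irrefl _ hij
        · exact lt_asymm hij (hlt _ _ h1)
  calc _ ≤ (F '' {w | OccursInfinitely α w}).ncard := Set.ncard_le_ncard hsub (Set.toFinite _)
    _ ≤ _ := Set.ncard_image_le (Set.toFinite _)

lemma Enum.next_change {k T T' : ℕ} {c : ℕ → ℕ} (h : Enum (fun i => dpsi (α i)) k T T' c) {i : ℕ}
    {t t' : ℝ} (h1 : c i ≤ ⌊t⌋₊) (h2 : ⌊t⌋₊ < c (i + 1))
    (ht' : IsLeast {s : ℝ | t < s ∧ ¬ SameOrder α t s} t') : t' = c (i + 1) := by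
  have ht : 1 ≤ t := by
    rw [← Nat.one_le_floor_iff]
    have := h.base_lt i
    omega
  have hlt : t < c (i + 1) := (Nat.floor_lt (by linarith)).1 h2
  refine ht'.unique ⟨⟨hlt, ?_⟩, ?_⟩
  · rw [sameOrder_iff ht (ht.trans hlt.le), h.st_between h1 h2, Nat.floor_natCast, ← h.st_pred]
    exact h.chg (i + 1)
  · rintro s ⟨hs, hne⟩
    by_contra! hsc
    refine hne ((sameOrder_iff ht (by linarith)).2 ?_)
    rw [h.st_between h1 h2, h.st_between (h1.trans (Nat.floor_mono hs.le))
      ((Nat.floor_lt (by linarith)).2 hsc)]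

lemma EnumTop.top_add_mul {ι : Type*} [Fintype ι] {v : ι → ℕ → ℝ} {k T T' : ℕ} {c : ℕ → ℕ}
    {y : ℕ → ι} (h : EnumTop v k T T' c y) (m s : ℕ) : y (m + k * s) = y m := by
  induction s with
  | zero => rfl
  | succ s ih => rw [Nat.mul_succ, ← add_assoc, h.top_add, ih]

end Transfer

/-- **Theorem (Main), item (v).** The `k` functions largest at `t_{i-1+ks}` are exactly
the ones jumping at `t_{i+ks}`, and `ψ_{i,i}` is the largest function at `t_{i-1+ks}`.
(`0`-based: `i` below is the paper's `i - 1`.) -/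
theorem stmt14 (k : ℕ) (hk : 2 ≤ k) (n : ℕ) (hn : n = k * (k + 1) / 2)
    (α : Fin n → ℝ) (hirr : ∀ i, Irrational (α i)) (hind : PairwiseIndependent α)
    (hka : kAlpha α = k) :
    ∃ T : ℝ, 1 < T ∧ ∀ t0 : ℝ, T ≤ t0 → ∀ ts : ℕ → ℝ, ts 0 = t0 → IsChangeSeq α ts →
      ∀ e : PairIdx k → Fin n, IsOrderVecP α t0 e →
        ∀ i : ℕ, ∀ hi : i < k, ∀ s : ℕ,
          (∀ m : Fin n,
            (Nat.card {j : Fin n //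
                psi (α j) (ts (i + k * s)) > psi (α m) (ts (i + k * s))} < k
              ↔ ¬ ContinuousAt (psi (α m)) (ts (i + 1 + k * s)))) ∧
          (∀ j : Fin n, j ≠ e (mkPos i i le_rfl hi) →
            psi (α (e (mkPos i i le_rfl hi))) (ts (i + k * s)) >
              psi (α j) (ts (i + k * s))) := by
  obtain ⟨T0, hsys⟩ := hind.exists_sys hirr
  obtain ⟨T1, T2, -, hreg⟩ := hsys.exists_reg
  have hcard : Fintype.card (Fin n) * 2 = k * (k + 1) := by
    rw [Fintype.card_fin, hn, Nat.div_mul_cancel (Nat.even_mul_succ_self k).two_dvd]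
  obtain ⟨c, hc⟩ := (hreg.full hk hcard ((ncard_vis_le_kAlpha hsys).trans hka.le)).exists_enum
  obtain ⟨y, h⟩ := hc.exists_enumTop
  have hone := h.one_le
  refine ⟨c k, by exact_mod_cast hone.trans_lt (h.base_lt k), fun t0 ht0 ts hts0 hts e he => ?_⟩
  have hfloor : c k ≤ ⌊t0⌋₊ := Nat.le_floor ht0
  obtain ⟨b, hb1, hb2⟩ := h.exists_index ((h.mono.monotone (Nat.zero_le k)).trans hfloor)
  have hkb : k ≤ b := Nat.lt_succ_iff.1 (h.mono.lt_iff_lt.1 (hfloor.trans_lt hb2))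
  have hloc : ∀ m, c (b + m) ≤ ⌊ts m⌋₊ ∧ ⌊ts m⌋₊ < c (b + m + 1) := by
    intro m
    induction m with
    | zero => rw [hts0]; exact ⟨hb1, hb2⟩
    | succ m ih =>
      rw [h.next_change ih.1 ih.2 (hts m), Nat.floor_natCast]
      exact ⟨le_rfl, h.mono (by omega)⟩
  have hval : ∀ m j, psi (α j) (ts m) = dpsi (α j) ⌊ts m⌋₊ := fun m j =>
    psi_eq_dpsi _ ((Nat.one_le_floor_iff _).1 (by
      have := (hloc m).1
      have := h.base_lt (b + m)
      omega))
  have hst : ∀ m, st (fun i => dpsi (α i)) ⌊ts m⌋₊ =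
      st (fun i => dpsi (α i)) (c (b + m + 1) - 1) := fun m => by
    rw [h.st_between (hloc m).1 (hloc m).2, h.st_pred]
  intro i hi s
  have hdiag : e (mkPos i i le_rfl hi) = y (b + (i + k * s) + 1) := by
    rw [h.diag_eq_top (show k ≤ b + 1 by omega) he.1 (fun p q hpq => ?_) hi,
      show b + (i + k * s) + 1 = b + 1 + i + k * s by ring, h.top_add_mul]
    have := he.2 p q hpq
    rw [← hts0, hval, hval] at this
    exact (st_iff (hst 0) _ _).1 this
  refine ⟨fun m => ?_, fun j hj => ?_⟩
  · rw [show i + 1 + k * s = i + k * s + 1 by ring,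
      h.next_change (hloc _).1 (hloc _).2 (hts (i + k * s)), not_continuousAt_psi_iff (by
        have := h.base_lt (b + (i + k * s) + 1)
        omega), ← h.card_above_lt_iff (show k ≤ b + (i + k * s) + 1 by omega)]
    simp only [hval, gt_iff_lt, st_iff (hst (i + k * s))]
  · rw [hdiag] at hj ⊢
    rw [hval, hval]
    exact (st_iff (hst (i + k * s)) _ _).2 (h.top _ j hj)
end

section
/- Let (α_1, α_2, α_3) be a 3-tuple of pairwise independent irrational numbers with k(α) = 2. Then there exists T > 1 such that for every t_0 ≥ T the following holds, where {t_i} is the sequence of moments of permutation changes starting from t_0 and v_α(t_0) = (v_1, v_2, v_3): v_α(t_i) = (v_1, v_2, v_3) for all even i and v_α(t_i) = (v_3, v_2, v_1) for all odd i; the function ψ_{α_{v_2}} is discontinuous at every t_i with i ≥ 1 and is continuous at every real t ∈ (t_i, t_{i+1}) for all i ≥ 0; the function ψ_{α_{v_1}} is discontinuous at t_i for every odd i ≥ 1 and continuous at t_i for every even i ≥ 2; and the function ψ_{α_{v_3}} is discontinuous at t_i for every even i ≥ 2 and continuous at t_i for every odd i ≥ 1. -/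
/-- The distance from `q * α` to the nearest integer. -/
noncomputable def intErr (α : ℝ) (q : ℤ) : ℝ := distToInt ((q : ℝ) * α)

/-- `q` is a best approximation denominator of `α`: it improves on every smaller one. -/
def IsRec (α : ℝ) (q : ℤ) : Prop := 1 ≤ q ∧ ∀ k : ℤ, 1 ≤ k → k < q → intErr α q < intErr α k

/-- `q < q'` are consecutive best approximation denominators of `α`. -/
structure Consec (α : ℝ) (q q' : ℤ) : Prop where
  left : IsRec α q
  right : IsRec α q'
  lt : q < q'
  between : ∀ k : ℤ, q < k → k < q' → ¬ IsRec α k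

section BestApproximations

variable {α : ℝ}

theorem intErr_le (α : ℝ) (q r : ℤ) : intErr α q ≤ |(q : ℝ) * α - r| := round_le _ _

theorem exists_sign_mul_intErr (α : ℝ) (q : ℤ) :
    ∃ σ p : ℤ, (σ = 1 ∨ σ = -1) ∧ (q : ℝ) * α - p = σ * intErr α q := by
  rcases abs_choice ((q : ℝ) * α - round ((q : ℝ) * α)) with e | e
  · exact ⟨1, round ((q : ℝ) * α), Or.inl rfl, by simp [intErr, distToInt, e]⟩
  · exact ⟨-1, round ((q : ℝ) * α), Or.inr rfl, by simp [intErr, distToInt, e]⟩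

theorem intErr_nonneg (α : ℝ) (q : ℤ) : 0 ≤ intErr α q := abs_nonneg _

theorem intErr_pos (hα : Irrational α) {q : ℤ} (hq : q ≠ 0) : 0 < intErr α q := by
  refine abs_pos.2 fun h => ?_
  exact (hα.intCast_mul hq).ne_int _ (sub_eq_zero.1 h)

theorem bddBelow_psi (α x : ℝ) : BddBelow
    ((fun q : ℤ => distToInt ((q : ℝ) * α)) '' {q : ℤ | 1 ≤ q ∧ (q : ℝ) ≤ x}) :=
  ⟨0, by rintro _ ⟨q, -, rfl⟩; exact abs_nonneg _⟩

theorem psi_le {x : ℝ} {k : ℤ} (hk : 1 ≤ k) (hkx : (k : ℝ) ≤ x) : psi α x ≤ intErr α k :=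
  csInf_le (bddBelow_psi α x) ⟨k, ⟨hk, hkx⟩, rfl⟩

theorem le_psi {x c : ℝ} (hx : 1 ≤ x) (h : ∀ k : ℤ, 1 ≤ k → (k : ℝ) ≤ x → c ≤ intErr α k) :
    c ≤ psi α x := by
  refine le_csInf ⟨_, 1, ⟨le_rfl, by simpa using hx⟩, rfl⟩ ?_
  rintro _ ⟨q, ⟨h1, h2⟩, rfl⟩
  exact h q h1 h2

theorem psi_floor_s15 (α x : ℝ) : psi α (⌊x⌋ : ℝ) = psi α x := by
  have : ∀ q : ℤ, (q : ℝ) ≤ (⌊x⌋ : ℝ) ↔ (q : ℝ) ≤ x := fun q => by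
    rw [Int.cast_le, Int.le_floor]
  simp only [psi, this]

theorem psi_antitone {x y : ℝ} (hx : 1 ≤ x) (hxy : x ≤ y) : psi α y ≤ psi α x :=
  le_psi hx fun _ h1 h2 => psi_le h1 (h2.trans hxy)

theorem psi_succ_of_not_isRec {m : ℤ} (hm : 1 ≤ m) (h : ¬ IsRec α (m + 1)) :
    psi α ((m + 1 : ℤ) : ℝ) = psi α (m : ℝ) := by
  have hm' : (1 : ℝ) ≤ m := by exact_mod_cast hm
  apply le_antisymm
  · exact psi_antitone hm' (by push_cast; linarith)
  · refine le_psi (by push_cast; linarith) fun k hk1 hk2 => ?_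
    have hk2 : k ≤ m + 1 := by exact_mod_cast hk2
    rcases hk2.lt_or_eq with hlt | rfl
    · exact psi_le hk1 (by exact_mod_cast (by omega : k ≤ m))
    · simp only [IsRec, not_and, not_forall, not_lt] at h
      obtain ⟨j, hj1, hj2, hj3⟩ := h hk1
      exact (psi_le hj1 (by exact_mod_cast (by omega : j ≤ m))).trans hj3

theorem psi_of_isRec {q : ℤ} (hq : IsRec α q) : psi α (q : ℝ) = intErr α q := by
  apply le_antisymm (psi_le hq.1 le_rfl)
  refine le_psi (by exact_mod_cast hq.1) fun k hk1 hk2 => ?_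
  have hk2 : k ≤ q := by exact_mod_cast hk2
  rcases hk2.lt_or_eq with hlt | rfl
  · exact (hq.2 k hk1 hlt).le
  · exact le_rfl

theorem psi_eq_intErr {q m : ℤ} (hq : IsRec α q) (hqm : q ≤ m)
    (h : ∀ k, q < k → k ≤ m → ¬ IsRec α k) : psi α (m : ℝ) = intErr α q := by
  induction m, hqm using Int.leInduction with
  | base => exact psi_of_isRec hq
  | succ m hm ih =>
    rw [psi_succ_of_not_isRec (hq.1.trans hm) (h _ (by omega) le_rfl)]
    exact ih fun k h1 h2 => h k h1 (by omega)

theorem Consec.psi_eq {q q' m : ℤ} (h : Consec α q q') (h1 : q ≤ m) (h2 : m < q') :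
    psi α (m : ℝ) = intErr α q :=
  psi_eq_intErr h.left h1 fun k hk1 hk2 => h.between k hk1 (by omega)

theorem isRec_of_psi_ne {m : ℤ} (hm : 1 ≤ m)
    (h : psi α ((m + 1 : ℤ) : ℝ) ≠ psi α (m : ℝ)) : IsRec α (m + 1) := by
  by_contra h'
  exact h (psi_succ_of_not_isRec hm h')

theorem isRec_one (α : ℝ) : IsRec α 1 := ⟨le_rfl, fun k h1 h2 => by omega⟩

theorem exists_prev_isRec (α : ℝ) {m : ℤ} (hm : 1 < m) :
    ∃ q, IsRec α q ∧ q < m ∧ ∀ k, q < k → k < m → ¬ IsRec α k := by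
  obtain ⟨q, ⟨h1, h2⟩, h3⟩ := Int.exists_greatest_of_bdd (P := fun q => IsRec α q ∧ q < m)
    ⟨m, fun z hz => hz.2.le⟩ ⟨1, isRec_one α, hm⟩
  exact ⟨q, h1, h2, fun k hk1 hk2 hk => by have := h3 k ⟨hk, hk2⟩; omega⟩

theorem psi_pos (hα : Irrational α) {m : ℤ} (hm : 1 ≤ m) : 0 < psi α (m : ℝ) := by
  obtain ⟨q, h1, h2, h3⟩ := exists_prev_isRec α (m := m + 1) (by omega)
  rw [psi_eq_intErr h1 (by omega) fun k hk1 hk2 => h3 k hk1 (by omega)]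
  exact intErr_pos hα (by have := h1.1; omega)

theorem exists_intErr_le (α : ℝ) {n : ℤ} (hn : 1 < n) :
    ∃ k : ℤ, 1 ≤ k ∧ k < n ∧ intErr α k * n ≤ 1 := by
  obtain ⟨k, hk0, hkn, hk⟩ := Real.exists_nat_abs_mul_sub_round_le α (n := (n - 1).toNat) (by omega)
  refine ⟨k, by omega, by omega, ?_⟩
  have hcast : (((n - 1).toNat : ℕ) : ℝ) + 1 = n := by
    have : (((n - 1).toNat : ℕ) : ℤ) + 1 = n := by omega
    exact_mod_cast this
  rw [hcast] at hk
  have hn0 : (0 : ℝ) < n := by exact_mod_cast (by omega : (0 : ℤ) < n)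
  rw [le_div_iff₀ hn0] at hk
  simpa [intErr, distToInt] using hk

theorem exists_isRec_gt (hα : Irrational α) {m : ℤ} (hm : 1 ≤ m) : ∃ q, IsRec α q ∧ m < q := by
  have hpos := psi_pos hα hm
  obtain ⟨n, hn⟩ := exists_nat_gt (1 / psi α (m : ℝ))
  obtain ⟨k, hk1, -, hk⟩ := exists_intErr_le α (n := (n : ℤ) + 2) (by omega)
  have hk3 : intErr α k < psi α (m : ℝ) := by
    rw [div_lt_iff₀ hpos] at hn
    push_cast at hk
    have := intErr_nonneg α k
    by_contra! hc
    nlinarith [Nat.cast_nonneg (α := ℝ) n]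
  obtain ⟨q, ⟨hq1, hq2⟩, hq3⟩ := Int.exists_least_of_bdd
    (P := fun q => 1 ≤ q ∧ intErr α q < psi α (m : ℝ)) ⟨1, fun z hz => hz.1⟩ ⟨k, hk1, hk3⟩
  refine ⟨q, ⟨hq1, fun j hj1 hj2 => ?_⟩, ?_⟩
  · by_contra! hc
    have := hq3 j ⟨hj1, hc.trans_lt hq2⟩
    omega
  · by_contra! hc
    exact absurd (psi_le hq1 (by exact_mod_cast hc : (q : ℝ) ≤ m)) (not_le.2 hq2)

theorem exists_next_isRec (hα : Irrational α) (m : ℤ) :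
    ∃ q, IsRec α q ∧ m ≤ q ∧ ∀ k, m ≤ k → k < q → ¬ IsRec α k := by
  obtain ⟨r, hr, hr'⟩ := exists_isRec_gt hα (m := max m 1) (le_max_right _ _)
  obtain ⟨q, ⟨h1, h2⟩, h3⟩ := Int.exists_least_of_bdd (P := fun q => IsRec α q ∧ m ≤ q)
    ⟨m, fun z hz => hz.2⟩ ⟨r, hr, by omega⟩
  exact ⟨q, h1, h2, fun k hk1 hk2 hk => by have := h3 k ⟨hk, hk1⟩; omega⟩

theorem Consec.one_le {q q' : ℤ} (h : Consec α q q') : (1 : ℝ) ≤ q := by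
  exact_mod_cast h.left.1

theorem Consec.cast_lt {q q' : ℤ} (h : Consec α q q') : (q : ℝ) < q' := by
  exact_mod_cast h.lt

theorem Consec.intErr_lt {q q' : ℤ} (h : Consec α q q') : intErr α q' < intErr α q :=
  h.right.2 q h.left.1 h.lt

/-- Below `q'`, no denominator beats `q`. -/
theorem Consec.intErr_le_of_lt {q q' : ℤ} (h : Consec α q q') {k : ℤ} (h1 : 1 ≤ k) (h2 : k < q') :
    intErr α q ≤ intErr α k := by
  have hlt := h.lt
  have hk : (k : ℝ) ≤ (q' - 1 : ℤ) := by exact_mod_cast (by omega : k ≤ q' - 1)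
  rw [← h.psi_eq (m := q' - 1) (by omega) (by omega)]
  exact psi_le h1 hk

/-- The errors of consecutive best approximations have opposite signs, and the two approximations
span the lattice of all integer approximations. -/
theorem Consec.exists_basis (hα : Irrational α) {q q' : ℤ} (h : Consec α q q') :
    ∃ σ p p' : ℤ, (σ = 1 ∨ σ = -1) ∧ (q : ℝ) * α - p = σ * intErr α q ∧
      (q' : ℝ) * α - p' = -(σ * intErr α q') ∧ q * p' - q' * p = σ := by
  have hq := h.left.1
  have hlt := h.lt
  have hA : 0 < intErr α q := intErr_pos hα (by omega)
  have hA' : 0 < intErr α q' := intErr_pos hα (by omega)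
  have hAA := h.intErr_lt
  obtain ⟨σ, p, hσ, hp⟩ := exists_sign_mul_intErr α q
  obtain ⟨σ', p', hσ', hp'⟩ := exists_sign_mul_intErr α q'
  have hopp : σ' = -σ := by
    by_contra hne
    have hs : σ' = σ := by omega
    subst hs
    have h1 := intErr_le α (q' - q) (p' - p)
    have h2 := h.intErr_le_of_lt (k := q' - q) (by omega) (by omega)
    have h3 : (((q' - q : ℤ) : ℝ) * α - ((p' - p : ℤ) : ℝ)) =
        σ' * (intErr α q' - intErr α q) := by push_cast; linarith
    have h4 : |((σ' : ℤ) : ℝ)| = 1 := by rcases hσ with rfl | rfl <;> norm_num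
    rw [h3, abs_mul, h4, one_mul, abs_sub_comm, abs_of_pos (by linarith)] at h1
    linarith
  subst hopp
  push_cast at hp'
  have hcomb : ((q * p' - q' * p : ℤ) : ℝ) = σ * (q' * intErr α q + q * intErr α q') := by
    push_cast
    linear_combination (q' : ℝ) * hp - (q : ℝ) * hp'
  have hsq : ((σ : ℤ) : ℝ) * σ = 1 := by rcases hσ with rfl | rfl <;> norm_num
  have hdet : ((σ * (q * p' - q' * p) : ℤ) : ℝ) = q' * intErr α q + q * intErr α q' := by
    rw [Int.cast_mul, hcomb, ← mul_assoc, hsq, one_mul]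
  have hq0 : (0 : ℝ) < q := by have := h.one_le; linarith
  have hlt' := h.cast_lt
  obtain ⟨k, hk1, hk2, hk3⟩ := exists_intErr_le α (n := q') (by omega)
  have hle := h.intErr_le_of_lt hk1 hk2
  have hup : (q' : ℝ) * intErr α q ≤ 1 := by nlinarith
  have hone : σ * (q * p' - q' * p) = 1 := by
    have l1 : (0 : ℝ) < ((σ * (q * p' - q' * p) : ℤ) : ℝ) := by
      rw [hdet]
      have := mul_pos hq0 hA'
      have := mul_pos (hq0.trans hlt') hA
      linarith
    have l2 : ((σ * (q * p' - q' * p) : ℤ) : ℝ) < 2 := by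
      rw [hdet]
      nlinarith
    have l1 : 0 < σ * (q * p' - q' * p) := by exact_mod_cast l1
    have l2 : σ * (q * p' - q' * p) < 2 := by exact_mod_cast l2
    omega
  refine ⟨σ, p, p', hσ, hp, by linarith, ?_⟩
  rcases hσ with rfl | rfl <;> linarith

theorem Consec.det_eq_one (hα : Irrational α) {q q' : ℤ} (h : Consec α q q') :
    q' * intErr α q + q * intErr α q' = 1 := by
  obtain ⟨σ, p, p', hσ, hp, hp', hd⟩ := h.exists_basis hα
  have hd : (q : ℝ) * p' - q' * p = σ := by exact_mod_cast hd
  have hsq : (σ : ℝ) * σ = 1 := by rcases hσ with rfl | rfl <;> norm_num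
  linear_combination (1 - q' * intErr α q - q * intErr α q') * hsq + (σ : ℝ) * hd -
    (σ : ℝ) * q' * hp + (σ : ℝ) * q * hp'

theorem Consec.exists_coords (hα : Irrational α) {q q' : ℤ} (h : Consec α q q') (n : ℤ) :
    ∃ (x y : ℤ) (ε : ℝ), |ε| = intErr α n ∧ n = x * q' + y * q ∧
      ε = y * intErr α q - x * intErr α q' := by
  obtain ⟨σ, p, p', hσ, hp, hp', hd⟩ := h.exists_basis hα
  have hsq : σ * σ = 1 := by rcases hσ with rfl | rfl <;> norm_num
  have hsq' : (σ : ℝ) * σ = 1 := by exact_mod_cast hsq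
  have habs : |(σ : ℝ)| = 1 := by rcases hσ with rfl | rfl <;> norm_num
  obtain ⟨r, hr⟩ : ∃ r : ℤ, intErr α n = |(n : ℝ) * α - r| := ⟨_, rfl⟩
  have hn : n = (σ * (q * r - n * p)) * q' + (σ * (n * p' - r * q')) * q := by
    linear_combination (-n : ℤ) * hsq - σ * n * hd
  have hrr : r = (σ * (q * r - n * p)) * p' + (σ * (n * p' - r * q')) * p := by
    linear_combination (-r : ℤ) * hsq - σ * r * hd
  generalize σ * (q * r - n * p) = x at hn hrr
  generalize σ * (n * p' - r * q') = y at hn hrr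
  refine ⟨x, y, σ * (n * α - r), by rw [hr, abs_mul, habs, one_mul], hn, ?_⟩
  subst hn hrr
  push_cast
  linear_combination (σ : ℝ) * x * hp' + (σ : ℝ) * y * hp +
    (y * intErr α q - x * intErr α q') * hsq'

theorem Consec.intErr_comb_le (hα : Irrational α) {q q' : ℤ} (h : Consec α q q') (x y : ℤ) :
    intErr α (x * q' + y * q) ≤ |y * intErr α q - x * intErr α q'| := by
  obtain ⟨σ, p, p', hσ, hp, hp', hd⟩ := h.exists_basis hα
  have habs : |(σ : ℝ)| = 1 := by rcases hσ with rfl | rfl <;> norm_num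
  have h1 := intErr_le α (x * q' + y * q) (x * p' + y * p)
  have h2 : (((x * q' + y * q : ℤ) : ℝ) * α - ((x * p' + y * p : ℤ) : ℝ)) =
      σ * (y * intErr α q - x * intErr α q') := by
    push_cast
    linear_combination (x : ℝ) * hp' + (y : ℝ) * hp
  rwa [h2, abs_mul, habs, one_mul] at h1

/-- The recurrence satisfied by three consecutive best approximations. -/
theorem Consec.recurrence (hα : Irrational α) {a b c : ℤ} (h : Consec α a b)
    (h' : Consec α b c) :
    ∃ z : ℤ, 1 ≤ z ∧ c = z * b + a ∧ intErr α a = z * intErr α b + intErr α c := by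
  obtain ⟨x, y, ε, hε, hc, hε'⟩ := h.exists_coords hα c
  have d1 := h.det_eq_one hα
  have d2 := h'.det_eq_one hα
  have l1 := h.cast_lt
  have l2 := h'.cast_lt
  have e1 := h.intErr_lt
  have e2 := h'.intErr_lt
  have o1 := h.one_le
  have hc0 := intErr_pos hα (q := c) (by have := h'.right.1; omega)
  have hcR : (c : ℝ) = x * b + y * a := by exact_mod_cast hc
  have hy : (y : ℝ) = c * intErr α b + b * ε := by
    rw [hcR, hε']; linear_combination (-(y : ℝ)) * d1
  have hx : (x : ℝ) = c * intErr α a - a * ε := by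
    rw [hcR, hε']; linear_combination (-(x : ℝ)) * d1
  rcases (abs_eq hc0.le).1 hε with rfl | rfl
  · have hy1 : y = 1 := by
      have : (y : ℝ) = 1 := by rw [hy, d2]
      exact_mod_cast this
    subst hy1
    refine ⟨x, ?_, by omega, by push_cast at hε'; linarith⟩
    have : (0 : ℝ) < x := by rw [hx]; nlinarith
    have : 0 < x := by exact_mod_cast this
    omega
  · exfalso
    have y0 : (0 : ℝ) < y := by rw [hy]; nlinarith
    have y1 : (y : ℝ) < 1 := by rw [hy]; nlinarith
    have y0 : 0 < y := by exact_mod_cast y0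
    have y1 : y < 1 := by exact_mod_cast y1
    omega

end BestApproximations

section Pairs

variable {f g : ℝ}

/-- Neither of two irrationality measure functions eventually stays strictly below the other. -/
theorem exists_psi_le (hf : Irrational f) (hg : Irrational g) (T : ℝ) :
    ∃ t, T ≤ t ∧ psi f t ≤ psi g t := by
  by_contra! hcon
  obtain ⟨p0, hp0, hp0T, -⟩ := exists_next_isRec hf ⌈T⌉
  obtain ⟨r0, hr0, hr0p⟩ := exists_isRec_gt hg hp0.1
  have hp01 := hp0.1
  obtain ⟨p, hp, hpr, hpn⟩ := exists_prev_isRec f (m := r0) (by omega)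
  obtain ⟨p', hp', hpr', hpn'⟩ := exists_next_isRec hf r0
  have hpT : T ≤ p := by
    have h1 : p0 ≤ p := by
      by_contra! hc
      exact hpn p0 hc hr0p hp0
    have h2 := Int.le_ceil T
    have h3 : ((⌈T⌉ : ℤ) : ℝ) ≤ p := by exact_mod_cast hp0T.trans h1
    linarith
  have hpp : Consec f p p' := ⟨hp, hp', by omega, fun k h1 h2 => by
    by_cases hk : k < r0
    · exact hpn k h1 hk
    · exact hpn' k (by omega) h2⟩
  have hp1 := hp.1
  obtain ⟨r, hr, hr1, hrn⟩ := exists_next_isRec hg (p + 1)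
  have hrr0 : r ≤ r0 := by
    by_contra! hc
    exact hrn r0 (by omega) hc hr0
  obtain ⟨n, hn, hn1, hnn⟩ := exists_prev_isRec g (m := p + 1) (by omega)
  have hnr : Consec g n r := ⟨hn, hr, by omega, fun k h1 h2 => by
    by_cases hk : k < p + 1
    · exact hnn k h1 hk
    · exact hrn k (by omega) h2⟩
  have hlt1 := hcon p hpT
  rw [hnr.psi_eq (by omega) (by omega), hpp.psi_eq le_rfl hpp.lt] at hlt1
  have hlt2 := hcon p' (hpT.trans hpp.cast_lt.le)
  rw [psi_of_isRec hp'] at hlt2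
  have df := hpp.det_eq_one hf
  have dg := hnr.det_eq_one hg
  have o1 := hnr.one_le
  have o2 := hpp.one_le
  have c1 := hpp.cast_lt
  have c2 := hnr.cast_lt
  have e1 := hnr.intErr_lt
  have i1 := intErr_nonneg g r
  have i2 := intErr_nonneg f p'
  have crp : (r : ℝ) ≤ p' := by exact_mod_cast hrr0.trans hpr'
  have cnp : (n : ℝ) ≤ p := by exact_mod_cast (by omega : n ≤ p)
  obtain ⟨r', hr', hrr', hrn'⟩ := exists_next_isRec hg (r + 1)
  by_cases hc : r' ≤ p'
  · obtain ⟨z, hz, hz', -⟩ := hnr.recurrence hg ⟨hr, hr', by omega, fun k h1 h2 =>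
      hrn' k (by omega) h2⟩
    have hsum : r + n ≤ p' := by
      have : r ≤ z * r := by have := hr.1; nlinarith
      omega
    have hsum : (r : ℝ) + n ≤ p' := by exact_mod_cast hsum
    nlinarith
  · have hv : psi g (p' : ℝ) = intErr g r :=
      psi_eq_intErr hr (by omega) fun k h1 h2 => hrn' k (by omega) (by omega)
    rw [hv] at hlt2
    nlinarith

/-- If two irrationality measure functions differ somewhere, then large consecutive best
approximation denominators are not shared. -/
theorem exists_bound_of_shared (hf : Irrational f) (hg : Irrational g)
    (hne : ∃ x, psi f x ≠ psi g x) :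
    ∃ B : ℝ, ∀ s t : ℤ, Consec f s t → Consec g s t → (s : ℝ) ≤ B := by
  by_contra! hcon
  have key : ∀ f g : ℝ, Irrational f → Irrational g →
      (∀ B : ℝ, ∃ s t : ℤ, Consec f s t ∧ Consec g s t ∧ B < s) →
      ∀ n : ℤ, intErr g n ≤ intErr f n := by
    intro f g hf hg hcon n
    refine le_of_forall_pos_le_add fun ε hε => ?_
    obtain ⟨s, t, h1, h2, hs⟩ := hcon (|(n : ℝ)| / ε)
    obtain ⟨x, y, e, he, hn, he'⟩ := h1.exists_coords hf n
    have hle := h2.intErr_comb_le hg x y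
    rw [← hn] at hle
    have hnR : (n : ℝ) = x * t + y * s := by exact_mod_cast hn
    have df := h1.det_eq_one hf
    have dg := h2.det_eq_one hg
    have o := h1.one_le
    have c := h1.cast_lt
    have hs0 : (0 : ℝ) < s := by linarith
    have i1 := intErr_nonneg f s
    have i2 := intErr_nonneg f t
    have i3 := intErr_nonneg g s
    have i4 := intErr_nonneg g t
    have hd : |intErr g s - intErr f s| ≤ 1 := by
      rw [abs_le]; constructor <;> nlinarith
    have hyx : (y * intErr g s - x * intErr g t) =
        e + n * ((intErr g s - intErr f s) / s) := by
      rw [he', hnR]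
      field_simp
      linear_combination (x : ℝ) * (df - dg)
    have hb : |(n : ℝ) * ((intErr g s - intErr f s) / s)| ≤ ε := by
      rw [abs_mul, abs_div, abs_of_pos hs0, ← mul_div_assoc, div_le_iff₀ hs0]
      rw [div_lt_iff₀ hε] at hs
      have := mul_le_mul_of_nonneg_left hd (abs_nonneg (n : ℝ))
      linarith
    rw [hyx] at hle
    have := abs_add_le e (n * ((intErr g s - intErr f s) / s))
    linarith
  obtain ⟨x, hx⟩ := hne
  refine hx ?_
  have heq : ∀ n : ℤ, intErr f n = intErr g n := fun n => le_antisymm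
    (key g f hg hf (fun B => (hcon B).imp fun s ⟨t, h1, h2, h3⟩ => ⟨t, h2, h1, h3⟩) n)
    (key f g hf hg (fun B => (hcon B).imp fun s ⟨t, h1, h2, h3⟩ => ⟨t, h1, h2, h3⟩) n)
  have heq : ∀ n : ℤ, distToInt ((n : ℝ) * f) = distToInt ((n : ℝ) * g) := heq
  simp only [psi, heq]

/-- If `psi g` jumps at `s` and `t`, lies below `psi f` on `[s, t)` and above it at `t`, then it
does not jump in between. -/
theorem not_isRec_of_lt_of_crossing (hf : Irrational f) (hg : Irrational g) {s t : ℤ}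
    (hs : IsRec g s) (ht : IsRec g t) (hlt : ∀ m : ℤ, s ≤ m → m < t → psi g (m : ℝ) < psi f (m : ℝ))
    (hcross : psi f (t : ℝ) < psi g (t : ℝ)) (k : ℤ) (hsk : s < k) (hkt : k < t) :
    ¬ IsRec g k := by
  intro hk
  have hs1 := hs.1
  obtain ⟨b, hb, hbt, hbn⟩ := exists_prev_isRec g (m := t) (by omega)
  have hkb : k ≤ b := by
    by_contra! hc
    exact hbn k hc hkt hk
  obtain ⟨a, ha, hab, han⟩ := exists_prev_isRec g (m := b) (by omega)
  have hsa : s ≤ a := by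
    by_contra! hc
    exact han s hc (by omega) hs
  have cab : Consec g a b := ⟨ha, hb, hab, han⟩
  have cbt : Consec g b t := ⟨hb, ht, hbt, hbn⟩
  have hft : IsRec f t := by
    have h1 : psi f (t : ℝ) < psi f ((t - 1 : ℤ) : ℝ) := by
      have h2 := hlt (t - 1) (by omega) (by omega)
      have h3 : psi g (t : ℝ) ≤ psi g ((t - 1 : ℤ) : ℝ) :=
        psi_antitone (by exact_mod_cast (by omega : (1 : ℤ) ≤ t - 1)) (by push_cast; linarith)
      linarith
    have := isRec_of_psi_ne (α := f) (m := t - 1) (by omega) (by simpa using h1.ne)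
    simpa using this
  rw [psi_of_isRec hft, psi_of_isRec ht] at hcross
  obtain ⟨c, hc, hcb, hcn⟩ := exists_prev_isRec f (m := b) (by omega)
  obtain ⟨d, hd, hbd, hdn⟩ := exists_next_isRec hf b
  have hdt : d ≤ t := by
    by_contra! h
    exact hdn t hbt.le h hft
  have ccd : Consec f c d := ⟨hc, hd, by omega, fun k h1 h2 => by
    by_cases hk : k < b
    · exact hcn k h1 hk
    · exact hdn k (by omega) h2⟩
  have hfc : intErr g a < intErr f c := by
    have := hlt (max c a) (by omega) (by omega)
    rwa [ccd.psi_eq (by omega) (by omega), cab.psi_eq (by omega) (by omega)] at this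
  obtain ⟨z, hz, hzt, hze⟩ := cab.recurrence hg cbt
  have dab := cab.det_eq_one hg
  have dbt := cbt.det_eq_one hg
  have dcd := ccd.det_eq_one hf
  have oa := cab.one_le
  have oc := ccd.one_le
  have lab := cab.cast_lt
  have lbt := cbt.cast_lt
  have lcd := ccd.cast_lt
  have nft := intErr_nonneg f t
  have ngt := intErr_nonneg g t
  have ngb := intErr_nonneg g b
  have nfd := intErr_nonneg f d
  rcases hdt.lt_or_eq with hdt | rfl
  · have hbdR : (b : ℝ) ≤ d := by exact_mod_cast hbd
    by_cases hac : a ≤ c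
    · have hacR : (a : ℝ) ≤ c := by exact_mod_cast hac
      have hfd := hlt d (by omega) hdt
      rw [psi_of_isRec hd, cbt.psi_eq hbd hdt] at hfd
      have h1 : (b : ℝ) * intErr g a < d * intErr f c := by
        apply mul_lt_mul' hbdR hfc (intErr_nonneg g a); linarith
      have h2 : (a : ℝ) * intErr g b ≤ c * intErr f d := by
        apply mul_le_mul hacR hfd.le ngb; linarith
      linarith
    · have hcaR : (c : ℝ) < a := by exact_mod_cast not_le.1 hac
      have hdtR : (d : ℝ) < t := by exact_mod_cast hdt
      have hdlt : intErr f t < intErr f d := hft.2 d hd.1 hdt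
      obtain ⟨x, y, ε, hε, htxy, hε'⟩ := ccd.exists_coords hf t
      have htR : (t : ℝ) = x * d + y * c := by exact_mod_cast htxy
      have hεle := abs_le.1 hε.le
      have hx : (x : ℝ) = t * intErr f c - c * ε := by
        rw [htR, hε']; linear_combination (-(x : ℝ)) * dcd
      have hy : (y : ℝ) = t * intErr f d + d * ε := by
        rw [htR, hε']; linear_combination (-(y : ℝ)) * dcd
      have hzR : (z : ℝ) = t * intErr g a - a * intErr g t := by
        have htz : (t : ℝ) = z * b + a := by exact_mod_cast hzt
        rw [htz]
        linear_combination (-(z : ℝ)) * dab - (a : ℝ) * hze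
      have hzx : (z : ℝ) < x := by
        have h1 : (t : ℝ) * intErr g a < t * intErr f c := by
          apply mul_lt_mul_of_pos_left hfc; linarith
        have h2 : (c : ℝ) * ε ≤ a * intErr g t := by nlinarith
        linarith
      have hy0 : (0 : ℝ) < y := by
        rw [hy]; nlinarith
      have hzx : z < x := by exact_mod_cast hzx
      have hy0 : 0 < y := by exact_mod_cast hy0
      have hc1 := hc.1
      have h1 : x * d < t := by nlinarith
      have h2 : t < (z + 1) * b := by linarith
      have hd1 := hd.1
      nlinarith
  · have hzR : (1 : ℝ) ≤ z := by exact_mod_cast hz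
    have h1 : intErr g b + intErr g d ≤ intErr g a := by nlinarith
    nlinarith

end Pairs

section Continuity

variable {α : ℝ}

theorem not_continuousAt_psi {q : ℤ} (h1 : 1 < q) (h : IsRec α q) :
    ¬ ContinuousAt (psi α) (q : ℝ) := by
  intro hc
  have hlt : psi α (q : ℝ) < psi α ((q - 1 : ℤ) : ℝ) := by
    obtain ⟨p, hp, hpq, hpn⟩ := exists_prev_isRec α h1
    rw [psi_of_isRec h, psi_eq_intErr hp (by omega) fun k h1 h2 => hpn k h1 (by omega)]
    exact h.2 p hp.1 hpq
  have hev := hc.eventually (Iio_mem_nhds hlt)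
  obtain ⟨ε, hε, hball⟩ := Metric.eventually_nhds_iff.1 hev
  obtain ⟨δ, hδ0, hδ⟩ : ∃ δ : ℝ, 0 < δ ∧ δ < min ε 1 := exists_between (lt_min hε one_pos)
  have h2 := hball (y := (q : ℝ) - δ) (by
    rw [Real.dist_eq]
    simpa [abs_of_pos hδ0] using hδ.trans_le (min_le_left _ _))
  have hfl : ⌊(q : ℝ) - δ⌋ = q - 1 := by
    have := hδ.trans_le (min_le_right ε 1)
    rw [Int.floor_eq_iff]
    push_cast
    constructor <;> linarith
  rw [← psi_floor_s15, hfl] at h2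
  exact lt_irrefl _ h2

theorem continuousAt_psi {t : ℝ} (ht : 1 < t) (h : ∀ q : ℤ, (q : ℝ) = t → ¬ IsRec α q) :
    ContinuousAt (psi α) t := by
  have hcongr : psi α =ᶠ[nhds t] fun _ => psi α t := by
    by_cases hfl : (⌊t⌋ : ℝ) = t
    · have h1 : (1 : ℤ) < ⌊t⌋ := by
        have : ((1 : ℤ) : ℝ) < (⌊t⌋ : ℝ) := by rw [hfl]; simpa using ht
        exact_mod_cast this
      have hstep := psi_succ_of_not_isRec (α := α) (m := ⌊t⌋ - 1) (by omega)
        (by simpa using h _ hfl)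
      rw [sub_add_cancel, hfl] at hstep
      filter_upwards [Ioo_mem_nhds (sub_one_lt t) (lt_add_one t)] with x hx
      rcases lt_or_ge x t with hxt | hxt
      · have : ⌊x⌋ = ⌊t⌋ - 1 := by
          rw [Int.floor_eq_iff]; push_cast; rw [hfl]; constructor <;> linarith [hx.1]
        rw [← psi_floor_s15, this, hstep]
      · have : ⌊x⌋ = ⌊t⌋ := by
          rw [Int.floor_eq_iff, hfl]; exact ⟨hxt, hx.2⟩
        rw [← psi_floor_s15, this, psi_floor_s15]
    · have h1 : (⌊t⌋ : ℝ) < t := lt_of_le_of_ne (Int.floor_le t) hfl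
      filter_upwards [Ioo_mem_nhds h1 (Int.lt_floor_add_one t)] with x hx
      have : ⌊x⌋ = ⌊t⌋ := by
        rw [Int.floor_eq_iff]; exact ⟨hx.1.le, hx.2⟩
      rw [← psi_floor_s15, this, psi_floor_s15]
  exact continuousAt_const.congr hcongr.symm

end Continuity

/-- At time `x` one has `psi a x > psi b x > psi c x`. -/
def Descending (a b c x : ℝ) : Prop := psi b x < psi a x ∧ psi c x < psi b x

theorem descending_floor {a b c x : ℝ} : Descending a b c (⌊x⌋ : ℝ) ↔ Descending a b c x := by
  simp only [Descending, psi_floor_s15]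

theorem Descending.not_reverse {a b c x : ℝ} (h : Descending a b c x) : ¬ Descending c b a x :=
  fun hrev => lt_asymm h.1 hrev.2

/-- The behaviour of three irrationality measure functions at an order reversal which has been
preceded by another one. -/
theorem isRec_at_reversal {a b c T₁ T : ℝ} (ha : Irrational a) (hb : Irrational b)
    (hc : Irrational c) (hT₁ : 1 ≤ T₁)
    (hord : ∀ x, T₁ ≤ x → Descending a b c x ∨ Descending c b a x)
    (hshare : ∀ s t : ℤ, Consec b s t → Consec c s t → (s : ℝ) ≤ T₁)
    (hprev : ∃ n : ℤ, T₁ ≤ n ∧ (n : ℝ) ≤ T ∧ Descending c b a n)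
    {τ t : ℝ} (hτ : T ≤ τ) (hτt : τ < t) (hon : ∀ x, τ ≤ x → x < t → Descending a b c x)
    (hat : Descending c b a t) :
    ∃ m : ℤ, (m : ℝ) = t ∧ IsRec a m ∧ IsRec b m ∧ ¬ IsRec c m ∧
      ∀ k : ℤ, τ < k → (k : ℝ) < t → ¬ IsRec b k := by
  obtain ⟨n₀, hn₀1, hn₀T, hn₀⟩ := hprev
  obtain ⟨n, ⟨hn1, hn2, hn3⟩, hnmax⟩ := Int.exists_greatest_of_bdd
    (P := fun n : ℤ => T₁ ≤ n ∧ n ≤ ⌊τ⌋ ∧ Descending c b a n)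
    ⟨⌊τ⌋, fun z hz => hz.2.1⟩ ⟨n₀, hn₀1, Int.le_floor.2 (hn₀T.trans hτ), hn₀⟩
  have hn1' : (1 : ℤ) ≤ n := by
    have : ((1 : ℤ) : ℝ) ≤ n := by push_cast; linarith
    exact_mod_cast this
  have hflτ := (hon τ le_rfl hτt)
  have hnlt : n < ⌊τ⌋ := by
    refine lt_of_le_of_ne hn2 fun h => ?_
    rw [h, descending_floor] at hn3
    exact hflτ.not_reverse hn3
  have hsτ : ((n + 1 : ℤ) : ℝ) ≤ τ := Int.le_floor.1 (by omega)
  have hdesc : ∀ x : ℝ, ((n + 1 : ℤ) : ℝ) ≤ x → x < t → Descending a b c x := by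
    intro x hx1 hx2
    rcases le_or_gt τ x with h | h
    · exact hon x h hx2
    have hnx : n + 1 ≤ ⌊x⌋ := Int.le_floor.2 hx1
    have hT₁x : T₁ ≤ (⌊x⌋ : ℝ) := by
      have : (n : ℝ) ≤ ⌊x⌋ := by exact_mod_cast (by omega : n ≤ ⌊x⌋)
      linarith
    rw [← descending_floor]
    refine (hord _ hT₁x).resolve_right fun h' => ?_
    have := hnmax ⌊x⌋ ⟨hT₁x, Int.floor_le_floor h.le, h'⟩
    omega
  have hst : ((n + 1 : ℤ) : ℝ) < t := hsτ.trans_lt hτt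
  have htint : (⌊t⌋ : ℝ) = t := by
    by_contra hne
    have hlt := lt_of_le_of_ne (Int.floor_le t) hne
    have h1 := hdesc (⌊t⌋ : ℝ) (by exact_mod_cast Int.le_floor.2 hst.le) hlt
    exact (descending_floor.1 h1).not_reverse hat
  obtain ⟨m, rfl⟩ : ∃ m : ℤ, (m : ℝ) = t := ⟨_, htint⟩
  have hsm : n + 1 < m := by exact_mod_cast hst
  have hD : ∀ k : ℤ, n + 1 ≤ k → k < m → Descending a b c k := fun k h1 h2 =>
    hdesc k (by exact_mod_cast h1) (by exact_mod_cast h2)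
  have hmono : ∀ (β : ℝ) (k : ℤ), 1 ≤ k → psi β ((k + 1 : ℤ) : ℝ) ≤ psi β (k : ℝ) :=
    fun β k hk => psi_antitone (by exact_mod_cast hk) (by push_cast; linarith)
  have hs := hD (n + 1) le_rfl hsm
  have hm' := hD (m - 1) (by omega) (by omega)
  have ma := hmono a n hn1'
  have mc := hmono c (m - 1) (by omega)
  rw [sub_add_cancel] at mc
  have bs : IsRec b (n + 1) :=
    isRec_of_psi_ne hn1' (ne_of_lt (by linarith [hs.1, hs.2, hn3.1, hn3.2]))
  have cs : IsRec c (n + 1) :=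
    isRec_of_psi_ne hn1' (ne_of_lt (by linarith [hs.1, hs.2, hn3.1, hn3.2]))
  have am : IsRec a m := by
    rw [← sub_add_cancel m 1]
    refine isRec_of_psi_ne (by omega) (ne_of_lt ?_)
    rw [sub_add_cancel]
    linarith [hm'.1, hm'.2, hat.1, hat.2]
  have bm : IsRec b m := by
    rw [← sub_add_cancel m 1]
    refine isRec_of_psi_ne (by omega) (ne_of_lt ?_)
    rw [sub_add_cancel]
    linarith [hm'.1, hm'.2, hat.1, hat.2]
  have hb_no := not_isRec_of_lt_of_crossing ha hb bs bm (fun k h1 h2 => (hD k h1 h2).1) hat.2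
  refine ⟨m, rfl, am, bm, fun cm => ?_, fun k hk1 hk2 => hb_no k ?_ (by exact_mod_cast hk2)⟩
  · have hc_no := not_isRec_of_lt_of_crossing hb hc cs cm (fun k h1 h2 => (hD k h1 h2).2) hat.1
    have := hshare (n + 1) m ⟨bs, bm, hsm, hb_no⟩ ⟨cs, cm, hsm, hc_no⟩
    push_cast at this
    linarith
  · have := hsτ.trans_lt hk1
    exact_mod_cast this

section OrderVectors

variable {n : ℕ} {α : Fin n → ℝ}

theorem exists_isOrderVec {t : ℝ} (h : ∀ i j, i ≠ j → psi (α i) t ≠ psi (α j) t) :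
    ∃ v, IsOrderVec α t v := by
  refine ⟨Tuple.sort fun i => -psi (α i) t, Equiv.bijective _, fun p q hpq => ?_⟩
  have h1 := Tuple.monotone_sort (fun i => -psi (α i) t) hpq.le
  have h2 := h _ _ ((Tuple.sort fun i => -psi (α i) t).injective.ne hpq.ne)
  exact lt_of_le_of_ne (neg_le_neg_iff.1 h1) h2.symm

theorem IsOrderVec.sameOrder {v : Fin n → Fin n} {t t' : ℝ} (h : IsOrderVec α t v)
    (h' : IsOrderVec α t' v) : SameOrder α t t' := by
  intro i j
  obtain ⟨p, rfl⟩ := h.1.2 i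
  obtain ⟨q, rfl⟩ := h.1.2 j
  rcases lt_trichotomy p q with hpq | rfl | hpq
  · exact iff_of_false (h.2 p q hpq).not_gt (h'.2 p q hpq).not_gt
  · simp
  · exact iff_of_true (h.2 q p hpq) (h'.2 q p hpq)

theorem IsOrderVec.of_sameOrder {v : Fin n → Fin n} {t t' : ℝ} (h : IsOrderVec α t v)
    (hs : SameOrder α t t') : IsOrderVec α t' v :=
  ⟨h.1, fun p q hpq => (hs _ _).1 (h.2 p q hpq)⟩

theorem IsOrderVec.unique {v w : Fin n → Fin n} {t : ℝ} (hv : IsOrderVec α t v)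
    (hw : IsOrderVec α t w) : v = w := by
  have hmono : ∀ {u}, IsOrderVec α t u → StrictMono fun p => -psi (α (u p)) t :=
    fun hu p q hpq => neg_lt_neg (hu.2 p q hpq)
  have hrange : ∀ {u}, IsOrderVec α t u →
      Set.range (fun p => -psi (α (u p)) t) = Set.range fun i => -psi (α i) t :=
    fun hu => hu.1.2.range_comp fun i => -psi (α i) t
  have heq := (hmono hv).range_inj (hmono hw) |>.1 ((hrange hv).trans (hrange hw).symm)
  funext p
  obtain ⟨q, hq⟩ := hw.1.2 (v p)
  have h1 : -psi (α (w q)) t = -psi (α (w p)) t := by rw [hq]; exact congrFun heq p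
  rw [← hq, (hmono hw).injective h1]

theorem bijective_comp_rev {v : Fin n → Fin n} (h : Function.Bijective v) :
    Function.Bijective fun p : Fin n => v p.rev :=
  h.comp Fin.rev_bijective

/-- If only the orders `w` and `w'` occur, a change of order starting at `w` leads to `w'`. -/
theorem IsChangeSeq.step {ts : ℕ → ℝ} (hts : IsChangeSeq α ts) {S : ℝ} {w w' : Fin n → Fin n}
    (hord : ∀ x, S ≤ x → IsOrderVec α x w ∨ IsOrderVec α x w') {i : ℕ} (hi : S ≤ ts i)
    (h : IsOrderVec α (ts i) w) :
    ts i < ts (i + 1) ∧ IsOrderVec α (ts (i + 1)) w' ∧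
      ∀ x, ts i ≤ x → x < ts (i + 1) → IsOrderVec α x w := by
  obtain ⟨⟨hlt, hne⟩, hmin⟩ := hts i
  refine ⟨hlt, (hord _ (hi.trans hlt.le)).resolve_left fun h' => hne (h.sameOrder h'), ?_⟩
  intro x hx1 hx2
  rcases hx1.eq_or_lt with rfl | hx1
  · exact h
  · by_contra hc
    exact hx2.not_ge (hmin ⟨hx1, fun hs => hc (h.of_sameOrder hs)⟩)

theorem eventually_occursInfinitely (α : Fin n → ℝ) :
    ∀ᶠ t in Filter.atTop, ∀ v, IsOrderVec α t v → OccursInfinitely α v := by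
  rw [Filter.eventually_all]
  intro v
  by_cases h : OccursInfinitely α v
  · exact Filter.Eventually.of_forall fun _ _ => h
  · simp only [OccursInfinitely, not_forall, not_exists, not_and] at h
    obtain ⟨T, hT⟩ := h
    filter_upwards [Filter.eventually_gt_atTop T] with t ht hv
    exact absurd hv (hT t ht)

/-- If exactly two order vectors occur infinitely often, then they are reverse to each other. -/
theorem exists_reverse_orders (hirr : ∀ i, Irrational (α i)) (hind : PairwiseIndependent α)
    (hka : kAlpha α = 2) :
    ∃ u : Fin n → Fin n, OccursInfinitely α u ∧ OccursInfinitely α (fun p => u p.rev) ∧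
      ∀ᶠ t in Filter.atTop, IsOrderVec α t u ∨ IsOrderVec α t (fun p => u p.rev) := by
  obtain ⟨T₀, -, hT₀⟩ := hind
  rw [kAlpha, Nat.card_coe_set_eq, Set.ncard_eq_two] at hka
  obtain ⟨u, w, -, huw⟩ := hka
  have hocc : ∀ v, OccursInfinitely α v ↔ v = u ∨ v = w := fun v => by
    simpa using Set.ext_iff.1 huw v
  have hu := (hocc u).2 (Or.inl rfl)
  have hw := (hocc w).2 (Or.inr rfl)
  have hev : ∀ᶠ t in Filter.atTop, IsOrderVec α t u ∨ IsOrderVec α t w := by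
    filter_upwards [Filter.eventually_ge_atTop T₀, eventually_occursInfinitely α] with t ht h
    obtain ⟨v, hv⟩ := exists_isOrderVec (hT₀ t ht)
    rcases (hocc v).1 (h v hv) with rfl | rfl
    · exact Or.inl hv
    · exact Or.inr hv
  have hrev : ∀ t, IsOrderVec α t w → IsOrderVec α t (fun p => u p.rev) := by
    intro t ht
    have hub : Function.Bijective u := (hu 0).choose_spec.2.1
    refine ⟨bijective_comp_rev hub, fun p q hpq => ?_⟩
    obtain ⟨S, hS⟩ := Filter.eventually_atTop.1 hev
    have hlt : q.rev < p.rev := Fin.rev_lt_rev.2 hpq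
    obtain ⟨t', ht', hle⟩ := exists_psi_le (hirr (u q.rev)) (hirr (u p.rev)) (max S T₀)
    have hne := hT₀ t' ((le_max_right _ _).trans ht') _ _ (hub.1.ne hlt.ne)
    rcases hS t' ((le_max_left _ _).trans ht') with h | h
    · exact absurd (h.2 _ _ hlt) hle.not_gt
    · exact (h.sameOrder ht _ _).1 (lt_of_le_of_ne hle hne)
  refine ⟨u, hu, fun T => ?_, hev.mono fun t ht => ht.imp_right (hrev t)⟩
  obtain ⟨t, ht, h⟩ := hw T
  exact ⟨t, ht, hrev t h⟩

theorem isOrderVec_three {α : Fin 3 → ℝ} {t : ℝ} {v : Fin 3 → Fin 3} :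
    IsOrderVec α t v ↔
      Function.Bijective v ∧ Descending (α (v 0)) (α (v 1)) (α (v 2)) t := by
  refine and_congr_right fun _ => ⟨fun h => ⟨h 0 1 (by decide), h 1 2 (by decide)⟩, ?_⟩
  rintro ⟨h1, h2⟩ p q hpq
  fin_cases p <;> fin_cases q <;> first | exact absurd hpq (by decide) | skip
  · exact h1
  · exact h2.trans h1
  · exact h2

theorem isOrderVec_three_rev {α : Fin 3 → ℝ} {t : ℝ} {v : Fin 3 → Fin 3}
    (hv : Function.Bijective v) :
    IsOrderVec α t (fun p => v p.rev) ↔ Descending (α (v 2)) (α (v 1)) (α (v 0)) t := by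
  rw [isOrderVec_three]
  exact and_iff_right (bijective_comp_rev hv)

end OrderVectors

/-- The case `k = 2`, `n = 3` of the main theorem, described explicitly. -/
theorem stmt15 (α : Fin 3 → ℝ) (hirr : ∀ i, Irrational (α i))
    (hind : PairwiseIndependent α) (hka : kAlpha α = 2) :
    ∃ T : ℝ, 1 < T ∧ ∀ t0 : ℝ, T ≤ t0 → ∀ ts : ℕ → ℝ, ts 0 = t0 → IsChangeSeq α ts →
      ∀ v : Fin 3 → Fin 3, IsOrderVec α t0 v →
        (∀ i : ℕ, Even i → IsOrderVec α (ts i) v) ∧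
        (∀ i : ℕ, Odd i → IsOrderVec α (ts i) (fun p => v p.rev)) ∧
        (∀ i : ℕ, 1 ≤ i → ¬ ContinuousAt (psi (α (v 1))) (ts i)) ∧
        (∀ i : ℕ, ∀ t : ℝ, ts i < t → t < ts (i + 1) → ContinuousAt (psi (α (v 1))) t) ∧
        (∀ i : ℕ, Odd i → ¬ ContinuousAt (psi (α (v 0))) (ts i)) ∧
        (∀ i : ℕ, Even i → 2 ≤ i → ContinuousAt (psi (α (v 0))) (ts i)) ∧
        (∀ i : ℕ, Even i → 2 ≤ i → ¬ ContinuousAt (psi (α (v 2))) (ts i)) ∧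
        (∀ i : ℕ, Odd i → ContinuousAt (psi (α (v 2))) (ts i)) := by
  obtain ⟨u, hu, hur, hev⟩ := exists_reverse_orders hirr hind hka
  obtain ⟨T₀, -, hT₀⟩ := hind
  obtain ⟨T₁, hT₁⟩ := Filter.eventually_atTop.1 hev
  have hshare : ∀ i j : Fin 3, ∃ B : ℝ, i ≠ j → ∀ s t : ℤ, Consec (α i) s t →
      Consec (α j) s t → (s : ℝ) ≤ B := fun i j => by
    by_cases hij : i = j
    · exact ⟨0, fun h => absurd hij h⟩
    · obtain ⟨B, hB⟩ := exists_bound_of_shared (hirr i) (hirr j) ⟨T₀, hT₀ T₀ le_rfl i j hij⟩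
      exact ⟨B, fun _ => hB⟩
  choose B hB using hshare
  obtain ⟨B', hB'⟩ := (Set.finite_range fun ij : Fin 3 × Fin 3 => B ij.1 ij.2).bddAbove
  obtain ⟨S, hS1, hST, hSB⟩ : ∃ S : ℝ, 1 ≤ S ∧ T₁ ≤ S ∧ B' ≤ S :=
    ⟨max 1 (max T₁ B'), by simp, by simp, by simp⟩
  have hpast : ∀ w, OccursInfinitely α w → ∃ n : ℤ, S ≤ n ∧ IsOrderVec α n w := fun w hw => by
    obtain ⟨t, ht, h⟩ := hw (⌈S⌉ : ℝ)
    refine ⟨⌊t⌋, ?_, h.1, fun p q hpq => ?_⟩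
    · have h1 : ⌈S⌉ ≤ ⌊t⌋ := Int.le_floor.2 ht.le
      exact (Int.le_ceil S).trans (by exact_mod_cast h1)
    · simpa only [psi_floor_s15] using h.2 p q hpq
  obtain ⟨n₁, hn₁, hn₁'⟩ := hpast _ hu
  obtain ⟨n₂, hn₂, hn₂'⟩ := hpast _ hur
  obtain ⟨T, hTS, hTn₁, hTn₂⟩ : ∃ T : ℝ, S + 1 ≤ T ∧ (n₁ : ℝ) ≤ T ∧ (n₂ : ℝ) ≤ T :=
    ⟨max (S + 1) (max n₁ n₂), by simp, by simp, by simp⟩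
  refine ⟨T, by linarith, fun t0 ht0 ts hts0 hts v hv => ?_⟩
  have hvb : Function.Bijective v := hv.1
  have hvu : v = u ∨ v = fun p => u p.rev := by
    rcases hT₁ t0 (by linarith) with h | h
    · exact Or.inl (hv.unique h)
    · exact Or.inr (hv.unique h)
  have hordv : ∀ x, S ≤ x → IsOrderVec α x v ∨ IsOrderVec α x fun p => v p.rev := by
    intro x hx
    rcases hvu with rfl | rfl
    · exact hT₁ x (hST.trans hx)
    · simpa only [Fin.rev_rev] using (hT₁ x (hST.trans hx)).symm
  have hpastv : (∃ n : ℤ, S ≤ n ∧ (n : ℝ) ≤ T ∧ IsOrderVec α n v) ∧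
      ∃ n : ℤ, S ≤ n ∧ (n : ℝ) ≤ T ∧ IsOrderVec α n fun p => v p.rev := by
    rcases hvu with rfl | rfl
    · exact ⟨⟨n₁, hn₁, hTn₁, hn₁'⟩, n₂, hn₂, hTn₂, hn₂'⟩
    · exact ⟨⟨n₂, hn₂, hTn₂, hn₂'⟩, n₁, hn₁, hTn₁, by simpa only [Fin.rev_rev] using hn₁'⟩
  have main : ∀ w : Fin 3 → Fin 3,
      (∀ x, S ≤ x → IsOrderVec α x w ∨ IsOrderVec α x fun p => w p.rev) →
      (∃ n : ℤ, S ≤ n ∧ (n : ℝ) ≤ T ∧ IsOrderVec α n fun p => w p.rev) →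
      ∀ i, T ≤ ts i → IsOrderVec α (ts i) w →
        (T ≤ ts (i + 1) ∧ IsOrderVec α (ts (i + 1)) fun p => w p.rev) ∧
        ¬ ContinuousAt (psi (α (w 0))) (ts (i + 1)) ∧
        ¬ ContinuousAt (psi (α (w 1))) (ts (i + 1)) ∧
        ContinuousAt (psi (α (w 2))) (ts (i + 1)) ∧
        ∀ t, ts i < t → t < ts (i + 1) → ContinuousAt (psi (α (w 1))) t := by
    intro w hord hpast i hi hw
    have hwb := hw.1
    obtain ⟨hlt, hnext, hon⟩ := hts.step hord (by linarith) hw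
    obtain ⟨m, hm, ha, hb, hc, hbno⟩ := isRec_at_reversal (hirr (w 0)) (hirr (w 1)) (hirr (w 2))
      hS1 (fun x hx => (hord x hx).imp (fun h => (isOrderVec_three.1 h).2)
        (isOrderVec_three_rev hwb).1)
      (fun s t h1 h2 => (hB _ _ (hwb.1.ne (by decide)) s t h1 h2).trans
        ((hB' ⟨(w 1, w 2), rfl⟩).trans hSB))
      (hpast.imp fun n h => ⟨h.1, h.2.1, (isOrderVec_three_rev hwb).1 h.2.2⟩)
      hi hlt (fun x h1 h2 => (isOrderVec_three.1 (hon x h1 h2)).2)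
      ((isOrderVec_three_rev hwb).1 hnext)
    have hm1 : 1 < m := by
      have : ((1 : ℤ) : ℝ) < m := by rw [hm]; push_cast; linarith
      exact_mod_cast this
    refine ⟨⟨by linarith, hnext⟩, ?_, ?_, ?_, fun t h1 h2 => ?_⟩
    · rw [← hm]; exact not_continuousAt_psi hm1 ha
    · rw [← hm]; exact not_continuousAt_psi hm1 hb
    · refine continuousAt_psi (by linarith) fun q hq => ?_
      rw [← hm, Int.cast_inj] at hq
      rwa [hq]
    · refine continuousAt_psi (by linarith) fun q hq => ?_
      subst hq
      exact hbno q h1 h2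
  have even_step := main v hordv hpastv.2
  have odd_step := main (fun p => v p.rev)
    (by simpa only [Fin.rev_rev] using fun x hx => (hordv x hx).symm)
    (by simpa only [Fin.rev_rev] using hpastv.1)
  simp only [Fin.rev_rev] at odd_step
  have parity : ∀ i, T ≤ ts i ∧ (Even i → IsOrderVec α (ts i) v) ∧
      (Odd i → IsOrderVec α (ts i) fun p => v p.rev) := by
    intro i
    induction i with
    | zero => exact ⟨hts0 ▸ ht0, fun _ => hts0 ▸ hv, fun h => absurd h (by decide)⟩
    | succ i ih =>
      obtain ⟨hT, he, ho⟩ := ih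
      rcases Nat.even_or_odd i with h | h
      · obtain ⟨h1, -⟩ := even_step i hT (he h)
        exact ⟨h1.1, fun h' => absurd h (Nat.even_add_one.1 h'), fun _ => h1.2⟩
      · obtain ⟨h1, -⟩ := odd_step i hT (ho h)
        exact ⟨h1.1, fun _ => h1.2, fun h' => absurd h (Nat.odd_add_one.1 h')⟩
  have at_odd : ∀ i, Odd i → ∃ j, i = j + 1 ∧ Even j := by
    rintro _ ⟨k, rfl⟩
    exact ⟨2 * k, rfl, even_two_mul k⟩
  have at_even : ∀ i, Even i → 1 ≤ i → ∃ j, i = j + 1 ∧ Odd j := by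
    intro i hi h1
    obtain ⟨j, rfl⟩ := Nat.exists_eq_add_of_le' h1
    exact ⟨j, rfl, Nat.not_even_iff_odd.1 (Nat.even_add_one.1 hi)⟩
  have even_step' := fun i (hi : Even i) => (even_step i (parity i).1 ((parity i).2.1 hi)).2
  have odd_step' := fun i (hi : Odd i) => (odd_step i (parity i).1 ((parity i).2.2 hi)).2
  refine ⟨fun i => (parity i).2.1, fun i => (parity i).2.2, fun i hi => ?_, fun i => ?_,
    fun i hi => ?_, fun i hi h2 => ?_, fun i hi h2 => ?_, fun i hi => ?_⟩
  · rcases Nat.even_or_odd i with h | h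
    · obtain ⟨j, rfl, hj⟩ := at_even i h hi
      exact (odd_step' j hj).2.1
    · obtain ⟨j, rfl, hj⟩ := at_odd i h
      exact (even_step' j hj).2.1
  · rcases Nat.even_or_odd i with h | h
    · exact (even_step' i h).2.2.2
    · exact (odd_step' i h).2.2.2
  · obtain ⟨j, rfl, hj⟩ := at_odd i hi
    exact (even_step' j hj).1
  · obtain ⟨j, rfl, hj⟩ := at_even i hi (by omega)
    exact (odd_step' j hj).2.2.1
  · obtain ⟨j, rfl, hj⟩ := at_even i hi (by omega)
    exact (odd_step' j hj).1
  · obtain ⟨j, rfl, hj⟩ := at_odd i hi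
    exact (even_step' j hj).2.2.1
end
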